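/- arXiv:2605.06780 — 7 statements merged into one kernel-verified Lean document; each statement's English description precedes it below -/
import Mathlib

section
/- Second-moment unitary twirl (Weingarten formula): for every natural number n ≥ 2 and all n×n complex matrices A and B, ∫_{U(n)} (U* A U) ⊗ (U* B U) dμ(U) = [(n · tr(A) · tr(B) − tr(AB)) / (n(n² − 1))] · I_{n²} + [(n · tr(AB) − tr(A) · tr(B)) / (n(n² − 1))] · F, where F is the swap operator on ℂ^n ⊗ ℂ^n determined by F(u ⊗ v) = v ⊗ u. -/
open MeasureTheory
open scoped Matrix Kronecker

attribute [local instance] Matrix.normedAddCommGroup Matrix.normedSpace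

/-- The Borel σ-algebra on the unitary group `U(n)` of `n × n` complex matrices. -/
noncomputable instance unitaryGroupMeasurableSpace {ι : Type*} [Fintype ι] [DecidableEq ι] :
    MeasurableSpace (Matrix.unitaryGroup ι ℂ) := borel _

instance unitaryGroupBorelSpace {ι : Type*} [Fintype ι] [DecidableEq ι] :
    BorelSpace (Matrix.unitaryGroup ι ℂ) := ⟨rfl⟩

/-- The swap operator `F` on `ℂ^n ⊗ ℂ^n`, determined by `F (u ⊗ v) = v ⊗ u`, written as a
matrix in the tensor-product (Kronecker) basis indexed by `Fin n × Fin n`. -/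
def swapMatrix (n : ℕ) : Matrix (Fin n × Fin n) (Fin n × Fin n) ℂ :=
  fun p q => if p.1 = q.2 ∧ p.2 = q.1 then 1 else 0


namespace TwirlAux
open Matrix

variable {n : ℕ}

/-- infinitesimal action -/
def D (X : Matrix (Fin n) (Fin n) ℂ) : Matrix (Fin n × Fin n) (Fin n × Fin n) ℂ :=
  X ⊗ₖ (1 : Matrix (Fin n) (Fin n) ℂ) + (1 : Matrix (Fin n) (Fin n) ℂ) ⊗ₖ X

lemma D_add (X Y : Matrix (Fin n) (Fin n) ℂ) : D (X + Y) = D X + D Y := by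
  simp only [D, add_kronecker, kronecker_add]; abel

lemma D_smul (c : ℂ) (X : Matrix (Fin n) (Fin n) ℂ) : D (c • X) = c • D X := by
  simp only [D, smul_kronecker, kronecker_smul, smul_add]

lemma commute_invol {M : Matrix (Fin n × Fin n) (Fin n × Fin n) ℂ}
    (h : ∀ V ∈ unitaryGroup (Fin n) ℂ, Commute M (V ⊗ₖ V))
    {S : Matrix (Fin n) (Fin n) ℂ} (h1 : Sᴴ = S) (h2 : S * S = 1) : Commute M (D S) := by
  have hS : Commute M (S ⊗ₖ S) := h S (by
    rw [mem_unitaryGroup_iff, star_eq_conjTranspose, h1, h2])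
  have hc : ((Real.sqrt 2 : ℝ) : ℂ) * (Real.sqrt 2 : ℝ) = 2 := by
    rw [← Complex.ofReal_mul]; norm_num
  set c : ℂ := ((Real.sqrt 2 : ℝ) : ℂ) with hcdef
  have hc0 : c ≠ 0 := by rintro h0; rw [h0] at hc; norm_num at hc
  have hcc : c⁻¹ * c⁻¹ = 1 / 2 := by rw [← mul_inv, hc]; norm_num
  have hst : star c = c := by simp [hcdef]
  have hV := h (c⁻¹ • (1 + Complex.I • S)) (by
    rw [mem_unitaryGroup_iff, star_eq_conjTranspose]
    have e : (c⁻¹ • (1 + Complex.I • S))ᴴ = c⁻¹ • (1 + (-Complex.I) • S) := by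
      rw [conjTranspose_smul, conjTranspose_add, conjTranspose_one, conjTranspose_smul, h1,
        star_inv₀, hst, Complex.star_def, Complex.conj_I]
    rw [e, smul_mul_smul_comm, hcc]
    simp only [mul_add, add_mul, one_mul, mul_one, smul_mul_smul_comm, h2, mul_neg,
      Complex.I_mul_I, neg_neg]
    module)
  have key : D S = (-2 * Complex.I) • ((c⁻¹ • (1 + Complex.I • S)) ⊗ₖ (c⁻¹ • (1 + Complex.I • S)))
      + Complex.I • (1 : Matrix (Fin n × Fin n) (Fin n × Fin n) ℂ) + (-Complex.I) • (S ⊗ₖ S) := by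
    rw [smul_kronecker, kronecker_smul, smul_smul, smul_smul, mul_assoc, hcc]
    simp only [D, add_kronecker, kronecker_add, smul_kronecker, kronecker_smul, one_kronecker_one]
    ext i j
    simp only [Matrix.add_apply, Matrix.smul_apply, smul_eq_mul]
    linear_combination (-((S ⊗ₖ (1 : Matrix (Fin n) (Fin n) ℂ)) i j)
      - ((1 : Matrix (Fin n) (Fin n) ℂ) ⊗ₖ S) i j - Complex.I * ((S ⊗ₖ S) i j)) * (-Complex.I_mul_I)
  rw [key]
  exact ((hV.smul_right _).add_right ((Commute.one_right M).smul_right _)).add_right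
    (hS.smul_right _)

lemma commute_single_diag {M : Matrix (Fin n × Fin n) (Fin n × Fin n) ℂ}
    (h : ∀ V ∈ unitaryGroup (Fin n) ℂ, Commute M (V ⊗ₖ V)) (a : Fin n) :
    Commute M (D (single a a 1)) := by
  have h1 : Commute M (D 1) := commute_invol h (by simp) (by simp)
  have h2 : Commute M (D (1 + (-2 : ℂ) • single a a 1)) := commute_invol h
    (by simp) (by
      simp only [add_mul, mul_add, one_mul, mul_one, smul_mul_smul_comm, single_mul_single_same]
      module)
  have : (single a a 1 : Matrix (Fin n) (Fin n) ℂ) =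
      (1/2 : ℂ) • 1 + (-1/2 : ℂ) • (1 + (-2 : ℂ) • single a a 1) := by module
  rw [this, D_add, D_smul, D_smul]
  exact (h1.smul_right _).add_right (h2.smul_right _)

lemma commute_single {M : Matrix (Fin n × Fin n) (Fin n × Fin n) ℂ}
    (h : ∀ V ∈ unitaryGroup (Fin n) ℂ, Commute M (V ⊗ₖ V)) (a b : Fin n) :
    Commute M (D (single a b 1)) := by
  by_cases hab : a = b
  · subst hab; exact commute_single_diag h a
  have hba : b ≠ a := Ne.symm hab
  have h1 : Commute M (D 1) := commute_invol h (by simp) (by simp)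
  have key : ∀ c : ℂ, c * star c = 1 → Commute M (D (1 + (-1 : ℂ) • single a a 1
      + (-1 : ℂ) • single b b 1 + c • single a b 1 + (star c) • single b a 1)) := by
    intro c hc
    refine commute_invol h ?_ ?_
    · simp only [conjTranspose_add, conjTranspose_smul, conjTranspose_single, star_star,
        conjTranspose_one, star_one, star_neg]
      abel
    · have hc' : star c * c = 1 := by rw [mul_comm, hc]
      simp only [add_mul, mul_add, one_mul, mul_one, smul_mul_smul_comm, single_mul_single_same,
        single_mul_single_of_ne, hab, hba, ne_eq, not_false_eq_true, smul_zero, hc, hc']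
      module
  have k1 := key 1 (by simp)
  have k2 := key Complex.I (by simp)
  have e : (single a b 1 : Matrix (Fin n) (Fin n) ℂ) =
      (1/2 : ℂ) • (1 + (-1 : ℂ) • single a a 1
      + (-1 : ℂ) • single b b 1 + (1:ℂ) • single a b 1 + (star (1:ℂ)) • single b a 1)
      + (-Complex.I/2 : ℂ) • (1 + (-1 : ℂ) • single a a 1
      + (-1 : ℂ) • single b b 1 + Complex.I • single a b 1 + (star Complex.I) • single b a 1)
      + ((Complex.I - 1)/2) • 1 + ((1 - Complex.I)/2) • single a a 1
      + ((1 - Complex.I)/2) • single b b 1 := by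
    ext i j
    simp only [Matrix.add_apply, Matrix.smul_apply, smul_eq_mul, star_one, Complex.star_def, Complex.conj_I]
    linear_combination ((single a b 1 : Matrix (Fin n) (Fin n) ℂ) i j
      - (single b a 1 : Matrix (Fin n) (Fin n) ℂ) i j) / 2 * Complex.I_mul_I
  rw [e]
  rw [D_add, D_add, D_add, D_add, D_smul, D_smul, D_smul, D_smul, D_smul]
  exact ((((k1.smul_right _).add_right (k2.smul_right _)).add_right (h1.smul_right _)).add_right
    ((commute_single_diag h a).smul_right _)).add_right ((commute_single_diag h b).smul_right _)

lemma entry_eq {M : Matrix (Fin n × Fin n) (Fin n × Fin n) ℂ}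
    (h : ∀ V ∈ unitaryGroup (Fin n) ℂ, Commute M (V ⊗ₖ V)) (a b p q r s : Fin n) :
    (if r = b then M (p, q) (a, s) else 0) + (if s = b then M (p, q) (r, a) else 0)
      = (if p = a then M (b, q) (r, s) else 0) + (if q = a then M (p, b) (r, s) else 0) := by
  have := congrFun (congrFun (commute_single h a b).eq (p, q)) (r, s)
  simp only [D, mul_add, add_mul, Matrix.add_apply, Matrix.mul_apply, kronecker_apply, single_apply, Matrix.one_apply,
    Fintype.sum_prod_type] at this
  simp only [mul_ite, ite_mul, mul_one, mul_zero, one_mul, zero_mul, ite_and,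
    Finset.sum_add_distrib, Finset.sum_ite_eq, Finset.sum_ite_eq', Finset.mem_univ, if_true, Finset.sum_const_zero,
    Finset.sum_ite_irrel] at this
  simp only [eq_comm (a := a) (b := p), eq_comm (a := a) (b := q), eq_comm (a := b) (b := r), eq_comm (a := b) (b := s)] at this
  exact this

lemma formula (hn : 2 ≤ n) {M : Matrix (Fin n × Fin n) (Fin n × Fin n) ℂ}
    (h : ∀ V ∈ unitaryGroup (Fin n) ℂ, Commute M (V ⊗ₖ V)) {t f : ℂ}
    (ht : ∑ p, ∑ q, M (p, q) (p, q) = t) (hf : ∑ p, ∑ q, M (p, q) (q, p) = f) :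
    M = (((n : ℂ) * t - f) / ((n : ℂ) * ((n : ℂ) ^ 2 - 1))) • 1
      + (((n : ℂ) * f - t) / ((n : ℂ) * ((n : ℂ) ^ 2 - 1))) • swapMatrix n := by
  have E := entry_eq h
  have hT1 : ∀ q s, (n : ℂ) * ∑ b, M (b, q) (b, s) = if q = s then t else 0 := by
    intro q a
    have e1 : ∀ b, ∑ p, M (p, q) (p, a) = if q = a then ∑ p, M (p, b) (p, b) else 0 := by
      intro b
      have := Finset.sum_congr (rfl : (Finset.univ : Finset (Fin n)) = Finset.univ)
        (fun p _ => E a b p q p b)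
      simp only [Finset.sum_add_distrib, Finset.sum_ite_eq', Finset.mem_univ, if_true,
        Finset.sum_ite_irrel, Finset.sum_const_zero] at this
      exact add_left_cancel this
    have := Finset.sum_congr (rfl : (Finset.univ : Finset (Fin n)) = Finset.univ) (fun b _ => e1 b)
    simp only [Finset.sum_const, Finset.card_univ, Fintype.card_fin, nsmul_eq_mul,
      Finset.sum_ite_irrel, mul_zero] at this
    rw [this, Finset.sum_comm, ht]
  have hT2 : ∀ p s, (n : ℂ) * ∑ b, M (p, b) (b, s) = if p = s then f else 0 := by
    intro p a
    have e1 : ∀ b, ∑ q, M (p, q) (q, a) = if p = a then ∑ q, M (b, q) (q, b) else 0 := by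
      intro b
      have := Finset.sum_congr (rfl : (Finset.univ : Finset (Fin n)) = Finset.univ)
        (fun q _ => E a b p q q b)
      simp only [Finset.sum_add_distrib, Finset.sum_ite_eq', Finset.mem_univ, if_true,
        Finset.sum_ite_irrel, Finset.sum_const_zero] at this
      rw [add_comm (M _ _)] at this
      exact add_right_cancel this
    have := Finset.sum_congr (rfl : (Finset.univ : Finset (Fin n)) = Finset.univ) (fun b _ => e1 b)
    simp only [Finset.sum_const, Finset.card_univ, Fintype.card_fin, nsmul_eq_mul,
      Finset.sum_ite_irrel, mul_zero] at this
    rw [this, hf]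
  have main : ∀ p q r s, (n : ℂ) * (n * M (p, q) (r, s) + M (p, q) (s, r))
      = (if p = r then (if q = s then t else 0) else 0)
        + (if q = r then (if p = s then f else 0) else 0) := by
    intro p q a s
    have := Finset.sum_congr (rfl : (Finset.univ : Finset (Fin n)) = Finset.univ)
        (fun b _ => E a b p q b s)
    simp only [Finset.sum_add_distrib, Finset.sum_ite_eq, Finset.mem_univ, if_true,
      Finset.sum_ite_irrel, Finset.sum_const_zero, Finset.sum_const, Finset.card_univ,
      Fintype.card_fin, nsmul_eq_mul] at this
    rw [this, mul_add, mul_ite, mul_ite, hT1, hT2, mul_zero]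
  have hn0 : (n : ℂ) ≠ 0 := by
    have : n ≠ 0 := by omega
    exact_mod_cast this
  have hn1 : (n : ℂ) ^ 2 - 1 ≠ 0 := by
    intro h0
    have h1 : (n : ℂ) ^ 2 = 1 := by linear_combination h0
    have h2 : n ^ 2 = 1 := by exact_mod_cast h1
    nlinarith
  ext ⟨p, q⟩ ⟨r, s⟩
  have m1 := main p q r s
  have m2 := main p q s r
  simp only [Matrix.add_apply, Matrix.smul_apply, Matrix.one_apply, swapMatrix, smul_eq_mul, Prod.mk.injEq]
  have key : (n : ℂ) * ((n : ℂ) ^ 2 - 1) * M (p, q) (r, s)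
      = ((n : ℂ) * t - f) * (if p = r ∧ q = s then 1 else 0)
        + ((n : ℂ) * f - t) * (if p = s ∧ q = r then 1 else 0) := by
    have : (n : ℂ) * ((n : ℂ) ^ 2 - 1) * M (p, q) (r, s) =
      n * ((n : ℂ) * (n * M (p, q) (r, s) + M (p, q) (s, r)))
      - (n : ℂ) * (n * M (p, q) (s, r) + M (p, q) (r, s)) := by ring
    rw [this, m1, m2]
    have w : ∀ (P Q : Prop) [Decidable P] [Decidable Q] (x : ℂ),
        (if P then (if Q then x else 0) else 0) = x * (if P ∧ Q then 1 else 0) := by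
      intro P Q _ _ x
      by_cases hP : P <;> by_cases hQ : Q <;> simp [hP, hQ]
    simp only [w, and_comm (a := q = r), and_comm (a := q = s)]
    ring
  have hne : (n : ℂ) * ((n : ℂ) ^ 2 - 1) ≠ 0 := mul_ne_zero hn0 hn1
  field_simp
  linear_combination key

lemma isCompact_unitary : CompactSpace (unitaryGroup (Fin n) ℂ) := by
  haveI : ProperSpace (Matrix (Fin n) (Fin n) ℂ) := FiniteDimensional.proper ℂ _
  refine isCompact_iff_compactSpace.mp (Metric.isCompact_of_isClosed_isBounded ?_ ?_)
  · have : ((unitaryGroup (Fin n) ℂ : Set (Matrix (Fin n) (Fin n) ℂ)))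
        = {U | U * Uᴴ = 1} := by
      ext U; exact mem_unitaryGroup_iff
    rw [this]
    exact isClosed_eq (by fun_prop) continuous_const
  · refine (Metric.isBounded_closedBall (x := 0) (r := 1)).subset ?_
    intro U hU
    rw [mem_closedBall_zero_iff, Matrix.norm_le_iff zero_le_one]
    exact fun i j => entry_norm_bound_of_unitary hU i j

/-- the integrand -/
def T (A B U : Matrix (Fin n) (Fin n) ℂ) : Matrix (Fin n × Fin n) (Fin n × Fin n) ℂ :=
  (Uᴴ * A * U) ⊗ₖ (Uᴴ * B * U)

lemma T_cont (A B : Matrix (Fin n) (Fin n) ℂ) :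
    Continuous (fun U : unitaryGroup (Fin n) ℂ => T A B (U : Matrix (Fin n) (Fin n) ℂ)) := by
  have hU : Continuous (fun U : unitaryGroup (Fin n) ℂ => (U : Matrix (Fin n) (Fin n) ℂ)) :=
    continuous_subtype_val
  have h (C : Matrix (Fin n) (Fin n) ℂ) : Continuous (fun U : unitaryGroup (Fin n) ℂ =>
    (U : Matrix (Fin n) (Fin n) ℂ)ᴴ * C * (U : Matrix (Fin n) (Fin n) ℂ)) := by fun_prop
  refine continuous_matrix fun i j => ?_
  simp only [T, kronecker_apply]
  exact ((h A).matrix_elem _ _).mul ((h B).matrix_elem _ _)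

lemma int_gen {X E F : Type*} [TopologicalSpace X] [CompactSpace X] [MeasurableSpace X]
    [BorelSpace X] (μ : Measure X) [IsProbabilityMeasure μ] [NormedAddCommGroup E]
    [NormedSpace ℂ E] [FiniteDimensional ℂ E] [NormedAddCommGroup F] [NormedSpace ℂ F]
    [CompleteSpace F] {f : X → E} (hf : Continuous f) (L : E →ₗ[ℂ] F) :
    L (∫ x, f x ∂μ) = ∫ x, L (f x) ∂μ := by
  have : CompleteSpace E := FiniteDimensional.complete ℂ E
  have hi : Integrable f μ :=
    hf.integrable_of_hasCompactSupport (HasCompactSupport.of_compactSpace _)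
  exact ((LinearMap.toContinuousLinearMap L).integral_comp_comm hi).symm

lemma int_comp {F : Type*} [NormedAddCommGroup F] [NormedSpace ℂ F] [CompleteSpace F]
    (μ : Measure (unitaryGroup (Fin n) ℂ)) [IsProbabilityMeasure μ]
    (A B : Matrix (Fin n) (Fin n) ℂ)
    (L : Matrix (Fin n × Fin n) (Fin n × Fin n) ℂ →ₗ[ℂ] F) :
    L (∫ U : unitaryGroup (Fin n) ℂ, T A B (U : Matrix (Fin n) (Fin n) ℂ) ∂μ)
      = ∫ U : unitaryGroup (Fin n) ℂ, L (T A B (U : Matrix (Fin n) (Fin n) ℂ)) ∂μ := by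
  have := isCompact_unitary (n := n)
  exact int_gen μ (T_cont A B) L

lemma T_commute (μ : Measure (unitaryGroup (Fin n) ℂ)) [IsProbabilityMeasure μ]
    [μ.IsMulRightInvariant] (A B : Matrix (Fin n) (Fin n) ℂ) :
    ∀ V ∈ unitaryGroup (Fin n) ℂ,
      Commute (∫ U : unitaryGroup (Fin n) ℂ, T A B (U : Matrix (Fin n) (Fin n) ℂ) ∂μ)
        (V ⊗ₖ V) := by
  intro V hV
  have hV' : V * Vᴴ = 1 := mem_unitaryGroup_iff.mp hV
  set M := ∫ U : unitaryGroup (Fin n) ℂ, T A B (U : Matrix (Fin n) (Fin n) ℂ) ∂μ with hM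
  let L : Matrix (Fin n × Fin n) (Fin n × Fin n) ℂ →ₗ[ℂ]
      Matrix (Fin n × Fin n) (Fin n × Fin n) ℂ :=
    (LinearMap.mulRight ℂ (V ⊗ₖ V)).comp (LinearMap.mulLeft ℂ (Vᴴ ⊗ₖ Vᴴ))
  have hL : L M = M := by
    rw [hM, int_comp μ A B L]
    rw [← integral_mul_right_eq_self (μ := μ)
      (fun U : unitaryGroup (Fin n) ℂ => T A B (U : Matrix (Fin n) (Fin n) ℂ)) ⟨V, hV⟩]
    congr 1
    funext U
    simp only [L, LinearMap.comp_apply, LinearMap.mulRight_apply, LinearMap.mulLeft_apply, T,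
      ← mul_kronecker_mul, Submonoid.coe_mul, conjTranspose_mul, Matrix.mul_assoc]
  have hL' : (Vᴴ ⊗ₖ Vᴴ) * M * (V ⊗ₖ V) = M := hL
  have hVV : (V ⊗ₖ V) * (Vᴴ ⊗ₖ Vᴴ) = 1 := by
    rw [← mul_kronecker_mul, hV', one_kronecker_one]
  change M * (V ⊗ₖ V) = (V ⊗ₖ V) * M
  conv_rhs => rw [← hL']
  rw [← Matrix.mul_assoc, ← Matrix.mul_assoc, hVV, Matrix.one_mul]

/-- the trace functionals -/
def tr1 (n : ℕ) : Matrix (Fin n × Fin n) (Fin n × Fin n) ℂ →ₗ[ℂ] ℂ where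
  toFun M := ∑ p, ∑ q, M (p, q) (p, q)
  map_add' X Y := by simp only [Matrix.add_apply, Finset.sum_add_distrib]
  map_smul' c X := by simp only [Matrix.smul_apply, Finset.smul_sum, RingHom.id_apply]

/-- the swapped trace functional -/
def tr2 (n : ℕ) : Matrix (Fin n × Fin n) (Fin n × Fin n) ℂ →ₗ[ℂ] ℂ where
  toFun M := ∑ p, ∑ q, M (p, q) (q, p)
  map_add' X Y := by simp only [Matrix.add_apply, Finset.sum_add_distrib]
  map_smul' c X := by simp only [Matrix.smul_apply, Finset.smul_sum, RingHom.id_apply]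

lemma conj_trace (A : Matrix (Fin n) (Fin n) ℂ) (U : unitaryGroup (Fin n) ℂ) :
    ((U : Matrix (Fin n) (Fin n) ℂ)ᴴ * A * (U : Matrix (Fin n) (Fin n) ℂ)).trace = A.trace := by
  have : (U : Matrix (Fin n) (Fin n) ℂ) * (U : Matrix (Fin n) (Fin n) ℂ)ᴴ = 1 :=
    mem_unitaryGroup_iff.mp U.2
  rw [trace_mul_comm, ← Matrix.mul_assoc, this, Matrix.one_mul]

lemma tr1_T (A B : Matrix (Fin n) (Fin n) ℂ) (U : unitaryGroup (Fin n) ℂ) :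
    tr1 n (T A B (U : Matrix (Fin n) (Fin n) ℂ)) = A.trace * B.trace := by
  rw [← conj_trace A U, ← conj_trace B U]
  simp only [tr1, LinearMap.coe_mk, AddHom.coe_mk, T, kronecker_apply, trace, diag_apply,
    Finset.sum_mul_sum]

lemma tr2_T (A B : Matrix (Fin n) (Fin n) ℂ) (U : unitaryGroup (Fin n) ℂ) :
    tr2 n (T A B (U : Matrix (Fin n) (Fin n) ℂ)) = (A * B).trace := by
  have hU : (U : Matrix (Fin n) (Fin n) ℂ) * (U : Matrix (Fin n) (Fin n) ℂ)ᴴ = 1 :=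
    mem_unitaryGroup_iff.mp U.2
  have e : (U : Matrix (Fin n) (Fin n) ℂ)ᴴ * (A * B) * (U : Matrix (Fin n) (Fin n) ℂ)
      = ((U : Matrix (Fin n) (Fin n) ℂ)ᴴ * A * (U : Matrix (Fin n) (Fin n) ℂ)) *
        ((U : Matrix (Fin n) (Fin n) ℂ)ᴴ * B * (U : Matrix (Fin n) (Fin n) ℂ)) := by
    calc _ = (U : Matrix (Fin n) (Fin n) ℂ)ᴴ * A * 1 * B * (U : Matrix (Fin n) (Fin n) ℂ) := by
          simp only [Matrix.mul_assoc, Matrix.one_mul]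
      _ = _ := by rw [← hU]; simp only [Matrix.mul_assoc]
  rw [← conj_trace (A * B) U, e]
  simp only [tr2, LinearMap.coe_mk, AddHom.coe_mk, T, kronecker_apply, trace, diag_apply]
  simp only [Matrix.mul_apply (M := _ * _ * _) (N := _ * _ * _)]

end TwirlAux

/-- **Second-moment unitary twirl (Weingarten formula).**  For `n ≥ 2` and all `n × n`
complex matrices `A`, `B`, the Haar average (over the Haar probability measure, i.e. the
left- and right-invariant Borel probability measure on `U(n)`) of
`(Uᴴ A U) ⊗ (Uᴴ B U)` equals
`((n·tr A·tr B − tr (AB)) / (n(n²−1))) • 1 + ((n·tr (AB) − tr A·tr B) / (n(n²−1))) • F`. -/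
theorem haar_second_moment_twirl (n : ℕ) (hn : 2 ≤ n)
    (μ : Measure (Matrix.unitaryGroup (Fin n) ℂ))
    [IsProbabilityMeasure μ] [μ.IsMulLeftInvariant] [μ.IsMulRightInvariant]
    (A B : Matrix (Fin n) (Fin n) ℂ) :
    ∫ (U : Matrix.unitaryGroup (Fin n) ℂ),
        ((U : Matrix (Fin n) (Fin n) ℂ)ᴴ * A * (U : Matrix (Fin n) (Fin n) ℂ)) ⊗ₖ
          ((U : Matrix (Fin n) (Fin n) ℂ)ᴴ * B * (U : Matrix (Fin n) (Fin n) ℂ)) ∂μ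
      = (((n : ℂ) * A.trace * B.trace - (A * B).trace) / ((n : ℂ) * ((n : ℂ) ^ 2 - 1))) •
            (1 : Matrix (Fin n × Fin n) (Fin n × Fin n) ℂ)
        + (((n : ℂ) * (A * B).trace - A.trace * B.trace) / ((n : ℂ) * ((n : ℂ) ^ 2 - 1))) •
            swapMatrix n := by
  have h1 : TwirlAux.tr1 n (∫ U : Matrix.unitaryGroup (Fin n) ℂ,
      TwirlAux.T A B (U : Matrix (Fin n) (Fin n) ℂ) ∂μ) = A.trace * B.trace := by
    rw [TwirlAux.int_comp]; simp [TwirlAux.tr1_T]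
  have h2 : TwirlAux.tr2 n (∫ U : Matrix.unitaryGroup (Fin n) ℂ,
      TwirlAux.T A B (U : Matrix (Fin n) (Fin n) ℂ) ∂μ) = (A * B).trace := by
    rw [TwirlAux.int_comp]; simp [TwirlAux.tr2_T]
  have := TwirlAux.formula hn (TwirlAux.T_commute μ A B) h1 h2
  rw [mul_assoc (n : ℂ) A.trace]
  exact this
end

section
/- General fluctuation formula: assume Pd ≥ 2. For all unit vectors ψ₁, ψ₂ ∈ ℂ^{Pd} ⊗ ℂ^m, ∫ |⟨ψ₁, V(U)†V(U) ψ₂⟩ − ⟨ψ₁, ψ₂⟩|² dμ(U) = ((P − 1)/(P²d² − 1)) · [P·d · tr(ψ₁^out ψ₂^out) − |⟨ψ₁, ψ₂⟩|²]. -/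
open MeasureTheory ComplexConjugate
open scoped Matrix

/-- The standard Hermitian inner product `⟨f, g⟩ = ∑ x, conj (f x) * g x`. -/
noncomputable def inn {ι : Type*} [Fintype ι] (f g : ι → ℂ) : ℂ :=
  ∑ x, conj (f x) * g x

/-- The single-layer slice-normal map
`V(U) = √P (⟨0|_P ⊗ Id_d) U ⊗ Id_m : ℂ^{Pd} ⊗ ℂ^m → ℂ^d ⊗ ℂ^m`, given entrywise by
`(V(U)ψ)(j, y) = √P · ∑ x, U((0, j), x) · ψ(x, y)`. -/
noncomputable def sliceV (P d m : ℕ) (hP : 0 < P)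
    (U : Matrix.unitaryGroup (Fin P × Fin d) ℂ)
    (ψ : (Fin P × Fin d) × Fin m → ℂ) : Fin d × Fin m → ℂ :=
  fun jy => (Real.sqrt P : ℂ) *
    ∑ x : Fin P × Fin d,
      (U : Matrix (Fin P × Fin d) (Fin P × Fin d) ℂ) ((⟨0, hP⟩ : Fin P), jy.1) x * ψ (x, jy.2)

/-- The reduced density matrix of `ψ ∈ ℂ^{Pd} ⊗ ℂ^m` on the out factor `ℂ^m`:
`ψ^out(y, y') = ∑ x, ψ(x, y) · conj (ψ(x, y'))`. -/
noncomputable def outMat (P d m : ℕ) (ψ : (Fin P × Fin d) × Fin m → ℂ) :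
    Matrix (Fin m) (Fin m) ℂ :=
  fun y y' => ∑ x : Fin P × Fin d, ψ (x, y) * conj (ψ (x, y'))


section helpers

variable {ι : Type*} [Fintype ι] [DecidableEq ι]

/-- second moment -/
noncomputable def secMom (μ : Measure (Matrix.unitaryGroup ι ℂ))
    (B : Matrix.unitaryGroup ι ℂ → Matrix ι ι ℂ) (p q : ι × ι) : ℂ :=
  ∫ U, B U p.1 p.2 * conj (B U q.1 q.2) ∂μ

theorem secMom_integrable (μ : Measure (Matrix.unitaryGroup ι ℂ)) [IsProbabilityMeasure μ]
    (B : Matrix.unitaryGroup ι ℂ → Matrix ι ι ℂ) (hB : ∀ i j, Continuous fun U => B U i j)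
    (C : ℝ) (hC : ∀ U i j, ‖B U i j‖ ≤ C) (p q : ι × ι) :
    Integrable (fun U => B U p.1 p.2 * conj (B U q.1 q.2)) μ := by
  have hc : Continuous fun U => B U p.1 p.2 * conj (B U q.1 q.2) :=
    (hB _ _).mul (Complex.continuous_conj.comp (hB _ _))
  refine Integrable.of_bound hc.measurable.aestronglyMeasurable (C * C) (Filter.Eventually.of_forall ?_)
  intro U
  rw [norm_mul, RCLike.norm_conj]
  exact mul_le_mul (hC _ _ _) (hC _ _ _) (norm_nonneg _) ((norm_nonneg _).trans (hC U p.1 p.2))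

theorem secMom_sum (μ : Measure (Matrix.unitaryGroup ι ℂ)) [IsProbabilityMeasure μ]
    (B : Matrix.unitaryGroup ι ℂ → Matrix ι ι ℂ) (hB : ∀ i j, Continuous fun U => B U i j)
    (C : ℝ) (hC : ∀ U i j, ‖B U i j‖ ≤ C) {κ : Type*} [Fintype κ] (v : κ → ι × ι) (c : κ → ℂ) :
    ∫ U, (∑ k, c k * B U (v k).1 (v k).2) * conj (∑ k, c k * B U (v k).1 (v k).2) ∂μ
      = ∑ k, ∑ l, c k * conj (c l) * secMom μ B (v k) (v l) := by
  have hi := secMom_integrable μ B hB C hC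
  have : ∀ U, (∑ k, c k * B U (v k).1 (v k).2) * conj (∑ k, c k * B U (v k).1 (v k).2)
      = ∑ k, ∑ l, (c k * conj (c l)) * (B U (v k).1 (v k).2 * conj (B U (v l).1 (v l).2)) := by
    intro U
    rw [map_sum, Finset.sum_mul_sum]
    refine Finset.sum_congr rfl fun k _ => Finset.sum_congr rfl fun l _ => ?_
    rw [map_mul]; ring
  simp_rw [this]
  rw [integral_finsetSum _ fun k _ => integrable_finsetSum _ fun l _ => (hi _ _).const_mul _]
  refine Finset.sum_congr rfl fun k _ => ?_
  rw [integral_finsetSum _ fun l _ => (hi _ _).const_mul _]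
  refine Finset.sum_congr rfl fun l _ => ?_
  rw [integral_const_mul]; rfl

theorem secMom_inv (μ : Measure (Matrix.unitaryGroup ι ℂ)) [μ.IsMulRightInvariant]
    (B : Matrix.unitaryGroup ι ℂ → Matrix ι ι ℂ)
    (hW : ∀ U W : Matrix.unitaryGroup ι ℂ, B (U * W) = (W : Matrix ι ι ℂ)ᴴ * B U * W)
    (W : Matrix.unitaryGroup ι ℂ) (p q : ι × ι) :
    secMom μ B p q = ∫ U, ((W : Matrix ι ι ℂ)ᴴ * B U * W) p.1 p.2 *
      conj (((W : Matrix ι ι ℂ)ᴴ * B U * W) q.1 q.2) ∂μ := by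
  unfold secMom
  rw [← integral_mul_right_eq_self _ W]
  simp_rw [hW]

theorem secMom_diag (μ : Measure (Matrix.unitaryGroup ι ℂ)) [μ.IsMulRightInvariant]
    (B : Matrix.unitaryGroup ι ℂ → Matrix ι ι ℂ)
    (hW : ∀ U W : Matrix.unitaryGroup ι ℂ, B (U * W) = (W : Matrix ι ι ℂ)ᴴ * B U * W)
    (θ : ι → ℂ) (hθ : ∀ i, θ i * conj (θ i) = 1) (p q : ι × ι) :
    secMom μ B p q = (conj (θ p.1) * θ p.2 * (θ q.1 * conj (θ q.2))) * secMom μ B p q := by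
  have hmem : Matrix.diagonal θ ∈ Matrix.unitaryGroup ι ℂ := by
    rw [Matrix.mem_unitaryGroup_iff, Matrix.star_eq_conjTranspose, Matrix.diagonal_conjTranspose,
      Matrix.diagonal_mul_diagonal, ← Matrix.diagonal_one]
    congr 1; funext i; exact hθ i
  conv_lhs => rw [secMom_inv μ B hW ⟨_, hmem⟩]
  unfold secMom
  rw [← integral_const_mul]
  congr 1; funext U
  simp only [Matrix.diagonal_conjTranspose, Matrix.mul_diagonal, Matrix.diagonal_mul, map_mul,
    Pi.star_apply, RCLike.star_def, Complex.conj_conj]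
  ring

theorem secMom_perm (μ : Measure (Matrix.unitaryGroup ι ℂ)) [μ.IsMulRightInvariant]
    (B : Matrix.unitaryGroup ι ℂ → Matrix ι ι ℂ)
    (hW : ∀ U W : Matrix.unitaryGroup ι ℂ, B (U * W) = (W : Matrix ι ι ℂ)ᴴ * B U * W)
    (σ : Equiv.Perm ι) (p q : ι × ι) :
    secMom μ B p q = secMom μ B (σ p.1, σ p.2) (σ q.1, σ q.2) := by
  have hmem : (1 : Matrix ι ι ℂ).submatrix id σ ∈ Matrix.unitaryGroup ι ℂ := by
    rw [Matrix.mem_unitaryGroup_iff, Matrix.star_eq_conjTranspose, Matrix.conjTranspose_submatrix,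
      Matrix.submatrix_mul_equiv]
    simp
  have key : ∀ (A : Matrix ι ι ℂ) i j, (((1 : Matrix ι ι ℂ).submatrix id σ)ᴴ * A *
      (1 : Matrix ι ι ℂ).submatrix id σ) i j = A (σ i) (σ j) := by
    intro A i j
    simp [Matrix.mul_apply, Matrix.one_apply]
  rw [secMom_inv μ B hW ⟨_, hmem⟩]
  unfold secMom
  simp_rw [key]

theorem secMom_zero (μ : Measure (Matrix.unitaryGroup ι ℂ)) [μ.IsMulRightInvariant]
    (B : Matrix.unitaryGroup ι ℂ → Matrix ι ι ℂ)
    (hW : ∀ U W : Matrix.unitaryGroup ι ℂ, B (U * W) = (W : Matrix ι ι ℂ)ᴴ * B U * W)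
    (x x' w w' : ι) (h1 : ¬ (x = x' ∧ w = w')) (h2 : ¬ (x = w ∧ x' = w')) :
    secMom μ B (x, x') (w, w') = 0 := by
  have key : ∀ k : ι, secMom μ B (x, x') (w, w') = _ :=
    fun k => secMom_diag μ B hW (fun i => if i = k then Complex.I else 1)
      (by intro i; by_cases h : i = k <;> simp [h]) (x, x') (w, w')
  by_contra hne
  have key2 : ∀ k : ι, _ = (1 : ℂ) := fun k => (mul_right_cancel₀ hne ((one_mul _).trans (key k))).symm
  have n1 : (Complex.I : ℂ) ≠ 1 := fun h => by simpa using congrArg Complex.re h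
  have n2 : (-Complex.I : ℂ) ≠ 1 := fun h => by simpa using congrArg Complex.re h
  have n3 : (-1 : ℂ) ≠ 1 := by norm_num
  by_cases e1 : x = x'
  · subst e1
    have e2 : w ≠ w' := fun h => h1 ⟨rfl, h⟩
    have a := key2 w
    by_cases e : x = w <;> simp [e, e2.symm, n1] at a
  · by_cases e3 : x = w
    · subst e3
      have e4 : x' ≠ w' := fun h => h2 ⟨rfl, h⟩
      have a := key2 x'
      simp [e1, e4.symm, n1] at a
    · have a := key2 x
      have e1' : x' ≠ x := fun h => e1 h.symm
      have e3' : w ≠ x := fun h => e3 h.symm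
      by_cases e : w' = x
      · simp [e, e1', e3'] at a
        exact n3 a
      · simp [e, e1', e3', n2] at a

theorem secMom_mix (μ : Measure (Matrix.unitaryGroup ι ℂ)) [IsProbabilityMeasure μ]
    [μ.IsMulRightInvariant]
    (B : Matrix.unitaryGroup ι ℂ → Matrix ι ι ℂ) (hB : ∀ i j, Continuous fun U => B U i j)
    (C : ℝ) (hC : ∀ U i j, ‖B U i j‖ ≤ C)
    (hW : ∀ U W : Matrix.unitaryGroup ι ℂ, B (U * W) = (W : Matrix ι ι ℂ)ᴴ * B U * W)
    (x y : ι) (hxy : x ≠ y) :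
    secMom μ B (x, x) (x, x) = secMom μ B (x, x) (y, y) + secMom μ B (x, y) (x, y) := by
  set S : Matrix ι ι ℂ := (1 : Matrix ι ι ℂ).submatrix id (Equiv.swap x y) with hS
  have hSS : S * S = 1 := by
    ext i j
    simp [hS, Matrix.mul_apply, Matrix.one_apply]
  have hSH : Sᴴ = S := by
    ext i j
    have : j = Equiv.swap x y i ↔ i = Equiv.swap x y j := by
      rw [eq_comm, Equiv.swap_apply_eq_iff]
    simp [hS, Matrix.one_apply, this]
  set W : Matrix ι ι ℂ := ((1 + Complex.I) / 2) • (1 : Matrix ι ι ℂ) + ((Complex.I - 1) / 2) • S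
    with hWd
  have hWH : Wᴴ = ((1 - Complex.I) / 2) • (1 : Matrix ι ι ℂ) + ((-Complex.I - 1) / 2) • S := by
    simp [hWd, Matrix.conjTranspose_add, Matrix.conjTranspose_smul, hSH, sub_eq_add_neg]
  have hI := Complex.I_mul_I
  have hmem : W ∈ Matrix.unitaryGroup ι ℂ := by
    rw [Matrix.mem_unitaryGroup_iff, Matrix.star_eq_conjTranspose, hWH, hWd]
    simp only [add_mul, mul_add, smul_mul_assoc, mul_smul_comm, one_mul, mul_one, hSS]
    match_scalars
    · ring_nf; simp; try norm_num
    · ring_nf; simp; try norm_num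
  have key : ∀ A : Matrix ι ι ℂ, (Wᴴ * A * W) x x = ∑ k : Fin 4,
      (![1/2, 1/2, Complex.I/2, -Complex.I/2] : Fin 4 → ℂ) k *
      A ((![(x,x),(y,y),(x,y),(y,x)] : Fin 4 → ι × ι) k).1
        ((![(x,x),(y,y),(x,y),(y,x)] : Fin 4 → ι × ι) k).2 := by
    intro A
    have hsw : ∀ j, x = Equiv.swap x y j ↔ j = y := by
      intro j
      rw [eq_comm, Equiv.swap_apply_eq_iff, Equiv.swap_apply_left]
    have e1 : (S * A) x x = A y x := by
      simp [hS, Matrix.mul_apply, Matrix.one_apply, hsw]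
    have e2 : (A * S) x x = A x y := by
      simp [hS, Matrix.mul_apply, Matrix.one_apply]
    have e3 : (S * A * S) x x = A y y := by
      simp [hS, Matrix.mul_apply, Matrix.one_apply, hsw]
    rw [hWH, hWd]
    simp only [add_mul, mul_add, smul_mul_assoc, mul_smul_comm, one_mul, mul_one,
      Matrix.add_apply, Matrix.smul_apply, e1, e2, e3, Fin.sum_univ_four, smul_eq_mul]
    simp
    ring_nf
    simp
    ring
  have h := secMom_inv μ B hW ⟨W, hmem⟩ (x, x) (x, x)
  simp only [key] at h
  rw [secMom_sum μ B hB C hC] at h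
  have z := secMom_zero μ B hW
  have s1 := secMom_perm μ B hW (Equiv.swap x y) (x, x) (x, x)
  have s2 := secMom_perm μ B hW (Equiv.swap x y) (x, x) (y, y)
  have s3 := secMom_perm μ B hW (Equiv.swap x y) (x, y) (x, y)
  have hyx := hxy.symm
  simp only [Equiv.swap_apply_left, Equiv.swap_apply_right] at s1 s2 s3
  simp [Fin.sum_univ_four, show (starRingEnd ℂ) 2 = 2 from Complex.conj_ofNat 2] at h
  rw [z x x x y, z x x y x, z y y x y, z y y y x, z x y x x, z x y y y, z y x x x, z y x y y,
    z x y y x, z y x x y, ← s1, ← s2, ← s3] at h <;> first | simp [hxy, hyx] | skip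
  linear_combination 2 * h - secMom μ B (x, y) (x, y) * hI

theorem secMom_formula (μ : Measure (Matrix.unitaryGroup ι ℂ)) [IsProbabilityMeasure μ]
    [μ.IsMulRightInvariant]
    (B : Matrix.unitaryGroup ι ℂ → Matrix ι ι ℂ) (hB : ∀ i j, Continuous fun U => B U i j)
    (C : ℝ) (hC : ∀ U i j, ‖B U i j‖ ≤ C)
    (hW : ∀ U W : Matrix.unitaryGroup ι ℂ, B (U * W) = (W : Matrix ι ι ℂ)ᴴ * B U * W)
    (i0 i1 : ι) (h01 : i0 ≠ i1) : ∃ a b : ℂ, ∀ x x' w w', secMom μ B (x, x') (w, w') =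
      a * (if x = x' ∧ w = w' then 1 else 0) + b * (if x = w ∧ x' = w' then 1 else 0) := by
  have hσ : ∀ x y : ι, x ≠ y → ∃ σ : Equiv.Perm ι, σ x = i0 ∧ σ y = i1 := by
    intro x y hxy
    have h1 : Equiv.swap x i0 y ≠ i0 := by
      intro h
      rw [Equiv.swap_apply_eq_iff, Equiv.swap_apply_right] at h
      exact hxy h.symm
    refine ⟨(Equiv.swap x i0).trans (Equiv.swap (Equiv.swap x i0 y) i1), ?_, ?_⟩
    · simp [Equiv.swap_apply_of_ne_of_ne h1.symm h01]
    · simp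
  refine ⟨secMom μ B (i0, i0) (i1, i1), secMom μ B (i0, i1) (i0, i1), ?_⟩
  have hb : ∀ x y, x ≠ y → secMom μ B (x, x) (y, y) = secMom μ B (i0, i0) (i1, i1) := by
    intro x y hxy
    obtain ⟨σ, h1, h2⟩ := hσ x y hxy
    rw [secMom_perm μ B hW σ]; simp [h1, h2]
  have hg : ∀ x y, x ≠ y → secMom μ B (x, y) (x, y) = secMom μ B (i0, i1) (i0, i1) := by
    intro x y hxy
    obtain ⟨σ, h1, h2⟩ := hσ x y hxy
    rw [secMom_perm μ B hW σ]; simp [h1, h2]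
  intro x x' w w'
  by_cases h1 : x = x' ∧ w = w'
  · obtain ⟨rfl, rfl⟩ := h1
    by_cases h2 : x = w
    · subst h2
      obtain ⟨y, hy⟩ : ∃ y, x ≠ y := by
        by_cases h : x = i0
        · exact ⟨i1, h ▸ h01⟩
        · exact ⟨i0, h⟩
      rw [secMom_mix μ B hB C hC hW x y hy, hb x y hy, hg x y hy]; simp
    · simp [h2, hb x w h2]
  · by_cases h2 : x = w ∧ x' = w'
    · obtain ⟨rfl, rfl⟩ := h2
      have : x ≠ x' := fun h => h1 ⟨h, h⟩
      simp [this, hg x x' this]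
    · rw [secMom_zero μ B hW _ _ _ _ h1 h2]; simp [h1, h2]

theorem secMom_traceless (μ : Measure (Matrix.unitaryGroup ι ℂ)) [IsProbabilityMeasure μ]
    [μ.IsMulRightInvariant]
    (B : Matrix.unitaryGroup ι ℂ → Matrix ι ι ℂ) (hB : ∀ i j, Continuous fun U => B U i j)
    (C : ℝ) (hC : ∀ U i j, ‖B U i j‖ ≤ C)
    (hW : ∀ U W : Matrix.unitaryGroup ι ℂ, B (U * W) = (W : Matrix ι ι ℂ)ᴴ * B U * W)
    (hcard : 2 ≤ Fintype.card ι) (htr : ∀ U, (B U).trace = 0) (q : ℂ)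
    (hsq : ∀ U, ∑ x, ∑ y, B U x y * conj (B U x y) = (Fintype.card ι : ℂ) * q) (T : ι → ι → ℂ) :
    ∫ U, (∑ x, ∑ y, T x y * B U x y) * conj (∑ x, ∑ y, T x y * B U x y) ∂μ =
      q / ((Fintype.card ι : ℂ) ^ 2 - 1) * ((Fintype.card ι : ℂ) * ∑ x, ∑ y, T x y * conj (T x y)
        - (∑ x, T x x) * conj (∑ x, T x x)) := by
  obtain ⟨i0, i1, h01⟩ := Fintype.one_lt_card_iff.mp (by omega : 1 < Fintype.card ι)
  obtain ⟨a, b, hab⟩ := secMom_formula μ B hB C hC hW i0 i1 h01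
  have hi := secMom_integrable μ B hB C hC
  set N : ℂ := (Fintype.card ι : ℂ) with hN
  have hN1 : N ≠ 0 := by rw [hN]; exact_mod_cast (by omega : Fintype.card ι ≠ 0)
  have hN2 : N ^ 2 - 1 ≠ 0 := by
    rw [hN, sub_ne_zero]; norm_cast
    intro h; nlinarith
  have E1 : a * N ^ 2 + b * N = 0 := by
    have h := secMom_sum μ B hB C hC (fun x : ι => (x, x)) (fun _ => 1)
    have h' : ∀ U, ∑ x, B U x x = 0 := fun U => htr U
    simp [h', hab, Finset.sum_add_distrib] at h
    rw [← hN] at h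
    linear_combination -h
  have E2 : a * N + b * N ^ 2 = N * q := by
    have h : ∫ U, ∑ x, ∑ y, B U x y * conj (B U x y) ∂μ = ∑ x, ∑ y, secMom μ B (x, y) (x, y) := by
      rw [integral_finsetSum _ fun x _ => integrable_finsetSum _ fun y _ => hi (x, y) (x, y)]
      refine Finset.sum_congr rfl fun x _ => ?_
      rw [integral_finsetSum _ fun y _ => hi (x, y) (x, y)]
      rfl
    simp [hsq, hab, Finset.sum_add_distrib] at h
    rw [← hN] at h
    linear_combination -h
  have h := secMom_sum μ B hB C hC (fun p : ι × ι => p) (fun p => T p.1 p.2)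
  simp only [Fintype.sum_prod_type] at h
  rw [h]
  have : ∑ x, ∑ y, ∑ x', ∑ y', T x y * conj (T x' y') * secMom μ B (x, y) (x', y') =
      a * ((∑ x, T x x) * conj (∑ x, T x x)) + b * ∑ x, ∑ y, T x y * conj (T x y) := by
    have r1 : ∑ x, ∑ y, ∑ x', ∑ y', T x y * conj (T x' y') *
        (a * (if x = y ∧ x' = y' then 1 else 0)) = a * ((∑ x, T x x) * conj (∑ x, T x x)) := by
      simp only [ite_and, mul_ite, mul_one, mul_zero]
      simp [Finset.sum_ite_irrel]
      rw [Finset.sum_mul_sum, Finset.mul_sum]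
      refine Finset.sum_congr rfl fun x _ => ?_
      rw [Finset.mul_sum]
      refine Finset.sum_congr rfl fun y _ => ?_
      ring
    have r2 : ∑ x, ∑ y, ∑ x', ∑ y', T x y * conj (T x' y') *
        (b * (if x = x' ∧ y = y' then 1 else 0)) = b * ∑ x, ∑ y, T x y * conj (T x y) := by
      simp only [ite_and, mul_ite, mul_one, mul_zero]
      simp [Finset.sum_ite_irrel, Finset.mul_sum]
      refine Finset.sum_congr rfl fun x _ => Finset.sum_congr rfl fun y _ => ?_
      ring
    rw [← r1, ← r2]
    simp only [hab, mul_add, Finset.sum_add_distrib]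
  rw [this]
  have hb : b = -a * N := by
    apply mul_right_cancel₀ hN1; linear_combination E1
  have ha : a = - (q / (N ^ 2 - 1)) := by
    field_simp
    apply mul_right_cancel₀ hN1
    subst hb
    linear_combination - E2
  rw [hb, ha]; ring

end helpers

/-- eigenvalues of `P Π - 1` -/
noncomputable def sliceD (P d : ℕ) (hP : 0 < P) : Fin P × Fin d → ℂ :=
  fun k => (if k.1 = (⟨0, hP⟩ : Fin P) then (P : ℂ) else 0) - 1

/-- the matrix `V†V - 1` -/
noncomputable def sliceB (P d : ℕ) (hP : 0 < P) (U : Matrix.unitaryGroup (Fin P × Fin d) ℂ) :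
    Matrix (Fin P × Fin d) (Fin P × Fin d) ℂ :=
  (U : Matrix (Fin P × Fin d) (Fin P × Fin d) ℂ)ᴴ * Matrix.diagonal (sliceD P d hP) * U

theorem unit_left {ι : Type*} [Fintype ι] [DecidableEq ι] (U : Matrix.unitaryGroup ι ℂ) :
    (U : Matrix ι ι ℂ)ᴴ * U = 1 := Matrix.mem_unitaryGroup_iff'.mp U.2

theorem unit_right {ι : Type*} [Fintype ι] [DecidableEq ι] (U : Matrix.unitaryGroup ι ℂ) :
    (U : Matrix ι ι ℂ) * (U : Matrix ι ι ℂ)ᴴ = 1 := Matrix.mem_unitaryGroup_iff.mp U.2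

theorem sliceB_apply (P d : ℕ) (hP : 0 < P) (U : Matrix.unitaryGroup (Fin P × Fin d) ℂ)
    (x y : Fin P × Fin d) : sliceB P d hP U x y =
      P * (∑ j, conj ((U : Matrix (Fin P × Fin d) (Fin P × Fin d) ℂ) (⟨0, hP⟩, j) x) *
        (U : Matrix (Fin P × Fin d) (Fin P × Fin d) ℂ) (⟨0, hP⟩, j) y)
        - if x = y then 1 else 0 := by
  have h := congrFun (congrFun (unit_left U) x) y
  rw [Matrix.one_apply] at h
  rw [← h, sliceB, Matrix.mul_apply, Matrix.mul_apply]
  simp only [Matrix.mul_diagonal, sliceD, mul_sub, sub_mul, Finset.sum_sub_distrib, mul_one]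
  congr 1
  rw [Fintype.sum_prod_type, Finset.sum_eq_single (⟨0, hP⟩ : Fin P)]
  · simp [Finset.mul_sum]
    refine Finset.sum_congr rfl fun j _ => ?_
    ring
  · intro b _ hb
    simp [hb]
  · simp

theorem sliceB_trace (P d : ℕ) (hP : 0 < P) (U : Matrix.unitaryGroup (Fin P × Fin d) ℂ) :
    (sliceB P d hP U).trace = 0 := by
  rw [sliceB, Matrix.trace_mul_comm, ← mul_assoc, unit_right, one_mul, Matrix.trace_diagonal]
  simp [sliceD, Fintype.sum_prod_type_right]
  ring

theorem sliceB_sq (P d : ℕ) (hP : 0 < P) (U : Matrix.unitaryGroup (Fin P × Fin d) ℂ) :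
    ∑ x, ∑ y, sliceB P d hP U x y * conj (sliceB P d hP U x y)
      = (Fintype.card (Fin P × Fin d) : ℂ) * ((P : ℂ) - 1) := by
  have h1 : ∑ x, ∑ y, sliceB P d hP U x y * conj (sliceB P d hP U x y) =
      (sliceB P d hP U * (sliceB P d hP U)ᴴ).trace := by
    simp [Matrix.trace, Matrix.mul_apply]
  have h2 : sliceB P d hP U * (sliceB P d hP U)ᴴ =
      (U : Matrix (Fin P × Fin d) (Fin P × Fin d) ℂ)ᴴ *
        (Matrix.diagonal (fun k => sliceD P d hP k * sliceD P d hP k) * U) := by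
    have h3 : star (sliceD P d hP) = sliceD P d hP := by
      funext k
      simp only [sliceD, Pi.star_apply]
      split_ifs <;> simp
    rw [sliceB, Matrix.conjTranspose_mul, Matrix.conjTranspose_mul, Matrix.conjTranspose_conjTranspose,
      Matrix.diagonal_conjTranspose, h3, ← Matrix.diagonal_mul_diagonal]
    simp only [mul_assoc]
    rw [← mul_assoc (U : Matrix (Fin P × Fin d) (Fin P × Fin d) ℂ)
      (U : Matrix (Fin P × Fin d) (Fin P × Fin d) ℂ)ᴴ, unit_right, one_mul]
  rw [h1, h2, Matrix.trace_mul_comm, mul_assoc, unit_right, mul_one, Matrix.trace_diagonal]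
  have h4 : ∀ k : Fin P × Fin d, sliceD P d hP k * sliceD P d hP k =
      (if k.1 = (⟨0, hP⟩ : Fin P) then (P : ℂ) ^ 2 - 2 * P else 0) + 1 := by
    intro k
    simp only [sliceD]
    split_ifs <;> ring
  simp [h4, Fintype.sum_prod_type_right, Finset.sum_add_distrib]
  ring

theorem sliceB_cont (P d : ℕ) (hP : 0 < P) (x y : Fin P × Fin d) :
    Continuous fun U => sliceB P d hP U x y := by
  have h : ∀ i j, Continuous fun U : Matrix.unitaryGroup (Fin P × Fin d) ℂ =>
      (U : Matrix (Fin P × Fin d) (Fin P × Fin d) ℂ) i j := fun i j =>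
    (continuous_subtype_val).matrix_elem i j
  simp only [sliceB_apply]
  refine (continuous_const.mul (continuous_finsetSum _ fun j _ => ?_)).sub continuous_const
  exact (Complex.continuous_conj.comp (h _ _)).mul (h _ _)

theorem sliceB_bound (P d : ℕ) (hP : 0 < P) (U : Matrix.unitaryGroup (Fin P × Fin d) ℂ)
    (x y : Fin P × Fin d) : ‖sliceB P d hP U x y‖ ≤ P * d + 1 := by
  rw [sliceB_apply]
  refine (norm_sub_le _ _).trans (add_le_add ?_ (by split_ifs <;> simp))
  rw [norm_mul, Complex.norm_natCast]
  refine mul_le_mul_of_nonneg_left ?_ (Nat.cast_nonneg _)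
  refine (norm_sum_le _ _).trans ?_
  refine (Finset.sum_le_sum (g := fun _ => (1 : ℝ)) fun j _ => ?_).trans (by simp)
  rw [norm_mul, RCLike.norm_conj]
  exact mul_le_one₀ (entry_norm_bound_of_unitary U.2 _ _) (norm_nonneg _)
    (entry_norm_bound_of_unitary U.2 _ _)

theorem sliceB_inn (P d m : ℕ) (hP : 0 < P) (U : Matrix.unitaryGroup (Fin P × Fin d) ℂ)
    (ψ₁ ψ₂ : (Fin P × Fin d) × Fin m → ℂ) :
    inn (sliceV P d m hP U ψ₁) (sliceV P d m hP U ψ₂) - inn ψ₁ ψ₂ =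
      ∑ x, ∑ y, (∑ z, conj (ψ₁ (x, z)) * ψ₂ (y, z)) * sliceB P d hP U x y := by
  have hs : (Real.sqrt P : ℂ) * (Real.sqrt P : ℂ) = P := by
    rw [← Complex.ofReal_mul, Real.mul_self_sqrt (Nat.cast_nonneg _)]; simp
  simp only [sliceB_apply, mul_sub, Finset.sum_sub_distrib]
  congr 1
  · simp only [inn, sliceV, map_mul, Complex.conj_ofReal, map_sum]
    rw [Fintype.sum_prod_type]
    have e : ∀ (j : Fin d) (z : Fin m), (Real.sqrt P : ℂ) *
        (∑ x, conj ((U : Matrix (Fin P × Fin d) (Fin P × Fin d) ℂ) (⟨0, hP⟩, j) x)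
          * conj (ψ₁ (x, z))) * ((Real.sqrt P : ℂ) *
        ∑ x, (U : Matrix (Fin P × Fin d) (Fin P × Fin d) ℂ) (⟨0, hP⟩, j) x * ψ₂ (x, z))
        = ∑ x, ∑ y, P * (conj (ψ₁ (x, z)) * ψ₂ (y, z) *
          (conj ((U : Matrix (Fin P × Fin d) (Fin P × Fin d) ℂ) (⟨0, hP⟩, j) x) *
            (U : Matrix (Fin P × Fin d) (Fin P × Fin d) ℂ) (⟨0, hP⟩, j) y)) := by
      intro j z
      rw [mul_mul_mul_comm, hs, Finset.sum_mul_sum, Finset.mul_sum]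
      refine Finset.sum_congr rfl fun x _ => ?_
      rw [Finset.mul_sum]
      refine Finset.sum_congr rfl fun y _ => ?_
      ring
    simp only [e]
    have e2 : ∀ x y, (∑ z, conj (ψ₁ (x, z)) * ψ₂ (y, z)) * (P * (∑ j,
        conj ((U : Matrix (Fin P × Fin d) (Fin P × Fin d) ℂ) (⟨0, hP⟩, j) x) *
        (U : Matrix (Fin P × Fin d) (Fin P × Fin d) ℂ) (⟨0, hP⟩, j) y)) =
        ∑ j, ∑ z, P * (conj (ψ₁ (x, z)) * ψ₂ (y, z) *
          (conj ((U : Matrix (Fin P × Fin d) (Fin P × Fin d) ℂ) (⟨0, hP⟩, j) x) *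
            (U : Matrix (Fin P × Fin d) (Fin P × Fin d) ℂ) (⟨0, hP⟩, j) y)) := by
      intro x y
      rw [mul_left_comm, Finset.sum_mul_sum, Finset.sum_comm, Finset.mul_sum]
      simp only [Finset.mul_sum]
    simp only [e2]
    have c1 : ∀ f : Fin d → Fin m → (Fin P × Fin d) → (Fin P × Fin d) → ℂ,
        ∑ j, ∑ z, ∑ x, ∑ y, f j z x y = ∑ x, ∑ y, ∑ j, ∑ z, f j z x y := by
      intro f
      have a1 := Finset.sum_comm (s := (Finset.univ : Finset (Fin d × Fin m)))
        (t := (Finset.univ : Finset ((Fin P × Fin d) × (Fin P × Fin d))))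
        (f := fun a b => f a.1 a.2 b.1 b.2)
      rw [Fintype.sum_prod_type, Fintype.sum_prod_type] at a1
      simpa only [Fintype.sum_prod_type (α₁ := Fin P × Fin d),
        Fintype.sum_prod_type (α₁ := Fin d) (α₂ := Fin m)] using a1
    exact c1 _
  · simp [inn, Fintype.sum_prod_type (α₁ := Fin P × Fin d)]

theorem outMat_trace (P d m : ℕ) (ψ₁ ψ₂ : (Fin P × Fin d) × Fin m → ℂ) :
    (outMat P d m ψ₁ * outMat P d m ψ₂).trace = ∑ x, ∑ y,
      (∑ z, conj (ψ₁ (x, z)) * ψ₂ (y, z)) * conj (∑ z, conj (ψ₁ (x, z)) * ψ₂ (y, z)) := by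
  simp only [Matrix.trace, Matrix.diag, Matrix.mul_apply, outMat, Finset.sum_mul_sum, map_sum,
    map_mul, Complex.conj_conj]
  have c1 : ∀ f : Fin m → Fin m → (Fin P × Fin d) → (Fin P × Fin d) → ℂ,
      ∑ j, ∑ z, ∑ x, ∑ y, f j z x y = ∑ x, ∑ y, ∑ j, ∑ z, f j z x y := by
    intro f
    have a1 := Finset.sum_comm (s := (Finset.univ : Finset (Fin m × Fin m)))
      (t := (Finset.univ : Finset ((Fin P × Fin d) × (Fin P × Fin d))))
      (f := fun a b => f a.1 a.2 b.1 b.2)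
    rw [Fintype.sum_prod_type, Fintype.sum_prod_type] at a1
    simpa only [Fintype.sum_prod_type (α₁ := Fin P × Fin d),
      Fintype.sum_prod_type (α₁ := Fin m) (α₂ := Fin m)] using a1
  rw [c1]
  refine Finset.sum_congr rfl fun x _ => Finset.sum_congr rfl fun y _ => ?_
  rw [Finset.sum_comm]
  refine Finset.sum_congr rfl fun z _ => Finset.sum_congr rfl fun z' _ => ?_
  ring

/-- **General fluctuation formula.**  Assume `Pd ≥ 2`.  For all unit vectors
`ψ₁, ψ₂ ∈ ℂ^{Pd} ⊗ ℂ^m`,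
`∫ |⟨ψ₁, V(U)†V(U) ψ₂⟩ − ⟨ψ₁, ψ₂⟩|² dμ(U)
  = ((P − 1)/(P²d² − 1)) · (P·d · tr(ψ₁^out ψ₂^out) − |⟨ψ₁, ψ₂⟩|²)`,
where `μ` is the Haar probability measure (the left- and right-invariant Borel probability
measure) on `U(Pd)`. -/
theorem sliceV_fluctuation_formula (P d m : ℕ) (hP : 0 < P) (hd : 0 < d) (hm : 0 < m)
    (hPd : 2 ≤ P * d)
    (μ : Measure (Matrix.unitaryGroup (Fin P × Fin d) ℂ))
    [IsProbabilityMeasure μ] [μ.IsMulLeftInvariant] [μ.IsMulRightInvariant]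
    (ψ₁ ψ₂ : (Fin P × Fin d) × Fin m → ℂ)
    (hψ₁ : inn ψ₁ ψ₁ = 1) (hψ₂ : inn ψ₂ ψ₂ = 1) :
    ((∫ U, ‖inn (sliceV P d m hP U ψ₁) (sliceV P d m hP U ψ₂) - inn ψ₁ ψ₂‖ ^ 2 ∂μ : ℝ) : ℂ)
      = (((P : ℂ) - 1) / ((P : ℂ) ^ 2 * (d : ℂ) ^ 2 - 1)) *
          ((P : ℂ) * (d : ℂ) * (outMat P d m ψ₁ * outMat P d m ψ₂).trace
            - (‖inn ψ₁ ψ₂‖ : ℂ) ^ 2) := by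
  have hsq : ∀ z : ℂ, ((‖z‖ : ℝ) : ℂ) ^ 2 = z * conj z := fun z => by
    rw [Complex.mul_conj, Complex.normSq_eq_norm_sq]; push_cast; rfl
  have hW : ∀ U W : Matrix.unitaryGroup (Fin P × Fin d) ℂ, sliceB P d hP (U * W) =
      (W : Matrix (Fin P × Fin d) (Fin P × Fin d) ℂ)ᴴ * sliceB P d hP U * W := by
    intro U W
    simp only [sliceB, Matrix.UnitaryGroup.mul_val, Matrix.conjTranspose_mul, mul_assoc]
  have h := secMom_traceless μ (sliceB P d hP) (sliceB_cont P d hP) (P * d + 1)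
    (sliceB_bound P d hP) hW (by simpa using hPd) (sliceB_trace P d hP) ((P : ℂ) - 1)
    (sliceB_sq P d hP) (fun x y => ∑ z, conj (ψ₁ (x, z)) * ψ₂ (y, z))
  have hinn : inn ψ₁ ψ₂ = ∑ x, ∑ z, conj (ψ₁ (x, z)) * ψ₂ (x, z) := by
    simp [inn, Fintype.sum_prod_type (α₁ := Fin P × Fin d)]
  rw [← integral_complex_ofReal]
  simp only [Complex.ofReal_pow, hsq, sliceB_inn]
  rw [h, outMat_trace, hinn]
  simp only [Fintype.card_prod, Fintype.card_fin, Nat.cast_mul]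
  ring
end

section
/- Product-state norm fluctuation: assume Pd ≥ 2. If ψ₀ = φ ⊗ χ is a unit vector in ℂ^{Pd} ⊗ ℂ^m with φ ∈ ℂ^{Pd} and χ ∈ ℂ^m unit vectors (so that ψ₀^out is a rank-one projection), then ∫ |⟨ψ₀, V(U)†V(U) ψ₀⟩ − 1|² dμ(U) = (P − 1)/(P·d + 1). -/
open MeasureTheory ComplexConjugate
open scoped Matrix

/-- The product vector `φ ⊗ χ ∈ ℂ^{Pd} ⊗ ℂ^m`. -/
noncomputable def prodVec (P d m : ℕ) (φ : Fin P × Fin d → ℂ) (χ : Fin m → ℂ) :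
    (Fin P × Fin d) × Fin m → ℂ :=
  fun xy => φ xy.1 * χ xy.2

/-- Householder reflections are unitary. -/
theorem aux_house {ι : Type*} [Fintype ι] [DecidableEq ι] (v : ι → ℂ) (c : ℝ)
    (hc : (c : ℂ) * (star v ⬝ᵥ v) = 2) :
    (1 - (c : ℂ) • Matrix.vecMulVec v (star v)) ∈ Matrix.unitaryGroup ι ℂ := by
  rw [Matrix.mem_unitaryGroup_iff]
  have hK : star (Matrix.vecMulVec v (star v)) = Matrix.vecMulVec v (star v) := by
    ext i j
    simp [Matrix.star_apply, Matrix.vecMulVec_apply, mul_comm]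
  have hs : star (1 - (c : ℂ) • Matrix.vecMulVec v (star v))
      = 1 - (c : ℂ) • Matrix.vecMulVec v (star v) := by
    rw [star_sub, star_one, star_smul, hK]; simp
  have hKK : Matrix.vecMulVec v (star v) * Matrix.vecMulVec v (star v)
      = (star v ⬝ᵥ v) • Matrix.vecMulVec v (star v) := by
    rw [Matrix.vecMulVec_mul_vecMulVec]
    ext i j
    simp [Matrix.vecMulVec_apply]; ring
  rw [hs, sub_mul, mul_sub, mul_sub, one_mul, mul_one, smul_mul_smul_comm, hKK, smul_smul,
    mul_assoc, hc, one_mul]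
  module

theorem aux_two {ι : Type*} [Fintype ι] [DecidableEq ι] (φ : ι → ℂ) (a b : ι) (hab : a ≠ b)
    (z : ℂ) (c : ℝ) (hc : c * (1 + Complex.normSq z) = 2) :
    ∃ g : Matrix.unitaryGroup ι ℂ, ∀ U : Matrix.unitaryGroup ι ℂ,
      ((↑(g * U) : Matrix ι ι ℂ) *ᵥ φ) a = ((U : Matrix ι ι ℂ) *ᵥ φ) a
        - c * (((U : Matrix ι ι ℂ) *ᵥ φ) a + conj z * ((U : Matrix ι ι ℂ) *ᵥ φ) b) ∧
      ((↑(g * U) : Matrix ι ι ℂ) *ᵥ φ) b = ((U : Matrix ι ι ℂ) *ᵥ φ) b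
        - c * (((U : Matrix ι ι ℂ) *ᵥ φ) a + conj z * ((U : Matrix ι ι ℂ) *ᵥ φ) b) * z ∧
      ∀ k, k ≠ a → k ≠ b →
        ((↑(g * U) : Matrix ι ι ℂ) *ᵥ φ) k = ((U : Matrix ι ι ℂ) *ᵥ φ) k := by
  set v : ι → ℂ := Pi.single a 1 + Pi.single b z with hv
  have hva : v a = 1 := by simp [hv, hab]
  have hvb : v b = z := by simp [hv, hab.symm]
  have hvk : ∀ k, k ≠ a → k ≠ b → v k = 0 := by
    intro k h1 h2; simp [hv, h1, h2]
  have hdot : ∀ w : ι → ℂ, star v ⬝ᵥ w = w a + conj z * w b := by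
    intro w
    have : star v = Pi.single a 1 + Pi.single b (conj z) := by
      rw [hv, star_add, ← Pi.single_star, ← Pi.single_star]; simp
    rw [this, add_dotProduct]; simp
  have hcc : (c : ℂ) * (star v ⬝ᵥ v) = 2 := by
    rw [hdot, hva, hvb, ← Complex.normSq_eq_conj_mul_self]
    exact_mod_cast hc
  refine ⟨⟨_, aux_house v c hcc⟩, fun U => ?_⟩
  have key : ∀ k, ((↑((⟨_, aux_house v c hcc⟩ : Matrix.unitaryGroup ι ℂ) * U) : Matrix ι ι ℂ) *ᵥ φ) k
      = ((U : Matrix ι ι ℂ) *ᵥ φ) k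
        - c * (((U : Matrix ι ι ℂ) *ᵥ φ) a + conj z * ((U : Matrix ι ι ℂ) *ᵥ φ) b) * v k := by
    intro k
    rw [← hdot]
    simp only [Submonoid.coe_mul, ← Matrix.mulVec_mulVec]
    simp only [Matrix.sub_mulVec, Matrix.smul_mulVec, Matrix.one_mulVec, Matrix.vecMulVec_mulVec,
      Pi.sub_apply, Pi.smul_apply, smul_eq_mul, MulOpposite.smul_eq_mul_unop, MulOpposite.unop_op]
    ring
  refine ⟨by rw [key, hva, mul_one], by rw [key, hvb], fun k h1 h2 => by rw [key, hvk k h1 h2]; simp⟩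

/-- squared modulus of a coordinate -/
noncomputable def auxf {ι : Type*} [Fintype ι] [DecidableEq ι] (φ : ι → ℂ) (a : ι)
    (U : Matrix.unitaryGroup ι ℂ) : ℝ := Complex.normSq (((U : Matrix ι ι ℂ) *ᵥ φ) a)

theorem auxf_cont {ι : Type*} [Fintype ι] [DecidableEq ι] (φ : ι → ℂ) (a : ι) :
    Continuous (auxf φ a) := by
  unfold auxf
  refine Complex.continuous_normSq.comp ?_
  have : Continuous fun U : Matrix.unitaryGroup ι ℂ => (U : Matrix ι ι ℂ) *ᵥ φ :=
    Continuous.matrix_mulVec continuous_subtype_val continuous_const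
  exact (continuous_apply a).comp this

theorem auxf_sum {ι : Type*} [Fintype ι] [DecidableEq ι] (φ : ι → ℂ)
    (hφ : ∑ x, conj (φ x) * φ x = 1) (U : Matrix.unitaryGroup ι ℂ) :
    ∑ a, auxf φ a U = 1 := by
  have h1 : star ((U : Matrix ι ι ℂ) *ᵥ φ) ⬝ᵥ ((U : Matrix ι ι ℂ) *ᵥ φ) = star φ ⬝ᵥ φ := by
    have hU : (U : Matrix ι ι ℂ)ᴴ * (U : Matrix ι ι ℂ) = 1 := by
      have := Matrix.mem_unitaryGroup_iff'.1 U.2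
      exact this
    rw [Matrix.star_mulVec, Matrix.dotProduct_mulVec, Matrix.vecMul_vecMul, hU, Matrix.vecMul_one]
  have h2 : star φ ⬝ᵥ φ = 1 := hφ
  rw [h2] at h1
  have h3 : ((∑ a, auxf φ a U : ℝ) : ℂ) = 1 := by
    rw [← h1]
    simp only [auxf, dotProduct, Complex.ofReal_sum, Complex.normSq_eq_conj_mul_self]
    rfl
  exact_mod_cast h3

theorem auxf_nonneg {ι : Type*} [Fintype ι] [DecidableEq ι] (φ : ι → ℂ) (a : ι)
    (U : Matrix.unitaryGroup ι ℂ) : 0 ≤ auxf φ a U := Complex.normSq_nonneg _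

theorem auxf_le {ι : Type*} [Fintype ι] [DecidableEq ι] (φ : ι → ℂ)
    (hφ : ∑ x, conj (φ x) * φ x = 1) (a : ι) (U : Matrix.unitaryGroup ι ℂ) :
    auxf φ a U ≤ 1 := by
  rw [← auxf_sum φ hφ U]
  exact Finset.single_le_sum (fun i _ => auxf_nonneg φ i U) (Finset.mem_univ a)

theorem aux_int {ι : Type*} [Fintype ι] [DecidableEq ι]
    (μ : Measure (Matrix.unitaryGroup ι ℂ)) [IsProbabilityMeasure μ] (φ : ι → ℂ)
    (hφ : ∑ x, conj (φ x) * φ x = 1) (a : ι) : Integrable (auxf φ a) μ := by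
  refine Integrable.of_bound (C := 1) (auxf_cont φ a).measurable.aestronglyMeasurable ?_
  refine Filter.Eventually.of_forall fun U => ?_
  rw [Real.norm_eq_abs, abs_of_nonneg (auxf_nonneg φ a U)]
  exact auxf_le φ hφ a U

theorem aux_int2 {ι : Type*} [Fintype ι] [DecidableEq ι]
    (μ : Measure (Matrix.unitaryGroup ι ℂ)) [IsProbabilityMeasure μ] (φ : ι → ℂ)
    (hφ : ∑ x, conj (φ x) * φ x = 1) (a b : ι) :
    Integrable (fun U => auxf φ a U * auxf φ b U) μ := by
  refine Integrable.of_bound (C := 1)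
    ((auxf_cont φ a).mul (auxf_cont φ b)).measurable.aestronglyMeasurable ?_
  refine Filter.Eventually.of_forall fun U => ?_
  rw [Real.norm_eq_abs, abs_of_nonneg (mul_nonneg (auxf_nonneg φ a U) (auxf_nonneg φ b U))]
  exact mul_le_one₀ (auxf_le φ hφ a U) (auxf_nonneg φ b U) (auxf_le φ hφ b U)

theorem aux_inv {ι : Type*} [Fintype ι] [DecidableEq ι]
    (μ : Measure (Matrix.unitaryGroup ι ℂ)) [μ.IsMulLeftInvariant]
    (F : Matrix.unitaryGroup ι ℂ → ℝ) (g : Matrix.unitaryGroup ι ℂ) :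
    ∫ U, F (g * U) ∂μ = ∫ U, F U ∂μ := integral_mul_left_eq_self F g

theorem aux_swap {ι : Type*} [Fintype ι] [DecidableEq ι] (φ : ι → ℂ) (a b : ι) :
    ∃ g : Matrix.unitaryGroup ι ℂ, ∀ U, auxf φ a (g * U) = auxf φ b U := by
  by_cases hab : a = b
  · subst hab; exact ⟨1, fun U => by rw [one_mul]⟩
  obtain ⟨g, hg⟩ := aux_two φ a b hab (-1) 1 (by simp; norm_num)
  refine ⟨g, fun U => ?_⟩
  unfold auxf
  rw [(hg U).1]
  simp

theorem aux_first {ι : Type*} [Fintype ι] [DecidableEq ι]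
    (μ : Measure (Matrix.unitaryGroup ι ℂ)) [IsProbabilityMeasure μ] [μ.IsMulLeftInvariant]
    (φ : ι → ℂ) (hφ : ∑ x, conj (φ x) * φ x = 1) (a : ι) :
    (Fintype.card ι : ℝ) * ∫ U, auxf φ a U ∂μ = 1 := by
  have h : ∀ b, ∫ U, auxf φ b U ∂μ = ∫ U, auxf φ a U ∂μ := by
    intro b
    obtain ⟨g, hg⟩ := aux_swap φ a b
    rw [← aux_inv μ (auxf φ a) g]
    exact integral_congr_ae (Filter.Eventually.of_forall fun U => (hg U).symm)
  have h2 : ∫ U, ∑ b, auxf φ b U ∂μ = 1 := by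
    simp [auxf_sum φ hφ]
  rw [integral_finsetSum _ (fun b _ => aux_int μ φ hφ b), Finset.sum_congr rfl (fun b _ => h b)] at h2
  simpa using h2

theorem aux_mixpt (x y : ℂ) :
    625 * (Complex.normSq (x - ((2/5 : ℝ) : ℂ) * (x + conj (2:ℂ) * y)) ^ 2
      + Complex.normSq (x - ((2/5 : ℝ) : ℂ) * (x + conj (-2:ℂ) * y)) ^ 2
      + Complex.normSq (x - ((2/5 : ℝ) : ℂ) * (x + conj (2 * Complex.I) * y)) ^ 2
      + Complex.normSq (x - ((2/5 : ℝ) : ℂ) * (x + conj (-2 * Complex.I) * y)) ^ 2)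
    = 324 * Complex.normSq x ^ 2 + 1024 * Complex.normSq y ^ 2
      + 2304 * (Complex.normSq x * Complex.normSq y) := by
  obtain ⟨p, q⟩ := x
  obtain ⟨r, s⟩ := y
  simp only [Complex.normSq_apply, Complex.sub_re, Complex.sub_im, Complex.mul_re, Complex.mul_im,
    Complex.add_re, Complex.add_im, Complex.ofReal_re, Complex.ofReal_im, Complex.conj_re,
    Complex.conj_im, Complex.neg_re, Complex.neg_im, Complex.I_re, Complex.I_im,
    Complex.re_ofNat, Complex.im_ofNat]
  ring

theorem aux_sq_eq {ι : Type*} [Fintype ι] [DecidableEq ι]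
    (μ : Measure (Matrix.unitaryGroup ι ℂ)) [μ.IsMulLeftInvariant]
    (φ : ι → ℂ) (a b : ι) :
    ∫ U, auxf φ b U * auxf φ b U ∂μ = ∫ U, auxf φ a U * auxf φ a U ∂μ := by
  obtain ⟨g, hg⟩ := aux_swap φ a b
  rw [← aux_inv μ (fun U => auxf φ a U * auxf φ a U) g]
  exact integral_congr_ae (Filter.Eventually.of_forall fun U => by simp only [hg U])

theorem aux_mix {ι : Type*} [Fintype ι] [DecidableEq ι]
    (μ : Measure (Matrix.unitaryGroup ι ℂ)) [IsProbabilityMeasure μ] [μ.IsMulLeftInvariant]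
    (φ : ι → ℂ) (hφ : ∑ x, conj (φ x) * φ x = 1) (a b : ι) (hab : a ≠ b) :
    ∫ U, auxf φ a U * auxf φ b U ∂μ = (∫ U, auxf φ a U * auxf φ a U ∂μ) / 2 := by
  obtain ⟨g1, h1⟩ := aux_two φ a b hab 2 (2/5) (by simp [Complex.normSq_apply]; norm_num)
  obtain ⟨g2, h2⟩ := aux_two φ a b hab (-2) (2/5) (by simp [Complex.normSq_apply]; norm_num)
  obtain ⟨g3, h3⟩ := aux_two φ a b hab (2 * Complex.I) (2/5)
    (by simp [Complex.normSq_apply]; norm_num)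
  obtain ⟨g4, h4⟩ := aux_two φ a b hab (-2 * Complex.I) (2/5)
    (by simp [Complex.normSq_apply]; norm_num)
  set F : Matrix.unitaryGroup ι ℂ → ℝ := fun U => auxf φ a U * auxf φ a U with hF
  have hFi : Integrable F μ := aux_int2 μ φ hφ a a
  have hi : ∀ g, Integrable (fun U => F (g * U)) μ := fun g => hFi.comp_mul_left g
  have hpt : ∀ U, 625 * (F (g1 * U) + F (g2 * U) + F (g3 * U) + F (g4 * U))
      = 324 * (auxf φ a U * auxf φ a U) + 1024 * (auxf φ b U * auxf φ b U)
        + 2304 * (auxf φ a U * auxf φ b U) := by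
    intro U
    have := aux_mixpt (((U : Matrix ι ι ℂ) *ᵥ φ) a) (((U : Matrix ι ι ℂ) *ᵥ φ) b)
    rw [← (h1 U).1, ← (h2 U).1, ← (h3 U).1, ← (h4 U).1] at this
    simp only [hF, auxf]
    linarith
  have hl : ∫ U, 625 * (F (g1 * U) + F (g2 * U) + F (g3 * U) + F (g4 * U)) ∂μ
      = 625 * (4 * ∫ U, F U ∂μ) := by
    rw [integral_const_mul, integral_add (((hi g1).fun_add (hi g2)).fun_add (hi g3)) (hi g4),
      integral_add ((hi g1).fun_add (hi g2)) (hi g3), integral_add (hi g1) (hi g2),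
      aux_inv, aux_inv, aux_inv, aux_inv]
    ring
  have hr : ∫ U, (324 * (auxf φ a U * auxf φ a U) + 1024 * (auxf φ b U * auxf φ b U)
        + 2304 * (auxf φ a U * auxf φ b U)) ∂μ
      = 324 * ∫ U, auxf φ a U * auxf φ a U ∂μ + 1024 * ∫ U, auxf φ b U * auxf φ b U ∂μ
        + 2304 * ∫ U, auxf φ a U * auxf φ b U ∂μ := by
    rw [integral_add (((aux_int2 μ φ hφ a a).const_mul _).fun_add ((aux_int2 μ φ hφ b b).const_mul _))
      ((aux_int2 μ φ hφ a b).const_mul _),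
      integral_add ((aux_int2 μ φ hφ a a).const_mul _) ((aux_int2 μ φ hφ b b).const_mul _),
      integral_const_mul, integral_const_mul, integral_const_mul]
  simp only [hpt] at hl
  rw [hr, aux_sq_eq μ φ a b] at hl
  simp only [hF] at hl ⊢
  linarith

theorem aux_second {ι : Type*} [Fintype ι] [DecidableEq ι]
    (μ : Measure (Matrix.unitaryGroup ι ℂ)) [IsProbabilityMeasure μ] [μ.IsMulLeftInvariant]
    (φ : ι → ℂ) (hφ : ∑ x, conj (φ x) * φ x = 1) (a0 a b : ι) :
    ∫ U, auxf φ a U * auxf φ b U ∂μ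
      = (∫ U, auxf φ a0 U * auxf φ a0 U ∂μ) / 2 * (1 + if a = b then 1 else 0) := by
  by_cases h : a = b
  · subst h
    rw [aux_sq_eq μ φ a0 a]; simp; ring
  · rw [aux_mix μ φ hφ a b h, aux_sq_eq μ φ a0 a]; simp [h]

/-- second moment over an injectively indexed set of coordinates -/
theorem aux_sumsum {ι κ : Type*} [Fintype ι] [DecidableEq ι] [Fintype κ] [DecidableEq κ]
    (μ : Measure (Matrix.unitaryGroup ι ℂ)) [IsProbabilityMeasure μ] [μ.IsMulLeftInvariant]
    (φ : ι → ℂ) (hφ : ∑ x, conj (φ x) * φ x = 1) (a0 : ι) (e : κ → ι)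
    (he : Function.Injective e) :
    ∫ U, (∑ j, auxf φ (e j) U) * (∑ j, auxf φ (e j) U) ∂μ
      = (∫ U, auxf φ a0 U * auxf φ a0 U ∂μ) / 2
        * (Fintype.card κ * (Fintype.card κ + 1)) := by
  simp only [Finset.sum_mul_sum]
  rw [integral_finsetSum _ (fun i _ => integrable_finsetSum _ fun j _ => aux_int2 μ φ hφ _ _)]
  have : ∀ i, ∫ U, ∑ j, auxf φ (e i) U * auxf φ (e j) U ∂μ
      = (∫ U, auxf φ a0 U * auxf φ a0 U ∂μ) / 2 * (Fintype.card κ + 1) := by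
    intro i
    rw [integral_finsetSum _ (fun j _ => aux_int2 μ φ hφ _ _)]
    have hs := aux_second μ φ hφ a0
    generalize (∫ U, auxf φ a0 U * auxf φ a0 U ∂μ) = A at hs ⊢
    simp only [hs, ← Finset.mul_sum, he.eq_iff, Finset.sum_add_distrib]
    simp
  simp only [this]
  simp
  ring

/-- **Product-state norm fluctuation.**  Assume `Pd ≥ 2`.  If `ψ₀ = φ ⊗ χ` is a unit
product vector in `ℂ^{Pd} ⊗ ℂ^m`, then
`∫ |⟨ψ₀, V(U)†V(U) ψ₀⟩ − 1|² dμ(U) = (P − 1)/(P·d + 1)`,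
where `μ` is the Haar probability measure (the left- and right-invariant Borel probability
measure) on `U(Pd)`. -/
theorem sliceV_product_state_norm_fluctuation (P d m : ℕ) (hP : 0 < P) (hd : 0 < d)
    (hm : 0 < m) (hPd : 2 ≤ P * d)
    (μ : Measure (Matrix.unitaryGroup (Fin P × Fin d) ℂ))
    [IsProbabilityMeasure μ] [μ.IsMulLeftInvariant] [μ.IsMulRightInvariant]
    (φ : Fin P × Fin d → ℂ) (χ : Fin m → ℂ)
    (hφ : inn φ φ = 1) (hχ : inn χ χ = 1) :
    (∫ U, ‖inn (sliceV P d m hP U (prodVec P d m φ χ))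
              (sliceV P d m hP U (prodVec P d m φ χ)) - 1‖ ^ 2 ∂μ)
      = ((P : ℝ) - 1) / ((P : ℝ) * (d : ℝ) + 1) := by
  classical
  have hφ' : ∑ x, conj (φ x) * φ x = 1 := hφ
  set e : Fin d → Fin P × Fin d := fun j => ((⟨0, hP⟩ : Fin P), j) with he
  have hinj : Function.Injective e := fun i j h => by simpa [he] using h
  have a0 : Fin P × Fin d := (⟨0, hP⟩, ⟨0, hd⟩)
  have hP' : (0 : ℝ) < P := by exact_mod_cast hP
  have hd' : (0 : ℝ) < d := by exact_mod_cast hd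
  have hval : ∀ U, inn (sliceV P d m hP U (prodVec P d m φ χ))
      (sliceV P d m hP U (prodVec P d m φ χ)) = ((P * ∑ j, auxf φ (e j) U : ℝ) : ℂ) := by
    intro U
    have hs : ∀ jy : Fin d × Fin m, sliceV P d m hP U (prodVec P d m φ χ) jy
        = (Real.sqrt P : ℂ) * ((U : Matrix (Fin P × Fin d) (Fin P × Fin d) ℂ) *ᵥ φ) (e jy.1)
          * χ jy.2 := by
      intro jy
      simp only [sliceV, prodVec, Matrix.mulVec, dotProduct, he]
      rw [mul_assoc, Finset.sum_mul]
      simp only [mul_assoc]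
    have hsq : (Real.sqrt P : ℂ) * (Real.sqrt P : ℂ) = P := by
      rw [← Complex.ofReal_mul, Real.mul_self_sqrt hP'.le]; simp
    have hχ' : ∑ y, conj (χ y) * χ y = 1 := hχ
    simp only [inn, hs, Fintype.sum_prod_type, map_mul, Complex.conj_ofReal]
    have : ∀ j, ∑ y, (Real.sqrt P : ℂ)
          * conj (((U : Matrix (Fin P × Fin d) (Fin P × Fin d) ℂ) *ᵥ φ) (e j)) * conj (χ y)
          * ((Real.sqrt P : ℂ) * ((U : Matrix (Fin P × Fin d) (Fin P × Fin d) ℂ) *ᵥ φ) (e j) * χ y)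
        = (P : ℂ) * (auxf φ (e j) U : ℂ) := by
      intro j
      rw [auxf, Complex.normSq_eq_conj_mul_self, ← hsq]
      rw [← mul_one ((Real.sqrt P : ℂ) * (Real.sqrt P : ℂ) * _), ← hχ', Finset.mul_sum]
      exact Finset.sum_congr rfl fun y _ => by ring
    simp only [this]
    push_cast
    rw [Finset.mul_sum]
  have hpt : ∀ U, ‖inn (sliceV P d m hP U (prodVec P d m φ χ))
      (sliceV P d m hP U (prodVec P d m φ χ)) - 1‖ ^ 2
      = (P : ℝ) ^ 2 * ((∑ j, auxf φ (e j) U) * (∑ j, auxf φ (e j) U))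
        - 2 * P * (∑ j, auxf φ (e j) U) + 1 := by
    intro U
    rw [hval, ← Complex.ofReal_one, ← Complex.ofReal_sub, Complex.norm_real, Real.norm_eq_abs,
      sq_abs]
    ring
  simp only [hpt]
  have i1 : Integrable (fun U => ∑ j, auxf φ (e j) U) μ :=
    integrable_finsetSum _ fun j _ => aux_int μ φ hφ' _
  have i2 : Integrable (fun U => (∑ j, auxf φ (e j) U) * (∑ j, auxf φ (e j) U)) μ := by
    simp only [Finset.sum_mul_sum]
    exact integrable_finsetSum _ fun i _ => integrable_finsetSum _ fun j _ => aux_int2 μ φ hφ' _ _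
  have i3 : Integrable (fun U => (P : ℝ) ^ 2 * ((∑ j, auxf φ (e j) U) * (∑ j, auxf φ (e j) U))
        - 2 * P * (∑ j, auxf φ (e j) U)) μ := (i2.const_mul _).sub (i1.const_mul _)
  rw [integral_add i3 (integrable_const _),
    integral_sub (i2.const_mul _) (i1.const_mul _), integral_const_mul, integral_const_mul,
    aux_sumsum μ φ hφ' a0 e hinj, integral_finsetSum _ (fun j _ => aux_int μ φ hφ' _)]
  have m1 : ∀ a, ∫ U, auxf φ a U ∂μ = 1 / (P * d) := by
    intro a
    have := aux_first μ φ hφ' a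
    simp only [Fintype.card_prod, Fintype.card_fin, Nat.cast_mul] at this
    field_simp
    linarith
  have m2 := aux_sumsum μ φ hφ' a0 id Function.injective_id
  simp only [id, auxf_sum φ hφ'] at m2
  simp only [Fintype.card_prod, Fintype.card_fin, Nat.cast_mul, mul_one, integral_const,
    probReal_univ, smul_eq_mul] at m2
  have m3 : (∫ U, auxf φ a0 U * auxf φ a0 U ∂μ) / 2 = 1 / (P * d * (P * d + 1)) := by
    rw [eq_div_iff (by positivity)]
    exact m2.symm
  simp only [m1, m3, Finset.sum_const, Finset.card_univ, Fintype.card_fin, nsmul_eq_mul,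
    integral_const, probReal_univ, smul_eq_mul]
  field_simp
  ring
end

section
/- Failure of emergence lower bound: assume P ≥ 2 and Pd ≥ 2. For every product unit vector ψ₀ = φ ⊗ χ ∈ ℂ^{Pd} ⊗ ℂ^m, the averaged norm fluctuation is bounded below by the inverse χ-dimension: ∫ |⟨ψ₀, V(U)†V(U) ψ₀⟩ − 1|² dμ(U) ≥ 1/(4d). -/
open MeasureTheory ComplexConjugate
open scoped Matrix

section helpers
variable {ι : Type*} [Fintype ι] [DecidableEq ι]

/-- squared modulus of an entry of `U φ`. -/
noncomputable def wsq (φ : ι → ℂ) (x : ι) (U : Matrix.unitaryGroup ι ℂ) : ℝ :=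
  Complex.normSq (((U : Matrix ι ι ℂ) *ᵥ φ) x)

lemma wsq_cont (φ : ι → ℂ) (x : ι) : Continuous (wsq φ x) := by
  unfold wsq
  refine Complex.continuous_normSq.comp ?_
  have h : Continuous fun U : Matrix.unitaryGroup ι ℂ => ((U : Matrix ι ι ℂ) *ᵥ φ) :=
    Continuous.matrix_mulVec continuous_subtype_val continuous_const
  exact (continuous_apply x).comp h

lemma wsq_nonneg (φ : ι → ℂ) (x : ι) (U) : 0 ≤ wsq φ x U := Complex.normSq_nonneg _

lemma wsq_sum (φ : ι → ℂ) (hφ : inn φ φ = 1) (U) : ∑ x, wsq φ x U = 1 := by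
  have h1 : ((∑ x, wsq φ x U : ℝ) : ℂ)
      = star ((U : Matrix ι ι ℂ) *ᵥ φ) ⬝ᵥ ((U : Matrix ι ι ℂ) *ᵥ φ) := by
    push_cast
    simp only [dotProduct, wsq, Complex.normSq_eq_conj_mul_self, Pi.star_apply]
    rfl
  have h2 : star ((U : Matrix ι ι ℂ) *ᵥ φ) ⬝ᵥ ((U : Matrix ι ι ℂ) *ᵥ φ) = star φ ⬝ᵥ φ := by
    rw [Matrix.star_mulVec, ← Matrix.dotProduct_mulVec, Matrix.mulVec_mulVec]
    have : (U : Matrix ι ι ℂ)ᴴ * (U : Matrix ι ι ℂ) = 1 := Matrix.UnitaryGroup.star_mul_self U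
    rw [this, Matrix.one_mulVec]
  have h3 : star φ ⬝ᵥ φ = inn φ φ := by rfl
  rw [h2, h3, hφ] at h1
  exact_mod_cast h1

lemma wsq_le_one (φ : ι → ℂ) (hφ : inn φ φ = 1) (x : ι) (U) : wsq φ x U ≤ 1 := by
  rw [← wsq_sum φ hφ U]
  exact Finset.single_le_sum (f := fun x => wsq φ x U) (fun i _ => wsq_nonneg φ i U)
    (Finset.mem_univ x)

/-- the coefficient `t`. -/
noncomputable def rt (c : ℂ) : ℝ := 2 / (1 + Complex.normSq c)

noncomputable def rv (a b : ι) (c : ℂ) : ι → ℂ := Pi.single a 1 + Pi.single b c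

noncomputable def rmat (a b : ι) (c : ℂ) : Matrix ι ι ℂ :=
  1 - (rt c : ℂ) • Matrix.vecMulVec (rv a b c) (star (rv a b c))

lemma rv_dot (a b : ι) (c : ℂ) (w : ι → ℂ) :
    star (rv a b c) ⬝ᵥ w = w a + conj c * w b := by
  simp [rv, Pi.single_star, add_dotProduct]

lemma rmat_mem (a b : ι) (hab : a ≠ b) (c : ℂ) : rmat a b c ∈ Matrix.unitaryGroup ι ℂ := by
  have hs : star (rmat a b c) = rmat a b c := by
    simp [rmat, Matrix.star_eq_conjTranspose, Matrix.conjTranspose_smul,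
      Matrix.conjTranspose_vecMulVec]
  have hd : star (rv a b c) ⬝ᵥ (rv a b c) = ((1 + Complex.normSq c : ℝ) : ℂ) := by
    rw [rv_dot]
    simp [rv, hab, hab.symm, Complex.normSq_eq_conj_mul_self]
  have ht : (rt c : ℂ) * ((1 + Complex.normSq c : ℝ) : ℂ) = 2 := by
    have : (1 + Complex.normSq c) ≠ 0 := by have := Complex.normSq_nonneg c; positivity
    rw [← Complex.ofReal_mul]
    unfold rt
    rw [div_mul_cancel₀ _ this]; norm_num
  rw [Matrix.mem_unitaryGroup_iff, hs]
  unfold rmat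
  have hv : Matrix.vecMulVec (rv a b c) (star (rv a b c)) *
     Matrix.vecMulVec (rv a b c) (star (rv a b c)) =
      ((1 + Complex.normSq c : ℝ) : ℂ) • Matrix.vecMulVec (rv a b c) (star (rv a b c)) := by
    rw [Matrix.vecMulVec_mul_vecMulVec, hd]
    ext i j
    simp [Matrix.vecMulVec_apply]; ring
  rw [sub_mul, mul_sub, mul_sub, smul_mul_smul_comm, hv, smul_smul, mul_assoc, ht]
  simp only [one_mul, mul_one]
  rw [mul_comm, mul_smul, two_smul]
  abel

lemma rmat_row (a b : ι) (hab : a ≠ b) (c : ℂ) (w : ι → ℂ) :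
    (rmat a b c *ᵥ w) a = w a - rt c * (w a + conj c * w b) := by
  unfold rmat
  rw [Matrix.sub_mulVec, Matrix.smul_mulVec, Matrix.vecMulVec_mulVec, rv_dot]
  simp [rv, hab]
  ring

variable (μ : Measure (Matrix.unitaryGroup ι ℂ))
    [IsProbabilityMeasure μ] [μ.IsMulLeftInvariant]

lemma integ_of_bdd (f : Matrix.unitaryGroup ι ℂ → ℝ) (hf : Continuous f) (C : ℝ)
    (h : ∀ U, |f U| ≤ C) : Integrable f μ :=
  Integrable.of_bound hf.measurable.aestronglyMeasurable C (Filter.Eventually.of_forall h)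

lemma inv_int (φ : ι → ℂ) (a b : ι) (hab : a ≠ b) (c : ℂ) (g : ℝ → ℝ) :
    ∫ U, g (wsq φ a U) ∂μ = ∫ U, g (Complex.normSq (((U : Matrix ι ι ℂ) *ᵥ φ) a
      - rt c * ((((U : Matrix ι ι ℂ) *ᵥ φ) a) + conj c * (((U : Matrix ι ι ℂ) *ᵥ φ) b)))) ∂μ := by
  rw [← integral_mul_left_eq_self _ (⟨rmat a b c, rmat_mem a b hab c⟩ : Matrix.unitaryGroup ι ℂ)]
  congr 1
  ext U
  rw [← rmat_row a b hab c, Matrix.mulVec_mulVec]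
  rfl

lemma swap_int (φ : ι → ℂ) (a b : ι) (g : ℝ → ℝ) :
    ∫ U, g (wsq φ a U) ∂μ = ∫ U, g (wsq φ b U) ∂μ := by
  by_cases hab : a = b
  · rw [hab]
  rw [inv_int μ φ a b hab (-1) g]
  congr 1
  ext U
  congr 1
  simp [wsq, rt]
  norm_num

lemma phase_id (x y : ℂ) :
    (Complex.normSq (x - rt 2 * (x + conj 2 * y)))^2
    + (Complex.normSq (x - rt (-2) * (x + conj (-2) * y)))^2
    + (Complex.normSq (x - rt (2 * Complex.I) * (x + conj (2 * Complex.I) * y)))^2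
    + (Complex.normSq (x - rt (-2 * Complex.I) * (x + conj (-2 * Complex.I) * y)))^2
    = 4 / 625 * (81 * Complex.normSq x ^ 2 + 256 * Complex.normSq y ^ 2
        + 576 * (Complex.normSq x * Complex.normSq y)) := by
  have e1 : rt 2 = 2/5 := by simp [rt, Complex.normSq_apply]; norm_num
  have e2 : rt (-2) = 2/5 := by simp [rt, Complex.normSq_apply]; norm_num
  have e3 : rt (2 * Complex.I) = 2/5 := by simp [rt, Complex.normSq_apply]; norm_num
  have e4 : rt (-2 * Complex.I) = 2/5 := by simp [rt, Complex.normSq_apply]; norm_num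
  rw [e1, e2, e3, e4]
  obtain ⟨p, q⟩ := x
  obtain ⟨r, s⟩ := y
  have h25 : ((2/5 : ℝ) : ℂ) = ⟨2/5, 0⟩ := rfl
  have h2 : (2 : ℂ) = ⟨2, 0⟩ := by apply Complex.ext <;> simp
  rw [h25, h2]
  simp only [Complex.normSq_apply, Complex.sub_re, Complex.sub_im, Complex.mul_re, Complex.mul_im,
    Complex.add_re, Complex.add_im, Complex.conj_re, Complex.conj_im, Complex.neg_re,
    Complex.neg_im, Complex.I_re, Complex.I_im]
  ring

lemma wsq_mul_int (φ : ι → ℂ) (hφ : inn φ φ = 1) (a b : ι) :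
    Integrable (fun U => wsq φ a U * wsq φ b U) μ := by
  refine integ_of_bdd μ _ ((wsq_cont φ a).mul (wsq_cont φ b)) 1 fun U => ?_
  rw [abs_of_nonneg (mul_nonneg (wsq_nonneg φ a U) (wsq_nonneg φ b U))]
  exact mul_le_one₀ (wsq_le_one φ hφ a U) (wsq_nonneg φ b U) (wsq_le_one φ hφ b U)

lemma wsq_int (φ : ι → ℂ) (hφ : inn φ φ = 1) (a : ι) :
    Integrable (fun U => wsq φ a U) μ := by
  refine integ_of_bdd μ _ (wsq_cont φ a) 1 fun U => ?_
  rw [abs_of_nonneg (wsq_nonneg φ a U)]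
  exact wsq_le_one φ hφ a U

lemma refl_int (φ : ι → ℂ) (hφ : inn φ φ = 1) (a b : ι) (hab : a ≠ b) (c : ℂ) :
    Integrable (fun U : Matrix.unitaryGroup ι ℂ => (Complex.normSq (((U : Matrix ι ι ℂ) *ᵥ φ) a
      - rt c * ((((U : Matrix ι ι ℂ) *ᵥ φ) a) + conj c * (((U : Matrix ι ι ℂ) *ᵥ φ) b))))^2) μ := by
  have h := (wsq_mul_int μ φ hφ a a).comp_mul_left
    (⟨rmat a b c, rmat_mem a b hab c⟩ : Matrix.unitaryGroup ι ℂ)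
  convert h using 2 with U
  rw [← rmat_row a b hab c, Matrix.mulVec_mulVec, sq]
  rfl

lemma cross (φ : ι → ℂ) (hφ : inn φ φ = 1) (a b : ι) (hab : a ≠ b) :
    ∫ U, wsq φ a U ^ 2 ∂μ = 2 * ∫ U, wsq φ a U * wsq φ b U ∂μ := by
  have hA : ∫ U, wsq φ a U ^ 2 ∂μ = ∫ U, wsq φ b U ^ 2 ∂μ := swap_int μ φ a b (· ^ 2)
  have h1 := inv_int μ φ a b hab 2 (· ^ 2)
  have h2 := inv_int μ φ a b hab (-2) (· ^ 2)
  have h3 := inv_int μ φ a b hab (2 * Complex.I) (· ^ 2)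
  have h4 := inv_int μ φ a b hab (-2 * Complex.I) (· ^ 2)
  have i1 := refl_int μ φ hφ a b hab 2
  have i2 := refl_int μ φ hφ a b hab (-2)
  have i3 := refl_int μ φ hφ a b hab (2 * Complex.I)
  have i4 := refl_int μ φ hφ a b hab (-2 * Complex.I)
  have ia : Integrable (fun U => wsq φ a U ^ 2) μ := by
    simpa only [sq] using wsq_mul_int μ φ hφ a a
  have ib : Integrable (fun U => wsq φ b U ^ 2) μ := by
    simpa only [sq] using wsq_mul_int μ φ hφ b b
  have iab := wsq_mul_int μ φ hφ a b
  have key := integral_congr_ae (μ := μ) (Filter.Eventually.of_forall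
    fun U : Matrix.unitaryGroup ι ℂ =>
      phase_id (((U : Matrix ι ι ℂ) *ᵥ φ) a) (((U : Matrix ι ι ℂ) *ᵥ φ) b))
  rw [integral_add ((i1.fun_add i2).fun_add i3) i4, integral_add (i1.fun_add i2) i3, integral_add i1 i2,
    ← h1, ← h2, ← h3, ← h4] at key
  have key2 : ∫ U, (4 / 625 * (81 * wsq φ a U ^ 2 + 256 * wsq φ b U ^ 2
        + 576 * (wsq φ a U * wsq φ b U))) ∂μ = 4 / 625 * (81 * ∫ U, wsq φ a U ^ 2 ∂μ
        + 256 * ∫ U, wsq φ b U ^ 2 ∂μ + 576 * ∫ U, wsq φ a U * wsq φ b U ∂μ) := by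
    rw [integral_const_mul, integral_add ((ia.const_mul _).fun_add (ib.const_mul _)) (iab.const_mul _),
      integral_add (ia.const_mul _) (ib.const_mul _)]
    simp only [integral_const_mul]
  have key3 := key.trans key2
  linarith

lemma cross' (φ : ι → ℂ) (hφ : inn φ φ = 1) (z a b : ι) :
    ∫ U, wsq φ a U * wsq φ b U ∂μ
      = (∫ U, wsq φ z U ^ 2 ∂μ) / 2 * (1 + if a = b then 1 else 0) := by
  have hA : ∫ U, wsq φ a U ^ 2 ∂μ = ∫ U, wsq φ z U ^ 2 ∂μ := swap_int μ φ a z (· ^ 2)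
  split_ifs with h
  · subst h
    rw [← hA]; simp only [sq]; ring
  · have := cross μ φ hφ a b h
    linarith

lemma sum_cross {κ : Type*} [Fintype κ] [DecidableEq κ] (e : κ → ι) (he : Function.Injective e)
    (φ : ι → ℂ) (hφ : inn φ φ = 1) (z : ι) :
    ∫ U, (∑ j, wsq φ (e j) U) ^ 2 ∂μ
      = (∫ U, wsq φ z U ^ 2 ∂μ) / 2 * (Fintype.card κ * (Fintype.card κ + 1)) := by
  simp only [sq (∑ j, wsq φ (e j) _), Finset.sum_mul_sum]
  rw [integral_finsetSum _ fun i _ => integrable_finsetSum _ fun j _ => wsq_mul_int μ φ hφ _ _]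
  have : ∀ i : κ, ∫ U, ∑ j, wsq φ (e i) U * wsq φ (e j) U ∂μ
      = (∫ U, wsq φ z U ^ 2 ∂μ) / 2 * (Fintype.card κ + 1) := by
    intro i
    rw [integral_finsetSum _ fun j _ => wsq_mul_int μ φ hφ _ _]
    simp only [cross' μ φ hφ z, ← Finset.mul_sum, Finset.sum_add_distrib, he.eq_iff]
    simp
  simp only [this]
  simp
  ring

lemma sum_first {κ : Type*} [Fintype κ] (e : κ → ι)
    (φ : ι → ℂ) (hφ : inn φ φ = 1) (z : ι) :
    ∫ U, (∑ j, wsq φ (e j) U) ∂μ = Fintype.card κ * ∫ U, wsq φ z U ∂μ := by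
  rw [integral_finsetSum _ fun i _ => wsq_int μ φ hφ _]
  simp only [fun i => swap_int μ φ i z (fun x => x)]
  simp

end helpers

lemma inn_sliceV (P d m : ℕ) (hP : 0 < P) (φ : Fin P × Fin d → ℂ) (χ : Fin m → ℂ)
    (hχ : inn χ χ = 1) (U : Matrix.unitaryGroup (Fin P × Fin d) ℂ) :
    inn (sliceV P d m hP U (prodVec P d m φ χ)) (sliceV P d m hP U (prodVec P d m φ χ))
      = ((P * ∑ j : Fin d, wsq φ ((⟨0, hP⟩ : Fin P), j) U : ℝ) : ℂ) := by
  have h : ∀ j y, sliceV P d m hP U (prodVec P d m φ χ) (j, y)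
      = (Real.sqrt P : ℂ) * (((U : Matrix _ _ ℂ) *ᵥ φ) ((⟨0, hP⟩ : Fin P), j) * χ y) := by
    intro j y
    simp only [sliceV, prodVec, Matrix.mulVec, dotProduct, Finset.sum_mul, mul_assoc]
  have hs : (Real.sqrt P : ℂ) * (Real.sqrt P : ℂ) = P := by
    rw [← Complex.ofReal_mul, Real.mul_self_sqrt (Nat.cast_nonneg _)]; simp
  unfold inn at hχ ⊢
  rw [Fintype.sum_prod_type]
  push_cast
  rw [Finset.mul_sum]
  refine Finset.sum_congr rfl fun j _ => ?_
  simp only [h, map_mul, Complex.conj_ofReal, wsq, Complex.normSq_eq_conj_mul_self]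
  rw [← mul_one (_ * (_ * _)), ← hχ, Finset.mul_sum, ← hs]
  refine Finset.sum_congr rfl fun y _ => ?_
  ring

/-- **Failure of emergence, lower bound.**  Assume `P ≥ 2` and `Pd ≥ 2`.  For every unit
product vector `ψ₀ = φ ⊗ χ ∈ ℂ^{Pd} ⊗ ℂ^m`, the averaged norm fluctuation is bounded below
by the inverse χ-dimension:
`∫ |⟨ψ₀, V(U)†V(U) ψ₀⟩ − 1|² dμ(U) ≥ 1/(4d)`,
where `μ` is the Haar probability measure (the left- and right-invariant Borel probability
measure) on `U(Pd)`. -/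
theorem sliceV_fluctuation_lower_bound (P d m : ℕ) (hP : 2 ≤ P) (hd : 0 < d)
    (hm : 0 < m) (hPd : 2 ≤ P * d)
    (μ : Measure (Matrix.unitaryGroup (Fin P × Fin d) ℂ))
    [IsProbabilityMeasure μ] [μ.IsMulLeftInvariant] [μ.IsMulRightInvariant]
    (φ : Fin P × Fin d → ℂ) (χ : Fin m → ℂ)
    (hφ : inn φ φ = 1) (hχ : inn χ χ = 1) :
    1 / (4 * (d : ℝ)) ≤
      ∫ U, ‖inn (sliceV P d m (lt_of_lt_of_le two_pos hP) U (prodVec P d m φ χ))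
              (sliceV P d m (lt_of_lt_of_le two_pos hP) U (prodVec P d m φ χ)) - 1‖ ^ 2 ∂μ := by
  have hP0 : 0 < P := lt_of_lt_of_le two_pos hP
  let z : Fin P × Fin d := (⟨0, hP0⟩, ⟨0, hd⟩)
  let e : Fin d → Fin P × Fin d := fun j => (⟨0, hP0⟩, j)
  have he : Function.Injective e := fun i j h => (Prod.mk.inj h).2
  have hint : ∀ U, ‖inn (sliceV P d m (lt_of_lt_of_le two_pos hP) U (prodVec P d m φ χ))
              (sliceV P d m (lt_of_lt_of_le two_pos hP) U (prodVec P d m φ χ)) - 1‖ ^ 2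
      = (P:ℝ)^2 * (∑ j, wsq φ (e j) U)^2 - 2 * P * (∑ j, wsq φ (e j) U) + 1 := by
    intro U
    rw [inn_sliceV P d m hP0 φ χ hχ U, ← Complex.ofReal_one, ← Complex.ofReal_sub,
      Complex.norm_real, Real.norm_eq_abs, sq_abs]
    ring
  simp only [hint]
  have iS : Integrable (fun U => ∑ j, wsq φ (e j) U) μ :=
    integrable_finsetSum _ fun j _ => wsq_int μ φ hφ _
  have iS2 : Integrable (fun U => (∑ j, wsq φ (e j) U) ^ 2) μ := by
    simp only [sq, Finset.sum_mul_sum]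
    exact integrable_finsetSum _ fun i _ => integrable_finsetSum _ fun j _ => wsq_mul_int μ φ hφ _ _
  have iT : Integrable (fun U => (P:ℝ)^2 * (∑ j, wsq φ (e j) U)^2
      - 2 * P * (∑ j, wsq φ (e j) U)) μ := (iS2.const_mul _).sub (iS.const_mul _)
  rw [integral_add iT (integrable_const _),
    integral_sub (iS2.const_mul _) (iS.const_mul _), integral_const_mul, integral_const_mul,
    sum_cross μ e he φ hφ z, sum_first μ e φ hφ z]
  have t1 := sum_cross μ (id : Fin P × Fin d → _) Function.injective_id φ hφ z
  have t2 := sum_first μ (id : Fin P × Fin d → _) φ hφ z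
  simp only [id, wsq_sum φ hφ] at t1 t2
  simp at t1 t2 ⊢
  set A := ∫ U, wsq φ z U ^ 2 ∂μ
  set B := ∫ U, wsq φ z U ∂μ
  have hdR : (1:ℝ) ≤ d := by exact_mod_cast hd
  have hPR : (2:ℝ) ≤ P := by exact_mod_cast hP
  have hA : A = 2 / (P * d * (P * d + 1)) := by
    field_simp; linarith
  have hB : B = 1 / (P * d) := by
    field_simp; linarith
  rw [hA, hB]
  have : (P:ℝ) ^ 2 * (2 / (P * d * (P * d + 1)) / 2 * (d * (d + 1))) - 2 * P * (d * (1 / (P * d))) + 1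
     = (P - 1) / (P * d + 1) := by
    field_simp; ring
  rw [this, ← mul_inv, ← one_div, div_le_div_iff₀ (by positivity) (by positivity)]
  nlinarith
end

section
/- Uniform upper bound on inner-product fluctuations: assume Pd ≥ 2. For all unit vectors ψ₁, ψ₂ ∈ ℂ^{Pd} ⊗ ℂ^m, ∫ |⟨ψ₁, V(U)†V(U) ψ₂⟩ − ⟨ψ₁, ψ₂⟩|² dμ(U) ≤ 2 · tr(ψ₁^out ψ₂^out)/d, and in particular this integral is at most 2/d. -/
open MeasureTheory ComplexConjugate
open scoped Matrix

section Aux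

variable {ι : Type*} [Fintype ι] [DecidableEq ι]

lemma aux_compact : CompactSpace (Matrix.unitaryGroup ι ℂ) := by
  apply isCompact_iff_compactSpace.mp
  have h1 : IsCompact (Set.pi Set.univ (fun _ : ι => Set.pi Set.univ
      (fun _ : ι => Metric.closedBall (0 : ℂ) 1))) :=
    isCompact_univ_pi (fun _ => isCompact_univ_pi (fun _ => isCompact_closedBall _ _))
  refine IsCompact.of_isClosed_subset (X := Matrix ι ι ℂ)
    (t := (Matrix.unitaryGroup ι ℂ : Set (Matrix ι ι ℂ))) h1 ?_ ?_
  · have : (Matrix.unitaryGroup ι ℂ : Set (Matrix ι ι ℂ)) = {A | star A * A = 1} := by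
      ext A
      exact Matrix.mem_unitaryGroup_iff'
    rw [this]
    exact isClosed_eq (by fun_prop) continuous_const
  · intro A hA i _ j _
    simpa using entry_norm_bound_of_unitary hA i j

/-- conjugated matrix -/
noncomputable def auxN (M : Matrix ι ι ℂ) (U : Matrix.unitaryGroup ι ℂ) : Matrix ι ι ℂ :=
  star (U : Matrix ι ι ℂ) * M * (U : Matrix ι ι ℂ)

lemma auxN_cont (M : Matrix ι ι ℂ) : Continuous (auxN M) := by
  unfold auxN
  fun_prop

lemma auxN_cont' (M : Matrix ι ι ℂ) (x y : ι) : Continuous (fun U => auxN M U x y) :=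
  (auxN_cont M).matrix_elem x y

lemma auxN_mul (M : Matrix ι ι ℂ) (U W : Matrix.unitaryGroup ι ℂ) :
    auxN M (U * W) = star (W : Matrix ι ι ℂ) * auxN M U * (W : Matrix ι ι ℂ) := by
  simp [auxN, Matrix.mul_assoc]

variable (μ : Measure (Matrix.unitaryGroup ι ℂ)) [IsProbabilityMeasure μ]

lemma aux_integrable {f : Matrix.unitaryGroup ι ℂ → ℂ} (hf : Continuous f) : Integrable f μ := by
  have := aux_compact (ι := ι)
  exact hf.integrable_of_hasCompactSupport (HasCompactSupport.of_compactSpace f)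

lemma aux_quad {κ : Type*} [Fintype κ] (F : κ → Matrix.unitaryGroup ι ℂ → ℂ)
    (hF : ∀ k, Continuous (F k)) (c : κ → ℂ) :
    ∫ U, (∑ k, c k * F k U) * conj (∑ k, c k * F k U) ∂μ
      = ∑ k, ∑ l, c k * conj (c l) * ∫ U, F k U * conj (F l U) ∂μ := by
  have h : ∀ U, (∑ k, c k * F k U) * conj (∑ k, c k * F k U)
      = ∑ k, ∑ l, c k * conj (c l) * (F k U * conj (F l U)) := by
    intro U
    rw [map_sum, Finset.sum_mul_sum]
    refine Finset.sum_congr rfl fun k _ => Finset.sum_congr rfl fun l _ => ?_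
    rw [map_mul]; ring
  have hc : ∀ k l, Continuous (fun U => c k * conj (c l) * (F k U * conj (F l U))) := by
    intro k l
    have := hF k
    have := hF l
    have := Complex.continuous_conj
    fun_prop
  simp_rw [h]
  rw [integral_finsetSum _ (fun k _ => integrable_finsetSum _
    fun l _ => aux_integrable μ (hc k l))]
  refine Finset.sum_congr rfl fun k _ => ?_
  rw [integral_finsetSum _ (fun l _ => aux_integrable μ (hc k l))]
  refine Finset.sum_congr rfl fun l _ => ?_
  rw [integral_const_mul]

/-- second moments -/
noncomputable def auxB (M : Matrix ι ι ℂ) (a b c e : ι) : ℂ :=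
  ∫ U, auxN M U a b * conj (auxN M U c e) ∂μ

variable [μ.IsMulRightInvariant]

lemma auxB_inv (M : Matrix ι ι ℂ) (W : Matrix ι ι ℂ) (hW : star W * W = 1) (a b c e : ι) :
    auxB μ M a b c e = ∫ U, (star W * auxN M U * W) a b *
      conj ((star W * auxN M U * W) c e) ∂μ := by
  have h := integral_mul_right_eq_self (μ := μ)
    (fun U => auxN M U a b * conj (auxN M U c e)) ⟨W, Matrix.mem_unitaryGroup_iff'.2 hW⟩
  unfold auxB
  rw [← h]
  simp only [auxN_mul]

lemma auxB_phase (M : Matrix ι ι ℂ) (w : ι → ℂ) (hw : ∀ i, conj (w i) * w i = 1) (a b c e : ι) :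
    auxB μ M a b c e = conj (w a) * w b * w c * conj (w e) * auxB μ M a b c e := by
  conv_lhs => rw [auxB_inv μ M (Matrix.diagonal w) (by
    rw [Matrix.star_eq_conjTranspose, Matrix.diagonal_conjTranspose, Matrix.diagonal_mul_diagonal]
    rw [← Matrix.diagonal_one]
    congr 1
    ext i
    exact hw i) a b c e]
  unfold auxB
  rw [← integral_const_mul]
  congr 1
  ext U
  rw [Matrix.star_eq_conjTranspose, Matrix.diagonal_conjTranspose]
  simp only [Matrix.mul_diagonal, Matrix.diagonal_mul, Pi.star_apply, map_mul]
  simp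
  ring

lemma auxB_zero (M : Matrix ι ι ℂ) (a b c e : ι) (h1 : ¬ (a = b ∧ c = e))
    (h2 : ¬ (a = c ∧ b = e)) : auxB μ M a b c e = 0 := by
  have key : ∀ t : ι, auxB μ M a b c e = 0 ∨ 
      (conj (if a = t then Complex.I else 1) * (if b = t then Complex.I else 1) *
      (if c = t then Complex.I else 1) * conj (if e = t then Complex.I else 1)) = 1 := by
    intro t
    have := auxB_phase μ M (fun s => if s = t then Complex.I else 1)
      (by intro i; split_ifs <;> simp) a b c e
    by_cases h : auxB μ M a b c e = 0
    · exact Or.inl h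
    · right
      exact mul_right_cancel₀ h (by rw [one_mul]; exact this.symm)
  by_contra hne
  have key' := fun t => (key t).resolve_left hne
  have hI1 : Complex.I ≠ 1 := by
    intro h; simpa using congrArg Complex.re h
  have hI2 : Complex.I ≠ -1 := by
    intro h; simpa using congrArg Complex.re h
  have hI3 : (-1 : ℂ) ≠ 1 := by norm_num
  have hI4 : -Complex.I ≠ 1 := by
    intro h; simpa using congrArg Complex.re h
  have ka := key' a
  have kb := key' b
  have kc := key' c
  have ke := key' e
  by_cases hab : a = b
  · subst hab
    have hce : c ≠ e := fun h => h1 ⟨rfl, h⟩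
    by_cases hac : a = c
    · subst hac
      simp [hce, hce.symm] at ka 
      exact hI1 ka
    · simp [hce, hce.symm, hac] at kc
      exact hI1 kc
  · by_cases hac : a = c
    · subst hac
      have hbe : b ≠ e := fun h => h2 ⟨rfl, h⟩
      by_cases hae : a = e
      · subst hae
        simp [hab, Ne.symm hab] at kb
        exact hI1 kb
      · simp [hab, Ne.symm hab, hbe, hbe.symm] at kb
        exact hI1 kb
    · by_cases hae : a = e
      · subst hae
        simp [Ne.symm hab, Ne.symm hac] at ka
        norm_num at ka
      · simp [Ne.symm hab, Ne.symm hac, Ne.symm hae] at ka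
        exact hI4 ka

/-- swap matrix -/
def auxS (x y : ι) : Matrix ι ι ℂ := fun a b => if a = Equiv.swap x y b then 1 else 0

lemma auxS_star (x y : ι) : star (auxS x y) = auxS x y := by
  ext a b
  simp only [Matrix.star_apply, auxS]
  by_cases h : a = Equiv.swap x y b
  · have h' : b = Equiv.swap x y a := by rw [h]; simp
    rw [if_pos h, if_pos h']; simp
  · have h' : b ≠ Equiv.swap x y a := by rintro rfl; simp at h
    rw [if_neg h, if_neg h']; simp

lemma auxS_mul (x y : ι) (A : Matrix ι ι ℂ) (a b : ι) :
    (A * auxS x y) a b = A a (Equiv.swap x y b) := by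
  simp [Matrix.mul_apply, auxS]

lemma auxS_mul' (x y : ι) (A : Matrix ι ι ℂ) (a b : ι) :
    (auxS x y * A) a b = A (Equiv.swap x y a) b := by
  have h : ∀ c, auxS x y a c = if c = Equiv.swap x y a then 1 else 0 := by
    intro c
    have := congrFun (congrFun (auxS_star x y) a) c
    rw [← this, Matrix.star_apply, auxS]
    split_ifs <;> simp
  simp [Matrix.mul_apply, h]

lemma auxS_sq (x y : ι) : auxS x y * auxS x y = (1 : Matrix ι ι ℂ) := by
  ext a b
  rw [auxS_mul]
  simp [auxS, Matrix.one_apply]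

lemma auxB_swap (M : Matrix ι ι ℂ) (x y a b c e : ι) :
    auxB μ M a b c e = auxB μ M (Equiv.swap x y a) (Equiv.swap x y b)
      (Equiv.swap x y c) (Equiv.swap x y e) := by
  rw [auxB_inv μ M (auxS x y) (by rw [auxS_star, auxS_sq]) a b c e]
  simp only [auxS_star, auxS_mul, auxS_mul']
  rfl

lemma auxB_rot (M : Matrix ι ι ℂ) (x y : ι) (hxy : x ≠ y) :
    4 * auxB μ M x y x y = auxB μ M x y x y + auxB μ M y x y x + auxB μ M x x x x
      + auxB μ M y y y y - auxB μ M x x y y - auxB μ M y y x x := by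
  have hs : ((Real.sqrt 2 : ℝ) : ℂ)⁻¹ * ((Real.sqrt 2 : ℝ) : ℂ)⁻¹ = 2⁻¹ := by
    rw [← mul_inv, ← Complex.ofReal_mul, Real.mul_self_sqrt (by norm_num)]; norm_num
  set s : ℂ := ((Real.sqrt 2 : ℝ) : ℂ)⁻¹ with hsdef
  have hsc : star s = s := by simp [hsdef]
  set W : Matrix ι ι ℂ := s • (1 + Complex.I • auxS x y) with hWdef
  have hWs : star W = s • (1 - Complex.I • auxS x y) := by
    rw [hWdef, star_smul, hsc, star_add, star_smul, auxS_star]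
    simp [sub_eq_add_neg]
  have hW : star W * W = 1 := by
    rw [hWs, hWdef, smul_mul_smul_comm, hs, sub_mul, mul_add, mul_add, smul_mul_smul_comm, auxS_sq]
    have h2 : (1 * 1 + 1 * Complex.I • auxS x y - (Complex.I • auxS x y * 1 +
        (Complex.I * Complex.I) • (1 : Matrix ι ι ℂ))) = (2 : ℂ) • (1 : Matrix ι ι ℂ) := by
      rw [Complex.I_mul_I, two_smul, one_mul, one_mul, mul_one, neg_smul, one_smul]
      abel
    rw [h2, smul_smul]
    simp
  have hE : ∀ N : Matrix ι ι ℂ, (star W * N * W) x y =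
      ∑ k : Fin 4, ![2⁻¹, 2⁻¹, 2⁻¹ * Complex.I, -(2⁻¹ * Complex.I)] k *
        (![N x y, N y x, N x x, N y y] k) := by
    intro N
    have : star W * N * W = (2⁻¹ : ℂ) • (N + Complex.I • (N * auxS x y)
        - Complex.I • (auxS x y * N) + (auxS x y * N) * auxS x y) := by
      rw [hWs, hWdef, smul_mul_assoc, smul_mul_smul_comm, hs]
      congr 1
      rw [sub_mul, one_mul, mul_add, mul_one, sub_mul, smul_mul_assoc, smul_mul_smul_comm,
        mul_smul_comm, Complex.I_mul_I]
      simp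
      abel
    rw [this]
    simp only [Matrix.smul_apply, Matrix.add_apply, Matrix.sub_apply, auxS_mul, auxS_mul',
      Equiv.swap_apply_left, Equiv.swap_apply_right, smul_eq_mul, Fin.sum_univ_four]
    simp
    ring
  have h := auxB_inv μ M W hW x y x y
  simp only [hE] at h
  have h2 := aux_quad μ (fun (k : Fin 4) (U : Matrix.unitaryGroup ι ℂ) =>
    ![auxN M U x y, auxN M U y x, auxN M U x x, auxN M U y y] k) (by
      intro k
      fin_cases k
      exacts [auxN_cont' M _ _, auxN_cont' M _ _, auxN_cont' M _ _, auxN_cont' M _ _])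
      ![2⁻¹, 2⁻¹, 2⁻¹ * Complex.I, -(2⁻¹ * Complex.I)]
  rw [h2] at h
  have hB : ∀ a b c e, ∫ U, auxN M U a b * conj (auxN M U c e) ∂μ = auxB μ M a b c e :=
    fun _ _ _ _ => rfl
  have hyx := hxy.symm
  simp [Fin.sum_univ_four, hB] at h
  rw [auxB_zero μ M x y y x (by tauto) (by tauto), auxB_zero μ M x y x x (by tauto) (by tauto),
    auxB_zero μ M x y y y (by tauto) (by tauto), auxB_zero μ M y x x x (by tauto) (by tauto),
    auxB_zero μ M y x y y (by tauto) (by tauto), auxB_zero μ M y x x y (by tauto) (by tauto),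
    auxB_zero μ M x x x y (by tauto) (by tauto), auxB_zero μ M x x y x (by tauto) (by tauto),
    auxB_zero μ M y y x y (by tauto) (by tauto), auxB_zero μ M y y y x (by tauto) (by tauto)] at h
  have hc2 : conj (2 : ℂ) = 2 := Complex.conj_ofNat 2
  rw [hc2] at h
  ring_nf at h
  simp only [Complex.I_sq] at h
  linear_combination 4 * h

lemma auxN_trace (M : Matrix ι ι ℂ) (U : Matrix.unitaryGroup ι ℂ) :
    ∑ x, auxN M U x x = M.trace := by
  have : (auxN M U).trace = M.trace := by
    unfold auxN
    rw [Matrix.trace_mul_comm, ← mul_assoc, Matrix.mem_unitaryGroup_iff.1 U.2, one_mul]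
  exact this

lemma auxN_frob (M : Matrix ι ι ℂ) (U : Matrix.unitaryGroup ι ℂ) :
    ∑ x, ∑ y, auxN M U x y * conj (auxN M U x y) = (M * star M).trace := by
  have : (auxN M U * star (auxN M U)).trace = (M * star M).trace := by
    have h := Matrix.mem_unitaryGroup_iff.1 U.2
    have : auxN M U * star (auxN M U) = auxN (M * star M) U := by
      unfold auxN
      simp only [star_mul, star_star]
      calc _ = star (U : Matrix ι ι ℂ) * M * ((U : Matrix ι ι ℂ) * star (U : Matrix ι ι ℂ)) *
            star M * U := by simp only [mul_assoc]
        _ = _ := by rw [h]; simp [mul_assoc]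
    rw [this]
    exact auxN_trace _ U
  rw [← this]
  simp [Matrix.trace, Matrix.mul_apply]

lemma auxB_formula (M : Matrix ι ι ℂ) (hM : M.trace = 0) (hD : 2 ≤ Fintype.card ι) :
    ∃ α : ℂ, α * ((Fintype.card ι : ℂ) ^ 2 - 1) = (M * star M).trace ∧
      ∀ a b c e, auxB μ M a b c e = α * ((if a = c ∧ b = e then 1 else 0)
        - (Fintype.card ι : ℂ)⁻¹ * (if a = b ∧ c = e then 1 else 0)) := by
  obtain ⟨x₀, y₀, h₀⟩ := Fintype.exists_pair_of_one_lt_card (α := ι) (by omega)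
  set α := auxB μ M x₀ y₀ x₀ y₀ with hα
  set β := auxB μ M x₀ x₀ x₀ x₀ with hβ
  have hD0 : (Fintype.card ι : ℂ) ≠ 0 := by
    exact_mod_cast (by omega : Fintype.card ι ≠ 0)
  -- constancy
  have hsw : ∀ x y, auxB μ M x y x y = auxB μ M y x y x := by
    intro x y
    rw [auxB_swap μ M x y x y x y]; simp
  have hr : ∀ x y z, x ≠ y → x ≠ z → auxB μ M x y x y = auxB μ M x z x z := by
    intro x y z h1 h2
    rw [auxB_swap μ M y z x y x y]; simp [Equiv.swap_apply_of_ne_of_ne h1 h2]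
  have hαc : ∀ x y, x ≠ y → auxB μ M x y x y = α := by
    intro x y h
    by_cases hx : x₀ = y
    · subst hx
      rw [hsw, hr x₀ x y₀ h.symm h₀]
    · rw [hsw, hr y x x₀ h.symm (Ne.symm hx), hsw, hr x₀ y y₀ hx h₀]
  have hβc : ∀ x, auxB μ M x x x x = β := by
    intro x
    rw [auxB_swap μ M x x₀ x x x x]; simp [hβ]
  have hγ : ∀ x y, x ≠ y → auxB μ M x x y y = β - α := by
    intro x y h
    have h1 := auxB_rot μ M x y h
    have h2 : auxB μ M y y x x = auxB μ M x x y y := by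
      rw [auxB_swap μ M x y y y x x]; simp
    rw [hαc x y h, hαc y x h.symm, hβc, hβc, h2] at h1
    linear_combination (1/2) * h1
  have hsum : ∑ z, auxB μ M x₀ x₀ z z = 0 := by
    unfold auxB
    rw [← integral_finsetSum]
    · have : ∀ U, ∑ z, auxN M U x₀ x₀ * conj (auxN M U z z) = 0 := by
        intro U
        rw [← Finset.mul_sum, ← map_sum, auxN_trace, hM]; simp
      simp [this]
    · intro z _
      exact aux_integrable μ ((auxN_cont' M _ _).mul
        (Complex.continuous_conj.comp (auxN_cont' M _ _)))
  have hβα : β * Fintype.card ι = α * (Fintype.card ι - 1) := by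
    have h : ∀ z, auxB μ M x₀ x₀ z z = (β - α) + if x₀ = z then α else 0 := by
      intro z
      split_ifs with hz
      · subst hz; rw [hβc]; ring
      · rw [hγ _ _ hz]; ring
    simp [h, Finset.sum_add_distrib] at hsum
    linear_combination hsum
  have hform : ∀ a b c e, auxB μ M a b c e = α * ((if a = c ∧ b = e then 1 else 0)
        - (Fintype.card ι : ℂ)⁻¹ * (if a = b ∧ c = e then 1 else 0)) := by
    have hβ' : β = α * (1 - (Fintype.card ι : ℂ)⁻¹) := by
      field_simp
      linear_combination hβα
    intro a b c e
    by_cases h1 : a = b ∧ c = e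
    · obtain ⟨rfl, rfl⟩ := h1
      by_cases hac : a = c
      · subst hac
        rw [hβc, hβ']; simp
      · rw [hγ _ _ hac, hβ']; simp [hac]; ring
    · by_cases h2 : a = c ∧ b = e
      · obtain ⟨rfl, rfl⟩ := h2
        have : a ≠ b := fun h => h1 ⟨h, h⟩
        rw [hαc _ _ this]; simp [this]
      · rw [auxB_zero μ M a b c e h1 h2]; simp [h1, h2]
  refine ⟨α, ?_, hform⟩
  have hF : ∑ x, ∑ y, auxB μ M x y x y = (M * star M).trace := by
    have hi : ∀ x y, Integrable (fun U => auxN M U x y * conj (auxN M U x y)) μ := fun x y =>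
      aux_integrable μ ((auxN_cont' M _ _).mul
        (Complex.continuous_conj.comp (auxN_cont' M _ _)))
    unfold auxB
    simp_rw [← integral_finsetSum Finset.univ (fun y _ => hi _ y)]
    rw [← integral_finsetSum Finset.univ
      (fun x _ => integrable_finsetSum _ (fun y _ => hi x y))]
    simp [auxN_frob]
  rw [← hF]
  simp only [hform]
  simp [← Finset.mul_sum, Finset.sum_sub_distrib]
  field_simp

end Aux

lemma aux_norm_sq {κ : Type*} [Fintype κ] (f : κ → ℂ) (h : inn f f = 1) :
    ∑ x, ‖f x‖ ^ 2 = 1 := by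
  have : ((∑ x, ‖f x‖ ^ 2 : ℝ) : ℂ) = 1 := by
    rw [← h]
    unfold inn
    push_cast
    exact Finset.sum_congr rfl fun x _ => (Complex.conj_mul' (f x)).symm
  exact_mod_cast this

/-- contraction matrix over the out factor -/
noncomputable def auxA (P d m : ℕ) (ψ₁ ψ₂ : (Fin P × Fin d) × Fin m → ℂ)
    (k : (Fin P × Fin d) × (Fin P × Fin d)) : ℂ :=
  ∑ y, conj (ψ₁ (k.1, y)) * ψ₂ (k.2, y)

/-- traceless diagonal matrix -/
noncomputable def auxM (P d : ℕ) (hP : 0 < P) : Matrix (Fin P × Fin d) (Fin P × Fin d) ℂ :=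
  Matrix.diagonal fun x => (if x.1 = ⟨0, hP⟩ then (P : ℂ) else 0) - 1

lemma auxM_trace (P d : ℕ) (hP : 0 < P) : (auxM P d hP).trace = 0 := by
  rw [auxM, Matrix.trace_diagonal, Fintype.sum_prod_type_right]
  simp [Finset.sum_sub_distrib]

lemma auxM_frob (P d : ℕ) (hP : 0 < P) :
    (auxM P d hP * star (auxM P d hP)).trace = (P * d : ℂ) * (P - 1) := by
  rw [auxM, Matrix.star_eq_conjTranspose, Matrix.diagonal_conjTranspose,
    Matrix.diagonal_mul_diagonal, Matrix.trace_diagonal, Fintype.sum_prod_type]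
  have h : ∀ x : Fin P, ((if x = ⟨0, hP⟩ then (P : ℂ) else 0) - 1) *
      star ((if x = ⟨0, hP⟩ then (P : ℂ) else 0) - 1) =
      (if x = ⟨0, hP⟩ then (P : ℂ) ^ 2 - 2 * P else 0) + 1 := by
    intro x
    split_ifs
    · simp; ring
    · simp
  simp only [Pi.star_apply, h]
  simp [← Finset.mul_sum, Finset.sum_add_distrib]
  ring

lemma auxN_apply (P d : ℕ) (hP : 0 < P) (U : Matrix.unitaryGroup (Fin P × Fin d) ℂ)
    (x x' : Fin P × Fin d) :
    auxN (auxM P d hP) U x x' = P * (∑ j, conj (U.1 (⟨0, hP⟩, j) x) * U.1 (⟨0, hP⟩, j) x')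
      - if x = x' then 1 else 0 := by
  have h1 : (star U.1 * U.1) x x' = if x = x' then 1 else 0 := by
    rw [Matrix.mem_unitaryGroup_iff'.1 U.2, Matrix.one_apply]
  rw [← h1]
  unfold auxN auxM
  rw [Matrix.mul_apply, Matrix.mul_apply]
  simp only [Matrix.mul_diagonal, Matrix.star_apply]
  simp only [mul_sub, sub_mul, mul_one, Finset.sum_sub_distrib]
  congr 1
  rw [Fintype.sum_prod_type, Finset.sum_eq_single ⟨0, hP⟩]
  · rw [Finset.mul_sum]
    refine Finset.sum_congr rfl fun j _ => ?_
    simp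
    ring
  · intro b _ hb
    simp [hb]
  · simp

lemma aux_inn (P d m : ℕ) (hP : 0 < P) (U : Matrix.unitaryGroup (Fin P × Fin d) ℂ)
    (ψ₁ ψ₂ : (Fin P × Fin d) × Fin m → ℂ) :
    inn (sliceV P d m hP U ψ₁) (sliceV P d m hP U ψ₂) - inn ψ₁ ψ₂ =
      ∑ k, auxA P d m ψ₁ ψ₂ k * auxN (auxM P d hP) U k.1 k.2 := by
  simp only [auxN_apply, mul_sub, Finset.sum_sub_distrib]
  congr 1
  · have hs : (Real.sqrt P : ℂ) * (Real.sqrt P : ℂ) = P := by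
      rw [← Complex.ofReal_mul, Real.mul_self_sqrt (by positivity)]; simp
    have hl : inn (sliceV P d m hP U ψ₁) (sliceV P d m hP U ψ₂) =
        ∑ j, ∑ y, ∑ x, ∑ x', (P : ℂ) * (conj (U.1 (⟨0, hP⟩, j) x) * U.1 (⟨0, hP⟩, j) x' *
          (conj (ψ₁ (x, y)) * ψ₂ (x', y))) := by
      unfold inn sliceV
      rw [Fintype.sum_prod_type]
      refine Finset.sum_congr rfl fun j _ => Finset.sum_congr rfl fun y _ => ?_
      rw [map_mul, Complex.conj_ofReal, mul_mul_mul_comm, hs, map_sum, Finset.sum_mul_sum,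
        Finset.mul_sum]
      refine Finset.sum_congr rfl fun x _ => ?_
      rw [Finset.mul_sum]
      refine Finset.sum_congr rfl fun x' _ => ?_
      rw [map_mul]; ring
    rw [hl, Fintype.sum_prod_type]
    have hr : ∀ x x', auxA P d m ψ₁ ψ₂ (x, x') *
        ((P : ℂ) * (∑ j, conj (U.1 (⟨0, hP⟩, j) x) * U.1 (⟨0, hP⟩, j) x')) =
        ∑ j, ∑ y, (P : ℂ) * (conj (U.1 (⟨0, hP⟩, j) x) * U.1 (⟨0, hP⟩, j) x' *
          (conj (ψ₁ (x, y)) * ψ₂ (x', y))) := by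
      intro x x'
      unfold auxA
      rw [mul_comm, mul_assoc, Finset.sum_mul_sum, Finset.mul_sum]
      refine Finset.sum_congr rfl fun j _ => ?_
      rw [Finset.mul_sum]
    simp only [hr]
    calc _ = ∑ j, ∑ x, ∑ x', ∑ y, (P : ℂ) * (conj (U.1 (⟨0, hP⟩, j) x) * U.1 (⟨0, hP⟩, j) x' *
          (conj (ψ₁ (x, y)) * ψ₂ (x', y))) := by
          refine Finset.sum_congr rfl fun j _ => ?_
          rw [Finset.sum_comm]
          refine Finset.sum_congr rfl fun x _ => ?_
          rw [Finset.sum_comm]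
      _ = _ := by
          rw [Finset.sum_comm]
          refine Finset.sum_congr rfl fun x _ => ?_
          rw [Finset.sum_comm]
  · rw [Fintype.sum_prod_type]
    simp [inn, auxA, Fintype.sum_prod_type]

lemma aux_out (P d m : ℕ) (ψ₁ ψ₂ : (Fin P × Fin d) × Fin m → ℂ) :
    (outMat P d m ψ₁ * outMat P d m ψ₂).trace =
      ∑ k, auxA P d m ψ₁ ψ₂ k * conj (auxA P d m ψ₁ ψ₂ k) := by
  have hl : (outMat P d m ψ₁ * outMat P d m ψ₂).trace = ∑ y, ∑ y', ∑ x, ∑ x',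
      ψ₁ (x, y) * conj (ψ₁ (x, y')) * (ψ₂ (x', y') * conj (ψ₂ (x', y))) := by
    simp only [Matrix.trace, Matrix.diag_apply, Matrix.mul_apply, outMat, Finset.sum_mul_sum]
  have hr : ∀ x x', auxA P d m ψ₁ ψ₂ (x, x') * conj (auxA P d m ψ₁ ψ₂ (x, x')) =
      ∑ y, ∑ y', ψ₁ (x, y) * conj (ψ₁ (x, y')) * (ψ₂ (x', y') * conj (ψ₂ (x', y))) := by
    intro x x'
    unfold auxA
    rw [map_sum, Finset.sum_mul_sum, Finset.sum_comm]
    refine Finset.sum_congr rfl fun y _ => Finset.sum_congr rfl fun y' _ => ?_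
    simp only [map_mul, Complex.conj_conj]
    ring
  rw [hl, Fintype.sum_prod_type]
  simp only [hr]
  calc _ = ∑ y, ∑ x, ∑ x', ∑ y',
      ψ₁ (x, y) * conj (ψ₁ (x, y')) * (ψ₂ (x', y') * conj (ψ₂ (x', y))) := by
        refine Finset.sum_congr rfl fun j _ => ?_
        rw [Finset.sum_comm]
        refine Finset.sum_congr rfl fun x _ => ?_
        rw [Finset.sum_comm]
    _ = _ := by
        rw [Finset.sum_comm]
        refine Finset.sum_congr rfl fun x _ => ?_
        rw [Finset.sum_comm]

lemma aux_out_re (P d m : ℕ) (ψ₁ ψ₂ : (Fin P × Fin d) × Fin m → ℂ) :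
    (outMat P d m ψ₁ * outMat P d m ψ₂).trace =
      ((∑ k, ‖auxA P d m ψ₁ ψ₂ k‖ ^ 2 : ℝ) : ℂ) := by
  rw [aux_out]
  push_cast
  exact Finset.sum_congr rfl fun k _ => Complex.mul_conj' _

lemma aux_A_le (P d m : ℕ) (ψ₁ ψ₂ : (Fin P × Fin d) × Fin m → ℂ)
    (hψ₁ : inn ψ₁ ψ₁ = 1) (hψ₂ : inn ψ₂ ψ₂ = 1) :
    ∑ k, ‖auxA P d m ψ₁ ψ₂ k‖ ^ 2 ≤ 1 := by
  have h1 := aux_norm_sq _ hψ₁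
  have h2 := aux_norm_sq _ hψ₂
  rw [Fintype.sum_prod_type] at h1 h2
  calc ∑ k, ‖auxA P d m ψ₁ ψ₂ k‖ ^ 2
      ≤ ∑ k : (Fin P × Fin d) × (Fin P × Fin d),
        (∑ y, ‖ψ₁ (k.1, y)‖ ^ 2) * (∑ y, ‖ψ₂ (k.2, y)‖ ^ 2) := by
        refine Finset.sum_le_sum fun k _ => ?_
        have : ‖auxA P d m ψ₁ ψ₂ k‖ ≤ ∑ y, ‖ψ₁ (k.1, y)‖ * ‖ψ₂ (k.2, y)‖ := by
          refine (norm_sum_le _ _).trans (le_of_eq ?_)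
          simp
        calc _ ≤ (∑ y, ‖ψ₁ (k.1, y)‖ * ‖ψ₂ (k.2, y)‖) ^ 2 := by gcongr
          _ ≤ _ := Finset.sum_mul_sq_le_sq_mul_sq _ _ _
    _ = 1 := by
        rw [Fintype.sum_prod_type]
        simp only [← Finset.mul_sum, h2, mul_one, h1]

lemma aux_integral (P d m : ℕ) (hP : 0 < P) (hPd : 2 ≤ P * d)
    (μ : Measure (Matrix.unitaryGroup (Fin P × Fin d) ℂ))
    [IsProbabilityMeasure μ] [μ.IsMulRightInvariant]
    (ψ₁ ψ₂ : (Fin P × Fin d) × Fin m → ℂ) :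
    ∫ U, ‖inn (sliceV P d m hP U ψ₁) (sliceV P d m hP U ψ₂) - inn ψ₁ ψ₂‖ ^ 2 ∂μ =
      ((P * d : ℝ) * (P - 1) / ((P * d : ℝ) ^ 2 - 1)) * (∑ k, ‖auxA P d m ψ₁ ψ₂ k‖ ^ 2
        - (P * d : ℝ)⁻¹ * ‖∑ x, auxA P d m ψ₁ ψ₂ (x, x)‖ ^ 2) := by
  have hD : Fintype.card (Fin P × Fin d) = P * d := by simp
  obtain ⟨α, hα, hB⟩ := auxB_formula μ (auxM P d hP) (auxM_trace P d hP) (by rw [hD]; exact hPd)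
  rw [hD, auxM_frob] at hα
  simp only [hD] at hB
  push_cast at hα hB
  have hPd' : (2 : ℝ) ≤ P * d := by exact_mod_cast hPd
  have hne : ((P * d : ℝ) ^ 2 - 1) ≠ 0 := by nlinarith
  have hneC : ((P * d : ℂ) ^ 2 - 1) ≠ 0 := by exact_mod_cast hne
  have hα' : α = (((P * d : ℝ) * (P - 1) / ((P * d : ℝ) ^ 2 - 1) : ℝ) : ℂ) := by
    push_cast
    rw [eq_div_iff hneC, hα]
  apply Complex.ofReal_injective
  rw [← integral_complex_ofReal]
  have hq := aux_quad μ (fun (k : (Fin P × Fin d) × (Fin P × Fin d))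
    (U : Matrix.unitaryGroup (Fin P × Fin d) ℂ) => auxN (auxM P d hP) U k.1 k.2)
    (fun k => auxN_cont' _ _ _) (auxA P d m ψ₁ ψ₂)
  have hlhs : ∀ U : Matrix.unitaryGroup (Fin P × Fin d) ℂ,
      ((‖inn (sliceV P d m hP U ψ₁) (sliceV P d m hP U ψ₂) - inn ψ₁ ψ₂‖ ^ 2 : ℝ) : ℂ) =
      (∑ k, auxA P d m ψ₁ ψ₂ k * auxN (auxM P d hP) U k.1 k.2) *
        conj (∑ k, auxA P d m ψ₁ ψ₂ k * auxN (auxM P d hP) U k.1 k.2) := by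
    intro U
    rw [aux_inn, Complex.mul_conj']
    push_cast
    rfl
  simp only [hlhs]
  rw [hq]
  have hB' : ∀ k l : (Fin P × Fin d) × (Fin P × Fin d),
      ∫ U, auxN (auxM P d hP) U k.1 k.2 * conj (auxN (auxM P d hP) U l.1 l.2) ∂μ =
      α * ((if k = l then 1 else 0) -
        (P * d : ℂ)⁻¹ * ((if k.1 = k.2 then 1 else 0) * (if l.1 = l.2 then 1 else 0))) := by
    intro k l
    have := hB k.1 k.2 l.1 l.2
    unfold auxB at this
    rw [this]
    have hkl : (k = l) = (k.1 = l.1 ∧ k.2 = l.2) := propext Prod.ext_iff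
    simp only [hkl]
    congr 2
    by_cases h1 : k.1 = k.2 <;> by_cases h2 : l.1 = l.2 <;> simp [h1, h2]
  simp only [hB']
  have e1 : ((∑ k, ‖auxA P d m ψ₁ ψ₂ k‖ ^ 2 : ℝ) : ℂ) =
      ∑ k, ∑ l, auxA P d m ψ₁ ψ₂ k * conj (auxA P d m ψ₁ ψ₂ l) * (if k = l then 1 else 0) := by
    push_cast
    simp [Complex.mul_conj']
  have e2 : ((‖∑ x, auxA P d m ψ₁ ψ₂ (x, x)‖ ^ 2 : ℝ) : ℂ) =
      ∑ k, ∑ l, auxA P d m ψ₁ ψ₂ k * conj (auxA P d m ψ₁ ψ₂ l) *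
        ((if k.1 = k.2 then 1 else 0) * (if l.1 = l.2 then 1 else 0)) := by
    have e3 : ∑ x, auxA P d m ψ₁ ψ₂ (x, x) =
        ∑ k, auxA P d m ψ₁ ψ₂ k * (if k.1 = k.2 then 1 else 0) := by
      symm
      rw [Fintype.sum_prod_type]
      refine Finset.sum_congr rfl fun x _ => ?_
      simp
    rw [e3]
    push_cast
    rw [← Complex.mul_conj', map_sum, Finset.sum_mul_sum]
    refine Finset.sum_congr rfl fun k _ => Finset.sum_congr rfl fun l _ => ?_
    rw [map_mul]
    have : conj (if l.1 = l.2 then (1 : ℂ) else 0) = if l.1 = l.2 then (1 : ℂ) else 0 := by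
      split_ifs <;> simp
    rw [this]
    ring
  rw [Complex.ofReal_mul, Complex.ofReal_sub, Complex.ofReal_mul, e1, e2, ← hα', Finset.mul_sum,
    ← Finset.sum_sub_distrib, Finset.mul_sum]
  refine Finset.sum_congr rfl fun k _ => ?_
  rw [Finset.mul_sum, ← Finset.sum_sub_distrib, Finset.mul_sum]
  refine Finset.sum_congr rfl fun l _ => ?_
  push_cast
  ring

/-- **Uniform upper bound on inner-product fluctuations.**  Assume `Pd ≥ 2`.  For all unit
vectors `ψ₁, ψ₂ ∈ ℂ^{Pd} ⊗ ℂ^m`,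
`∫ |⟨ψ₁, V(U)†V(U) ψ₂⟩ − ⟨ψ₁, ψ₂⟩|² dμ(U) ≤ 2 · tr(ψ₁^out ψ₂^out) / d`, and in particular
this integral is at most `2/d`; here `μ` is the Haar probability measure (the left- and
right-invariant Borel probability measure) on `U(Pd)`. -/
theorem sliceV_fluctuation_upper_bound (P d m : ℕ) (hP : 0 < P) (hd : 0 < d) (hm : 0 < m)
    (hPd : 2 ≤ P * d)
    (μ : Measure (Matrix.unitaryGroup (Fin P × Fin d) ℂ))
    [IsProbabilityMeasure μ] [μ.IsMulLeftInvariant] [μ.IsMulRightInvariant]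
    (ψ₁ ψ₂ : (Fin P × Fin d) × Fin m → ℂ)
    (hψ₁ : inn ψ₁ ψ₁ = 1) (hψ₂ : inn ψ₂ ψ₂ = 1) :
    (∫ U, ‖inn (sliceV P d m hP U ψ₁) (sliceV P d m hP U ψ₂) - inn ψ₁ ψ₂‖ ^ 2 ∂μ
        ≤ 2 * ((outMat P d m ψ₁ * outMat P d m ψ₂).trace.re) / (d : ℝ))
    ∧ ∫ U, ‖inn (sliceV P d m hP U ψ₁) (sliceV P d m hP U ψ₂) - inn ψ₁ ψ₂‖ ^ 2 ∂μ
        ≤ 2 / (d : ℝ) := by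
  have hI := aux_integral P d m hP hPd μ ψ₁ ψ₂
  have hS := aux_A_le P d m ψ₁ ψ₂ hψ₁ hψ₂
  have hout : (outMat P d m ψ₁ * outMat P d m ψ₂).trace.re =
      ∑ k, ‖auxA P d m ψ₁ ψ₂ k‖ ^ 2 := by
    rw [aux_out_re, Complex.ofReal_re]
  have hS0 : 0 ≤ ∑ k, ‖auxA P d m ψ₁ ψ₂ k‖ ^ 2 := by positivity
  have hPd' : (2 : ℝ) ≤ P * d := by exact_mod_cast hPd
  have hP' : (1 : ℝ) ≤ P := by exact_mod_cast hP
  have hd' : (0 : ℝ) < d := by exact_mod_cast hd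
  have hden : (0 : ℝ) < (P * d : ℝ) ^ 2 - 1 := by nlinarith
  have hc0 : 0 ≤ (P * d : ℝ) * (P - 1) / ((P * d : ℝ) ^ 2 - 1) := by
    apply div_nonneg _ hden.le
    apply mul_nonneg (by positivity) (by linarith)
  have hc : (P * d : ℝ) * (P - 1) / ((P * d : ℝ) ^ 2 - 1) ≤ 2 / d := by
    rw [div_le_div_iff₀ hden hd']
    nlinarith [mul_nonneg (by positivity : (0 : ℝ) ≤ P) (sq_nonneg (d : ℝ))]
  have hmain : ∫ U, ‖inn (sliceV P d m hP U ψ₁) (sliceV P d m hP U ψ₂) - inn ψ₁ ψ₂‖ ^ 2 ∂μ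
      ≤ 2 * ((outMat P d m ψ₁ * outMat P d m ψ₂).trace.re) / (d : ℝ) := by
    rw [hI, hout]
    have h3 : 0 ≤ (P * d : ℝ)⁻¹ * ‖∑ x, auxA P d m ψ₁ ψ₂ (x, x)‖ ^ 2 := by positivity
    calc _ ≤ ((P * d : ℝ) * (P - 1) / ((P * d : ℝ) ^ 2 - 1)) *
          ∑ k, ‖auxA P d m ψ₁ ψ₂ k‖ ^ 2 :=
          mul_le_mul_of_nonneg_left (by linarith) hc0
      _ ≤ 2 / d * ∑ k, ‖auxA P d m ψ₁ ψ₂ k‖ ^ 2 := mul_le_mul_of_nonneg_right hc hS0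
      _ = _ := by ring
  refine ⟨hmain, hmain.trans ?_⟩
  rw [hout]
  gcongr
  linarith
end

section
/- Fourth moment of the image norm: assume Pd ≥ 2. For every unit vector ψ ∈ ℂ^{Pd} ⊗ ℂ^m, ∫ ‖V(U)ψ‖⁴ dμ(U) = 1 + (P − 1)(P·d · tr((ψ^out)²) − 1)/(P²d² − 1); equivalently, the variance of the squared norm ‖V(U)ψ‖² over the Haar measure equals (P − 1)(P·d · tr((ψ^out)²) − 1)/(P²d² − 1). -/
open MeasureTheory ComplexConjugate
open scoped Matrix

set_option linter.unusedSectionVars false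

section aux
variable {ι : Type*} [Fintype ι] [DecidableEq ι]

lemma aux_perm (σ : Equiv.Perm ι) : σ.permMatrix ℂ ∈ Matrix.unitaryGroup ι ℂ := by
  rw [Matrix.mem_unitaryGroup_iff, Matrix.star_eq_conjTranspose, Matrix.conjTranspose_permMatrix, ← Matrix.permMatrix_mul]
  simp

lemma aux_col (v : ι → ℂ) (hv : ∑ i, ‖v i‖ ^ 2 = 1) (x : ι) :
    ∃ W : Matrix.unitaryGroup ι ℂ, ∀ i, (W : Matrix ι ι ℂ) i x = v i := by
  have ho : Orthonormal ℂ (Set.domRestrict {x} (fun _ : ι => (WithLp.toLp 2 v : EuclideanSpace ℂ ι))) := by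
    refine ⟨fun i => ?_, fun i j hij => (hij (Subsingleton.elim _ _)).elim⟩
    simp [EuclideanSpace.norm_eq, Set.domRestrict_apply, hv]
  obtain ⟨b, hb⟩ := ho.exists_orthonormalBasis_extension_of_card_eq (by simp)
  refine ⟨⟨_, (EuclideanSpace.basisFun ι ℂ).toMatrix_orthonormalBasis_mem_unitary b⟩, fun i => ?_⟩
  simp [Module.Basis.toMatrix_apply, hb x rfl]

lemma aux_int_s7 (μ : Measure (Matrix.unitaryGroup ι ℂ)) [IsProbabilityMeasure μ]
    (f : Matrix.unitaryGroup ι ℂ → ℝ) (hf : Continuous f) : Integrable f μ := by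
  have : CompactSpace (Matrix.unitaryGroup ι ℂ) := by
    refine (isCompact_iff_compactSpace (s := ((Matrix.unitaryGroup ι ℂ : Submonoid (Matrix ι ι ℂ)) : Set (Matrix ι ι ℂ)))).1 ?_
    refine (isCompact_univ_pi (X := fun _ : ι => ι → ℂ) (s := fun _ => Set.univ.pi fun _ => Metric.closedBall 0 1) fun i => isCompact_univ_pi fun j => isCompact_closedBall _ _).of_isClosed_subset ?_ ?_
    · have : ((Matrix.unitaryGroup ι ℂ : Submonoid (Matrix ι ι ℂ)) : Set (Matrix ι ι ℂ)) = {A | A * star A = 1} := by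
        ext A; exact Matrix.mem_unitaryGroup_iff
      rw [this]
      exact isClosed_eq (by fun_prop) continuous_const
    · intro A hA i _ j _
      simpa using entry_norm_bound_of_unitary hA i j
  exact hf.integrable_of_hasCompactSupport (HasCompactSupport.of_compactSpace f)

/-- entry -/
noncomputable def ent (U : Matrix.unitaryGroup ι ℂ) (j x : ι) : ℂ := (U : Matrix ι ι ℂ) j x

@[fun_prop]
lemma ent_cont (j x : ι) : Continuous (fun U : Matrix.unitaryGroup ι ℂ => ent U j x) :=
  (continuous_subtype_val).matrix_elem j x

lemma ent_mul (U W : Matrix.unitaryGroup ι ℂ) (j x : ι) : ent (U * W) j x = ∑ i, ent U j i * ent W i x := by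
  simp [ent, Matrix.mul_apply]

lemma ent_mul_perm (U : Matrix.unitaryGroup ι ℂ) (σ : Equiv.Perm ι) (j x : ι) :
    ent (U * ⟨_, aux_perm σ⟩) j x = ent U j (σ.symm x) := by
  simp [ent, Equiv.Perm.permMatrix, PEquiv.mul_toMatrix_toPEquiv]

lemma ent_perm_mul (U : Matrix.unitaryGroup ι ℂ) (σ : Equiv.Perm ι) (j x : ι) :
    ent (⟨_, aux_perm σ⟩ * U) j x = ent U (σ j) x := by
  rw [ent_mul]
  simp [ent, Equiv.Perm.permMatrix, PEquiv.toMatrix_apply]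

/-- squared modulus of an entry -/
noncomputable def sqE (U : Matrix.unitaryGroup ι ℂ) (j x : ι) : ℝ := ‖ent U j x‖ ^ 2

@[fun_prop]
lemma sqE_cont (j x : ι) : Continuous (fun U : Matrix.unitaryGroup ι ℂ => sqE U j x) := by
  unfold sqE
  fun_prop

lemma sqE_row (U : Matrix.unitaryGroup ι ℂ) (j : ι) : ∑ x, sqE U j x = 1 := by
  have h := congrFun (congrFun (Matrix.mem_unitaryGroup_iff.1 U.2) j) j
  simp only [Matrix.mul_apply, Matrix.star_apply, Matrix.one_apply_eq, RCLike.star_def, Complex.mul_conj'] at h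
  unfold sqE ent
  exact_mod_cast h

lemma sqE_colsum (U : Matrix.unitaryGroup ι ℂ) (x : ι) : ∑ j, sqE U j x = 1 := by
  have h := congrFun (congrFun (Matrix.mem_unitaryGroup_iff'.1 U.2) x) x
  simp only [Matrix.mul_apply, Matrix.star_apply, Matrix.one_apply_eq, RCLike.star_def, Complex.conj_mul'] at h
  unfold sqE ent
  exact_mod_cast h

variable (μ : Measure (Matrix.unitaryGroup ι ℂ)) [IsProbabilityMeasure μ]

/-- mixed moment -/
noncomputable def MM (j x k z : ι) : ℝ := ∫ U, sqE U j x * sqE U k z ∂μ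

lemma MM_colperm [μ.IsMulRightInvariant] (σ : Equiv.Perm ι) (j x k z : ι) :
    MM μ j (σ x) k (σ z) = MM μ j x k z := by
  unfold MM
  rw [← integral_mul_right_eq_self _ (⟨_, aux_perm σ⟩ : Matrix.unitaryGroup ι ℂ)]
  simp [sqE, ent_mul_perm]

lemma MM_rowperm [μ.IsMulLeftInvariant] (σ : Equiv.Perm ι) (j x k z : ι) :
    MM μ (σ j) x (σ k) z = MM μ j x k z := by
  unfold MM
  rw [← integral_mul_left_eq_self _ (⟨_, aux_perm σ⁻¹⟩ : Matrix.unitaryGroup ι ℂ)]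
  simp [sqE, ent_perm_mul]

lemma E_one [μ.IsMulRightInvariant] (j x : ι) :
    ∫ U, sqE U j x ∂μ = 1 / Fintype.card ι := by
  have h1 : ∀ z, ∫ U, sqE U j z ∂μ = ∫ U, sqE U j x ∂μ := by
    intro z
    rw [← integral_mul_right_eq_self _ (⟨_, aux_perm (Equiv.swap x z)⟩ : Matrix.unitaryGroup ι ℂ)]
    simp [sqE, ent_mul_perm]
  have h2 : ∑ z, ∫ U, sqE U j z ∂μ = 1 := by
    rw [← integral_finsetSum _ (fun z _ => aux_int_s7 μ _ (by fun_prop))]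
    simp [sqE_row]
  simp [h1] at h2
  have : (Fintype.card ι : ℝ) ≠ 0 := by rintro h; simp [h] at h2
  field_simp; linarith

lemma MM_rowsum [μ.IsMulRightInvariant] (j x k : ι) :
    ∑ z, MM μ j x k z = 1 / Fintype.card ι := by
  unfold MM
  rw [← integral_finsetSum _ (fun z _ => aux_int_s7 μ _ (by fun_prop))]
  simp [← Finset.mul_sum, sqE_row, E_one]

lemma MM_colsum [μ.IsMulRightInvariant] (j x z : ι) :
    ∑ k, MM μ j x k z = 1 / Fintype.card ι := by
  unfold MM
  rw [← integral_finsetSum _ (fun z _ => aux_int_s7 μ _ (by fun_prop))]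
  simp [← Finset.mul_sum, sqE_colsum, E_one]

lemma aux_four (u v : ℂ) : ‖u + v‖ ^ 4 + ‖u - v‖ ^ 4 + ‖u + Complex.I * v‖ ^ 4 + ‖u - Complex.I * v‖ ^ 4
    = 4 * (‖u‖ ^ 2 * ‖u‖ ^ 2) + 4 * (‖v‖ ^ 2 * ‖v‖ ^ 2) + 16 * (‖u‖ ^ 2 * ‖v‖ ^ 2) := by
  have h : ∀ w : ℂ, ‖w‖ ^ 4 = (‖w‖ ^ 2) ^ 2 := fun w => by ring
  simp only [h, ← Complex.normSq_eq_norm_sq, Complex.normSq_apply]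
  simp
  ring

lemma aux_unit [μ.IsMulRightInvariant] (j x z : ι) (hxz : x ≠ z) (c : ℂ) (hc : ‖c‖ = 1) :
    ∫ U : Matrix.unitaryGroup ι ℂ, ‖ent U j x + c * ent U j z‖ ^ 4 ∂μ
      = 4 * MM μ j x j x := by
  obtain ⟨W, hW⟩ := aux_col (fun i => ((Real.sqrt 2)⁻¹ : ℂ) * (if i = x then 1 else 0) + ((Real.sqrt 2)⁻¹ : ℂ) * c * (if i = z then 1 else 0)) (by
    have : ∀ i, ‖((Real.sqrt 2)⁻¹ : ℂ) * (if i = x then 1 else 0) + ((Real.sqrt 2)⁻¹ : ℂ) * c * (if i = z then 1 else 0)‖ ^ 2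
      = (if i = x then 1/2 else 0) + (if i = z then (1/2 : ℝ) else 0) := by
      intro i
      by_cases h1 : i = x
      · have h2 : i ≠ z := fun h => hxz (h1 ▸ h)
        simp [h1, hxz]
      · by_cases h2 : i = z
        · simp [h2, hc, Ne.symm hxz]
        · simp [h1, h2]
    simp only [this, Finset.sum_add_distrib]
    simp; norm_num) x
  unfold MM
  rw [← integral_mul_right_eq_self (fun U => sqE U j x * sqE U j x) W, ← integral_const_mul]
  congr 1
  ext U
  have : ent (U * W) j x = ((Real.sqrt 2)⁻¹ : ℂ) * (ent U j x + c * ent U j z) := by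
    rw [ent_mul]
    simp only [show ∀ i, ent W i x = _ from hW, mul_add, Finset.sum_add_distrib]
    simp
    ring
  simp only [sqE, this, norm_mul]
  simp [mul_pow]
  ring

lemma MM_two [μ.IsMulRightInvariant] (j x z : ι) (hxz : x ≠ z) :
    MM μ j x j x = 2 * MM μ j x j z := by
  have hI : ∀ c : ℂ, Integrable (fun U : Matrix.unitaryGroup ι ℂ => ‖ent U j x + c * ent U j z‖ ^ 4) μ := by
    intro c
    apply aux_int_s7
    fun_prop
  have hJ : ∀ a b c e, Integrable (fun U : Matrix.unitaryGroup ι ℂ => sqE U a b * sqE U c e) μ := fun a b c e =>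
    aux_int_s7 μ _ (by fun_prop)
  have key := congrArg (fun f => ∫ U, f U ∂μ) (funext fun U : Matrix.unitaryGroup ι ℂ => aux_four (ent U j x) (ent U j z))
  simp only at key
  have e1 := aux_unit μ j x z hxz 1 (by simp)
  have e2 := aux_unit μ j x z hxz (-1) (by simp)
  have e3 := aux_unit μ j x z hxz Complex.I (by simp)
  have e4 := aux_unit μ j x z hxz (-Complex.I) (by simp)
  have i1 := hI 1
  have i2 := hI (-1)
  have i3 := hI Complex.I
  have i4 := hI (-Complex.I)
  simp only [one_mul, neg_mul, ← sub_eq_add_neg] at e1 e2 e3 e4 i1 i2 i3 i4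
  have hl : (∫ U : Matrix.unitaryGroup ι ℂ, ‖ent U j x + ent U j z‖ ^ 4 + ‖ent U j x - ent U j z‖ ^ 4 + ‖ent U j x + Complex.I * ent U j z‖ ^ 4 + ‖ent U j x - Complex.I * ent U j z‖ ^ 4 ∂μ) = 16 * MM μ j x j x := by
    rw [integral_add (by exact (i1.add i2).add i3) i4, integral_add (by exact i1.add i2) i3, integral_add i1 i2, e1, e2, e3, e4]
    ring
  rw [hl] at key
  have hr : (∫ U : Matrix.unitaryGroup ι ℂ, 4 * (sqE U j x * sqE U j x) + 4 * (sqE U j z * sqE U j z) + 16 * (sqE U j x * sqE U j z) ∂μ) = 4 * MM μ j x j x + 4 * MM μ j z j z + 16 * MM μ j x j z := by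
    rw [integral_add (by exact ((hJ _ _ _ _).const_mul _).add ((hJ _ _ _ _).const_mul _)) ((hJ _ _ _ _).const_mul _),
      integral_add ((hJ _ _ _ _).const_mul _) ((hJ _ _ _ _).const_mul _), integral_const_mul, integral_const_mul, integral_const_mul]
    rfl
  have hz : MM μ j z j z = MM μ j x j x := by
    simpa using MM_colperm μ (Equiv.swap x z) j x j x
  change _ = (∫ U : Matrix.unitaryGroup ι ℂ, 4 * (sqE U j x * sqE U j x) + 4 * (sqE U j z * sqE U j z) + 16 * (sqE U j x * sqE U j z) ∂μ) at key
  rw [hr, hz] at key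
  linarith

lemma sum_const_off (f : ι → ℝ) (x : ι) (c : ℝ) (h : ∀ z, z ≠ x → f z = c) :
    ∑ z, f z = f x + ((Fintype.card ι : ℝ) - 1) * c := by
  have : ∀ z, f z = c + (if z = x then f x - c else 0) := by
    intro z
    by_cases hz : z = x
    · simp [hz]
    · simp [hz, h z hz]
  rw [Finset.sum_congr rfl (fun z _ => this z)]
  simp [Finset.sum_add_distrib]
  ring

lemma MM_eq [μ.IsMulRightInvariant] [μ.IsMulLeftInvariant] (hN : 2 ≤ Fintype.card ι) (j x k z : ι) :
    MM μ j x k z = 1 / ((Fintype.card ι : ℝ) ^ 2 - 1) * (1 + (if j = k then 1 else 0) * (if x = z then 1 else 0)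
      - ((if j = k then 1 else 0) + (if x = z then 1 else 0)) / (Fintype.card ι : ℝ)) := by
  have hN' : (2 : ℝ) ≤ Fintype.card ι := by exact_mod_cast hN
  set N : ℝ := ((Fintype.card ι : ℕ) : ℝ) with hNdef
  have h0 : N ≠ 0 := by linarith
  have h1 : N - 1 ≠ 0 := by linarith
  have h2 : N + 1 ≠ 0 := by linarith
  have h3 : N ^ 2 - 1 ≠ 0 := by
    rw [show N ^ 2 - 1 = (N - 1) * (N + 1) by ring]; exact mul_ne_zero h1 h2
  -- diagonal
  have hA : ∀ j x, MM μ j x j x = 2 / (N * (N + 1)) := by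
    intro j x
    have := MM_rowsum μ j x j
    rw [sum_const_off _ x (MM μ j x j x / 2) (fun z hz => by rw [MM_two μ j x z (Ne.symm hz)]; ring), ← hNdef] at this
    field_simp at this ⊢
    linarith
  have hB : ∀ j x z, x ≠ z → MM μ j x j z = 1 / (N * (N + 1)) := by
    intro j x z hxz
    have := MM_two μ j x z hxz
    rw [hA] at this
    field_simp at this ⊢
    linarith
  have hC : ∀ j k x, j ≠ k → MM μ j x k x = 1 / (N * (N + 1)) := by
    intro j k x hjk
    have := MM_colsum μ j x x
    rw [sum_const_off _ j (MM μ j x k x) (fun l hl => by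
      have := MM_rowperm μ (Equiv.swap k l) j x k x
      rw [Equiv.swap_apply_of_ne_of_ne hjk (Ne.symm hl), Equiv.swap_apply_left] at this
      exact this), ← hNdef, hA] at this
    have h : (N - 1) * MM μ j x k x = (N - 1) * (1 / (N * (N + 1))) := by
      rw [eq_sub_of_add_eq' this]; field_simp; ring
    exact mul_left_cancel₀ h1 h
  have hD : ∀ j k x z, j ≠ k → x ≠ z → MM μ j x k z = 1 / (N ^ 2 - 1) := by
    intro j k x z hjk hxz
    have := MM_rowsum μ j x k
    rw [sum_const_off _ x (MM μ j x k z) (fun l hl => by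
      have := MM_colperm μ (Equiv.swap z l) j x k z
      rw [Equiv.swap_apply_of_ne_of_ne hxz (Ne.symm hl), Equiv.swap_apply_left] at this
      exact this), ← hNdef, hC j k x hjk] at this
    have h : (N - 1) * MM μ j x k z = (N - 1) * (1 / (N ^ 2 - 1)) := by
      rw [eq_sub_of_add_eq' this, show N ^ 2 - 1 = (N - 1) * (N + 1) by ring]; field_simp; ring
    exact mul_left_cancel₀ h1 h
  have h4 : N ^ 2 - 1 = (N - 1) * (N + 1) := by ring
  by_cases hjk : j = k
  · subst hjk
    by_cases hxz : x = z
    · subst hxz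
      rw [hA, h4]; simp; field_simp; ring
    · rw [hB _ _ _ hxz, h4]; simp [hxz]; field_simp
  · by_cases hxz : x = z
    · subst hxz
      rw [hC _ _ _ hjk, h4]; simp [hjk]; field_simp
    · rw [hD _ _ _ _ hjk hxz, h4]; simp [hjk, hxz]

lemma aux_main [μ.IsMulRightInvariant] [μ.IsMulLeftInvariant] (hN : 2 ≤ Fintype.card ι)
    {κ : Type*} [Fintype κ] [DecidableEq κ] (e : κ → ι) (he : Function.Injective e) (a : ι → ℝ) (ha : ∑ x, a x = 1) :
    ∫ U, (∑ j, ∑ x, a x * sqE U (e j) x) ^ 2 ∂μ = 1 / ((Fintype.card ι : ℝ) ^ 2 - 1) *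
      ((Fintype.card κ : ℝ) ^ 2 + Fintype.card κ * ∑ x, a x ^ 2
        - (Fintype.card κ + (Fintype.card κ : ℝ) ^ 2 * ∑ x, a x ^ 2) / (Fintype.card ι : ℝ)) := by
  have hex : ∀ U : Matrix.unitaryGroup ι ℂ, (∑ j, ∑ x, a x * sqE U (e j) x) ^ 2
      = ∑ j, ∑ k, ∑ x, ∑ z, a x * a z * (sqE U (e j) x * sqE U (e k) z) := by
    intro U
    rw [sq, Finset.sum_mul_sum]
    refine Finset.sum_congr rfl fun j _ => Finset.sum_congr rfl fun k _ => ?_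
    rw [Finset.sum_mul_sum]
    refine Finset.sum_congr rfl fun x _ => Finset.sum_congr rfl fun z _ => ?_
    ring
  have hint : ∫ U, (∑ j, ∑ x, a x * sqE U (e j) x) ^ 2 ∂μ
      = ∑ j, ∑ k, ∑ x, ∑ z, a x * a z * MM μ (e j) x (e k) z := by
    simp_rw [hex]
    rw [integral_finsetSum _ (fun j _ => aux_int_s7 μ _ (by fun_prop))]
    refine Finset.sum_congr rfl fun j _ => ?_
    rw [integral_finsetSum _ (fun j _ => aux_int_s7 μ _ (by fun_prop))]
    refine Finset.sum_congr rfl fun k _ => ?_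
    rw [integral_finsetSum _ (fun j _ => aux_int_s7 μ _ (by fun_prop))]
    refine Finset.sum_congr rfl fun x _ => ?_
    rw [integral_finsetSum _ (fun j _ => aux_int_s7 μ _ (by fun_prop))]
    refine Finset.sum_congr rfl fun z _ => ?_
    rw [integral_const_mul]; rfl
  rw [hint]
  set N : ℝ := ((Fintype.card ι : ℕ) : ℝ)
  have hin : ∀ j k, ∑ x, ∑ z, a x * a z * MM μ (e j) x (e k) z
      = 1 / (N ^ 2 - 1) * ((1 - (if j = k then 1 else 0) / N) + ((if j = k then 1 else 0) - 1 / N) * ∑ x, a x ^ 2) := by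
    intro j k
    have h1 : ∀ x z, a x * a z * MM μ (e j) x (e k) z = 1 / (N ^ 2 - 1) * ((1 - (if j = k then 1 else 0) / N) * (a x * a z)
        + ((if j = k then 1 else 0) - 1 / N) * (if x = z then a x * a z else 0)) := by
      intro x z
      rw [MM_eq μ hN]
      simp only [he.eq_iff]
      by_cases hxz : x = z
      · simp only [hxz, if_true]; ring
      · simp only [hxz, if_false]; ring
    simp only [h1, ← Finset.mul_sum, Finset.sum_add_distrib, ha]
    simp [ha, sq]
  simp only [hin, ← Finset.mul_sum, Finset.sum_add_distrib, ← Finset.sum_mul, Finset.sum_sub_distrib, ← Finset.sum_div]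
  simp
  left
  ring

lemma aux_first_s7 [μ.IsMulRightInvariant] 
    {κ : Type*} [Fintype κ] (e : κ → ι) (a : ι → ℝ) (ha : ∑ x, a x = 1) :
    ∫ U, (∑ j, ∑ x, a x * sqE U (e j) x) ∂μ = Fintype.card κ / Fintype.card ι := by
  rw [integral_finsetSum _ (fun j _ => aux_int_s7 μ _ (by fun_prop))]
  have : ∀ j, ∫ U, (∑ x, a x * sqE U (e j) x) ∂μ = 1 / Fintype.card ι := by
    intro j
    rw [integral_finsetSum _ (fun j _ => aux_int_s7 μ _ (by fun_prop))]
    simp_rw [integral_const_mul, E_one, ← Finset.sum_mul, ha, one_mul]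
  simp [this]; ring


lemma aux_quad_s7 {ν : Type*} [Fintype ν] (Ψ : Matrix ι ν ℂ) (hA : (Ψ * Ψᴴ).IsHermitian)
    (U : Matrix.unitaryGroup ι ℂ) (j : ι) :
    ∑ y, conj (∑ x, (U : Matrix ι ι ℂ) j x * Ψ x y) * (∑ x, (U : Matrix ι ι ℂ) j x * Ψ x y)
      = ((∑ x, hA.eigenvalues x * sqE (U * hA.eigenvectorUnitary) j x : ℝ) : ℂ) := by
  have h1 : ∑ y, conj (∑ x, (U : Matrix ι ι ℂ) j x * Ψ x y) * (∑ x, (U : Matrix ι ι ℂ) j x * Ψ x y)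
      = (((U : Matrix ι ι ℂ) * Ψ) * ((U : Matrix ι ι ℂ) * Ψ)ᴴ) j j := by
    rw [Matrix.mul_apply]
    refine Finset.sum_congr rfl fun y _ => ?_
    rw [Matrix.conjTranspose_apply, Matrix.mul_apply, mul_comm]; rfl
  have hs := hA.spectral_theorem
  rw [Unitary.conjStarAlgAut_apply] at hs
  set W := hA.eigenvectorUnitary
  have h2 : ((U : Matrix ι ι ℂ) * Ψ) * ((U : Matrix ι ι ℂ) * Ψ)ᴴ
      = ((U : Matrix ι ι ℂ) * (W : Matrix ι ι ℂ)) * Matrix.diagonal (RCLike.ofReal ∘ hA.eigenvalues) * ((U : Matrix ι ι ℂ) * (W : Matrix ι ι ℂ))ᴴ := by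
    rw [Matrix.conjTranspose_mul, Matrix.conjTranspose_mul]
    calc _ = (U : Matrix ι ι ℂ) * (Ψ * Ψᴴ) * (U : Matrix ι ι ℂ)ᴴ := by simp only [Matrix.mul_assoc]
      _ = _ := by
        refine (congrArg (fun M => (U : Matrix ι ι ℂ) * M * (U : Matrix ι ι ℂ)ᴴ) hs).trans ?_
        simp only [Matrix.mul_assoc, Matrix.star_eq_conjTranspose]
  rw [h1, h2, Matrix.mul_apply]
  push_cast
  refine Finset.sum_congr rfl fun x _ => ?_
  rw [Matrix.mul_diagonal, Matrix.conjTranspose_apply, sqE]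
  have : ent (U * W) j x = ((U : Matrix ι ι ℂ) * (W : Matrix ι ι ℂ)) j x := rfl
  rw [this]
  push_cast
  rw [← Complex.mul_conj']
  simp
  ring

lemma aux_tr {ν : Type*} [Fintype ν] (Ψ : Matrix ι ν ℂ) (hA : (Ψ * Ψᴴ).IsHermitian) :
    (Ψ * Ψᴴ).trace = ((∑ x, hA.eigenvalues x : ℝ) : ℂ) := by
  rw [hA.trace_eq_sum_eigenvalues]; simp

lemma aux_tr2 {ν : Type*} [Fintype ν] (Ψ : Matrix ι ν ℂ) (hA : (Ψ * Ψᴴ).IsHermitian) :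
    ((Ψ * Ψᴴ) * (Ψ * Ψᴴ)).trace = ((∑ x, hA.eigenvalues x ^ 2 : ℝ) : ℂ) := by
  have hs := hA.spectral_theorem
  conv_lhs => rw [hs, ← map_mul, Unitary.conjStarAlgAut_apply, Matrix.trace_mul_comm, ← mul_assoc]
  simp [Matrix.trace, sq]

end aux

/-- **Fourth moment of the image norm.**  Assume `Pd ≥ 2`.  For every unit vector
`ψ ∈ ℂ^{Pd} ⊗ ℂ^m`,
`∫ ‖V(U)ψ‖⁴ dμ(U) = 1 + (P − 1)(P·d · tr((ψ^out)²) − 1)/(P²d² − 1)`; equivalently, since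
`∫ ‖V(U)ψ‖² dμ(U) = 1`, the variance of `‖V(U)ψ‖²` over the Haar measure equals
`(P − 1)(P·d · tr((ψ^out)²) − 1)/(P²d² − 1)`.  Here `‖V(U)ψ‖² = ⟨V(U)ψ, V(U)ψ⟩`, so
`‖V(U)ψ‖⁴ = |⟨V(U)ψ, V(U)ψ⟩|²`, and `μ` is the Haar probability measure (the left- and
right-invariant Borel probability measure) on `U(Pd)`. -/
theorem sliceV_fourth_moment (P d m : ℕ) (hP : 0 < P) (hd : 0 < d) (hm : 0 < m)
    (hPd : 2 ≤ P * d)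
    (μ : Measure (Matrix.unitaryGroup (Fin P × Fin d) ℂ))
    [IsProbabilityMeasure μ] [μ.IsMulLeftInvariant] [μ.IsMulRightInvariant]
    (ψ : (Fin P × Fin d) × Fin m → ℂ) (hψ : inn ψ ψ = 1) :
    ((∫ U, ‖inn (sliceV P d m hP U ψ) (sliceV P d m hP U ψ)‖ ^ 2 ∂μ : ℝ) : ℂ)
        = 1 + ((P : ℂ) - 1) *
            ((P : ℂ) * (d : ℂ) * (outMat P d m ψ * outMat P d m ψ).trace - 1) /
              ((P : ℂ) ^ 2 * (d : ℂ) ^ 2 - 1)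
    ∧ ((∫ U, ‖inn (sliceV P d m hP U ψ) (sliceV P d m hP U ψ) - 1‖ ^ 2 ∂μ : ℝ) : ℂ)
        = ((P : ℂ) - 1) *
            ((P : ℂ) * (d : ℂ) * (outMat P d m ψ * outMat P d m ψ).trace - 1) /
              ((P : ℂ) ^ 2 * (d : ℂ) ^ 2 - 1) := by
  set Ψ : Matrix (Fin P × Fin d) (Fin m) ℂ := fun x y => ψ (x, y) with hΨ
  have hA : (Ψ * Ψᴴ).IsHermitian := Matrix.isHermitian_mul_conjTranspose_self Ψ
  set a := hA.eigenvalues with ha_def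
  set W := hA.eigenvectorUnitary with hW_def
  set e : Fin d → Fin P × Fin d := fun j => (⟨0, hP⟩, j) with he_def
  have he : Function.Injective e := fun i j h => (Prod.ext_iff.1 h).2
  have hin : ∀ U, inn (sliceV P d m hP U ψ) (sliceV P d m hP U ψ)
      = (((P : ℝ) * ∑ j, ∑ x, a x * sqE (U * W) (e j) x : ℝ) : ℂ) := by
    intro U
    have hq := fun j => aux_quad_s7 Ψ hA U (e j)
    rw [Complex.ofReal_mul, Complex.ofReal_sum]
    simp only [ha_def, hW_def, ← hq]
    unfold inn sliceV
    rw [Fintype.sum_prod_type, Finset.mul_sum]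
    refine Finset.sum_congr rfl fun j _ => ?_
    rw [Finset.mul_sum]
    refine Finset.sum_congr rfl fun y _ => ?_
    have hs : (Real.sqrt P : ℂ) * (Real.sqrt P : ℂ) = ((P : ℝ) : ℂ) := by
      rw [← Complex.ofReal_mul, Real.mul_self_sqrt (Nat.cast_nonneg P)]
    rw [map_mul, Complex.conj_ofReal, ← hs]
    simp only [hΨ, he_def]
    ring
  have ha : ∑ x, a x = 1 := by
    have h1 := aux_tr Ψ hA
    have h2 : (Ψ * Ψᴴ).trace = 1 := by
      rw [← hψ]
      unfold inn
      rw [Fintype.sum_prod_type, Matrix.trace]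
      refine Finset.sum_congr rfl fun x _ => ?_
      rw [Matrix.diag_apply, Matrix.mul_apply]
      refine Finset.sum_congr rfl fun y _ => ?_
      rw [Matrix.conjTranspose_apply, mul_comm]; rfl
    rw [h2] at h1
    exact_mod_cast h1.symm
  have hout : (outMat P d m ψ * outMat P d m ψ).trace = ((∑ x, a x ^ 2 : ℝ) : ℂ) := by
    rw [ha_def, ← aux_tr2 Ψ hA]
    have h1 : outMat P d m ψ = (Ψᴴ * Ψ)ᵀ := by
      ext y y'
      rw [Matrix.transpose_apply, Matrix.mul_apply]
      refine Finset.sum_congr rfl fun x _ => ?_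
      rw [Matrix.conjTranspose_apply, mul_comm]; rfl
    rw [h1, ← Matrix.transpose_mul, Matrix.trace_transpose, Matrix.mul_assoc, Matrix.trace_mul_comm]
    simp only [Matrix.mul_assoc]
  have hcard : Fintype.card (Fin P × Fin d) = P * d := by simp
  have h4 := aux_main μ (by rw [hcard]; exact hPd) e he a ha
  have h2 := aux_first_s7 μ e a ha
  rw [← integral_mul_right_eq_self _ W, hcard, Fintype.card_fin] at h4 h2
  set g : Matrix.unitaryGroup (Fin P × Fin d) ℂ → ℝ := fun U => ∑ j, ∑ x, a x * sqE (U * W) (e j) x with hg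
  change ∫ U, g U ^ 2 ∂μ = _ at h4
  change ∫ U, g U ∂μ = _ at h2
  have hgc : Continuous g := by
    have : ∀ j x, Continuous fun U : Matrix.unitaryGroup (Fin P × Fin d) ℂ => sqE (U * W) j x := fun j x =>
      (sqE_cont j x).comp (continuous_mul_const W)
    rw [hg]
    fun_prop
  have hPr : (1 : ℝ) ≤ P := by exact_mod_cast hP
  have hdr : (1 : ℝ) ≤ d := by exact_mod_cast hd
  have hPdr : (2 : ℝ) ≤ P * d := by exact_mod_cast hPd
  have hne : (P : ℝ) ^ 2 * (d : ℝ) ^ 2 - 1 ≠ 0 := by nlinarith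
  have hP0 : (P : ℝ) ≠ 0 := by linarith
  have hd0 : (d : ℝ) ≠ 0 := by linarith
  have A1 : ∫ U, (P * g U) ^ 2 ∂μ = 1 + ((P : ℝ) - 1) * (P * d * (∑ x, a x ^ 2) - 1) / ((P : ℝ) ^ 2 * (d : ℝ) ^ 2 - 1) := by
    simp_rw [mul_pow]
    rw [integral_const_mul, h4]
    push_cast
    rw [mul_pow]
    field_simp
    ring
  have A2 : ∫ U, P * g U ∂μ = 1 := by
    rw [integral_const_mul, h2]
    push_cast
    field_simp
  have B1 : ∫ U, ‖inn (sliceV P d m hP U ψ) (sliceV P d m hP U ψ)‖ ^ 2 ∂μ = ∫ U, (P * g U) ^ 2 ∂μ := by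
    congr 1; ext U
    rw [hin, Complex.norm_real, Real.norm_eq_abs, sq_abs]
  have B2 : ∫ U, ‖inn (sliceV P d m hP U ψ) (sliceV P d m hP U ψ) - 1‖ ^ 2 ∂μ = ∫ U, ((P * g U) ^ 2 - 2 * (P * g U) + 1) ∂μ := by
    congr 1; ext U
    rw [hin, ← Complex.ofReal_one, ← Complex.ofReal_sub, Complex.norm_real, Real.norm_eq_abs, sq_abs]
    simp only [hg]
    ring
  have B3 : ∫ U, ((P * g U) ^ 2 - 2 * (P * g U) + 1) ∂μ
      = ((P : ℝ) - 1) * (P * d * (∑ x, a x ^ 2) - 1) / ((P : ℝ) ^ 2 * (d : ℝ) ^ 2 - 1) := by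
    rw [integral_add (aux_int_s7 μ _ (by fun_prop)) (aux_int_s7 μ _ (by fun_prop)),
      integral_sub (aux_int_s7 μ _ (by fun_prop)) (aux_int_s7 μ _ (by fun_prop)), A1, integral_const_mul, A2]
    simp
    ring
  rw [B1, B2, B3, A1, hout]
  constructor <;> push_cast <;> rfl
end

section
/- Swap-twisted second moment: assume Pd ≥ 2. For every unit vector ψ ∈ ℂ^{Pd} ⊗ ℂ^m, ∫ ⟨ψ ⊗ ψ, (V(U)†V(U))^{⊗2} S_out (ψ ⊗ ψ)⟩ dμ(U) = tr((ψ^out)²) + (P − 1)(P·d − tr((ψ^out)²))/(P²d² − 1), where S_out is the operator on (ℂ^{Pd} ⊗ ℂ^m)^{⊗2} that swaps the two ℂ^m factors and leaves the two ℂ^{Pd} factors fixed. -/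
open MeasureTheory ComplexConjugate
open scoped Matrix

/-- The doubled vector `ψ ⊗ ψ` on two copies of `ℂ^{Pd} ⊗ ℂ^m`. -/
noncomputable def tensSelf (P d m : ℕ) (ψ : (Fin P × Fin d) × Fin m → ℂ) :
    ((Fin P × Fin d) × Fin m) × ((Fin P × Fin d) × Fin m) → ℂ :=
  fun uv => ψ uv.1 * ψ uv.2

/-- The operator `S_out` on `(ℂ^{Pd} ⊗ ℂ^m)^{⊗2}` swapping the two `ℂ^m` factors and
leaving the two `ℂ^{Pd}` factors fixed: `(S Φ)(x₁, y₁, x₂, y₂) = Φ(x₁, y₂, x₂, y₁)`. -/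
def swapOut (P d m : ℕ)
    (Φ : ((Fin P × Fin d) × Fin m) × ((Fin P × Fin d) × Fin m) → ℂ) :
    ((Fin P × Fin d) × Fin m) × ((Fin P × Fin d) × Fin m) → ℂ :=
  fun uv => Φ ((uv.1.1, uv.2.2), (uv.2.1, uv.1.2))

/-- The two-copy slice-normal map `V(U) ⊗ V(U)` acting on the doubled space. -/
noncomputable def sliceV2 (P d m : ℕ) (hP : 0 < P)
    (U : Matrix.unitaryGroup (Fin P × Fin d) ℂ)
    (Φ : ((Fin P × Fin d) × Fin m) × ((Fin P × Fin d) × Fin m) → ℂ) :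
    (Fin d × Fin m) × (Fin d × Fin m) → ℂ :=
  fun jk => (P : ℂ) *
    ∑ x₁ : Fin P × Fin d, ∑ x₂ : Fin P × Fin d,
      (U : Matrix (Fin P × Fin d) (Fin P × Fin d) ℂ) ((⟨0, hP⟩ : Fin P), jk.1.1) x₁ *
        (U : Matrix (Fin P × Fin d) (Fin P × Fin d) ℂ) ((⟨0, hP⟩ : Fin P), jk.2.1) x₂ *
          Φ ((x₁, jk.1.2), (x₂, jk.2.2))

set_option linter.unusedSectionVars false
set_option linter.unusedSimpArgs false

section SecMom

variable {ι κ : Type*} [Fintype ι] [DecidableEq ι] [Fintype κ] [DecidableEq κ]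

noncomputable def AA (e : κ → ι) (U : Matrix.unitaryGroup ι ℂ) (x y : ι) : ℂ :=
  ∑ j, conj ((U : Matrix ι ι ℂ) (e j) x) * (U : Matrix ι ι ℂ) (e j) y

lemma row_orth (U : Matrix.unitaryGroup ι ℂ) (a b : ι) :
    ∑ y, (U : Matrix ι ι ℂ) a y * conj ((U : Matrix ι ι ℂ) b y) = if a = b then 1 else 0 := by
  have h := congrFun (congrFun (Matrix.mem_unitaryGroup_iff.mp U.2) a) b
  simpa [Matrix.mul_apply, Matrix.star_apply, Matrix.one_apply] using h

lemma AA_trace (e : κ → ι) (U : Matrix.unitaryGroup ι ℂ) :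
    ∑ x, AA e U x x = Fintype.card κ := by
  unfold AA
  rw [Finset.sum_comm]
  have : ∀ j, ∑ x, conj ((U : Matrix ι ι ℂ) (e j) x) * (U : Matrix ι ι ℂ) (e j) x = 1 := by
    intro j
    have := row_orth U (e j) (e j)
    simp only [if_true] at this
    rw [← this]
    exact Finset.sum_congr rfl fun _ _ => mul_comm _ _
  simp [this]

lemma AA_idem (e : κ → ι) (he : Function.Injective e) (U : Matrix.unitaryGroup ι ℂ) (x z : ι) :
    ∑ y, AA e U x y * AA e U y z = AA e U x z := by
  unfold AA
  simp_rw [Finset.sum_mul_sum]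
  rw [Finset.sum_comm]
  refine Finset.sum_congr rfl fun j _ => ?_
  rw [Finset.sum_comm]
  have : ∀ k, ∑ y, conj ((U : Matrix ι ι ℂ) (e j) x) * (U : Matrix ι ι ℂ) (e j) y *
      (conj ((U : Matrix ι ι ℂ) (e k) y) * (U : Matrix ι ι ℂ) (e k) z) =
      if j = k then conj ((U : Matrix ι ι ℂ) (e j) x) * (U : Matrix ι ι ℂ) (e k) z else 0 := by
    intro k
    have h := row_orth U (e j) (e k)
    simp only [he.eq_iff] at h
    calc _ = conj ((U : Matrix ι ι ℂ) (e j) x) * (U : Matrix ι ι ℂ) (e k) z *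
        ∑ y, (U : Matrix ι ι ℂ) (e j) y * conj ((U : Matrix ι ι ℂ) (e k) y) := by
          rw [Finset.mul_sum]
          exact Finset.sum_congr rfl fun _ _ => by ring
      _ = _ := by rw [h]; split_ifs <;> simp
  simp [this]

lemma AA_mul (e : κ → ι) (U W : Matrix.unitaryGroup ι ℂ) (x y : ι) :
    AA e (U * W) x y = ∑ p, ∑ q, conj ((W : Matrix ι ι ℂ) p x) * (W : Matrix ι ι ℂ) q y *
      AA e U p q := by
  unfold AA
  simp only [Matrix.UnitaryGroup.mul_val, Matrix.mul_apply, map_sum, map_mul, Finset.sum_mul_sum]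
  simp only [Finset.mul_sum]
  rw [Finset.sum_comm]
  refine Finset.sum_congr rfl fun p _ => ?_
  rw [Finset.sum_comm]
  refine Finset.sum_congr rfl fun q _ => ?_
  exact Finset.sum_congr rfl fun _ _ => by ring

lemma AA_cont (e : κ → ι) (x y : ι) : Continuous fun U => AA e U x y := by
  unfold AA
  have h : ∀ a b : ι, Continuous fun U : Matrix.unitaryGroup ι ℂ => (U : Matrix ι ι ℂ) a b :=
    fun a b => (continuous_subtype_val).matrix_elem a b
  refine continuous_finsetSum _ fun j _ => ?_
  exact (Complex.continuous_conj.comp (h _ _)).mul (h _ _)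

lemma AA_bound (e : κ → ι) (U : Matrix.unitaryGroup ι ℂ) (x y : ι) :
    ‖AA e U x y‖ ≤ Fintype.card κ := by
  unfold AA
  refine (norm_sum_le _ _).trans ?_
  calc _ ≤ ∑ j : κ, (1 : ℝ) := by
        refine Finset.sum_le_sum fun j _ => ?_
        rw [norm_mul, RCLike.norm_conj]
        exact mul_le_one₀ (entry_norm_bound_of_unitary U.2 _ _) (norm_nonneg _)
          (entry_norm_bound_of_unitary U.2 _ _)
    _ = _ := by simp

variable (μ : Measure (Matrix.unitaryGroup ι ℂ)) [IsProbabilityMeasure μ]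

lemma AA_int (e : κ → ι) (x y : ι) : Integrable (fun U => AA e U x y) μ :=
  Integrable.of_bound (AA_cont e x y).aestronglyMeasurable (Fintype.card κ : ℝ)
    (Filter.Eventually.of_forall fun U => AA_bound e U x y)

lemma AA2_int (e : κ → ι) (x y z w : ι) : Integrable (fun U => AA e U x y * AA e U z w) μ :=
  Integrable.of_bound ((AA_cont e x y).mul (AA_cont e z w)).aestronglyMeasurable
    ((Fintype.card κ : ℝ) * (Fintype.card κ : ℝ))
    (Filter.Eventually.of_forall fun U => by
      rw [norm_mul]
      exact mul_le_mul (AA_bound e U x y) (AA_bound e U z w) (norm_nonneg _) (by positivity))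

noncomputable def TT (e : κ → ι) (x y z w : ι) : ℂ := ∫ U, AA e U x y * AA e U z w ∂μ

variable [μ.IsMulRightInvariant]

lemma TT_inv (e : κ → ι) (W : Matrix.unitaryGroup ι ℂ) (x y z w : ι) :
    TT μ e x y z w = ∫ U, AA e (U * W) x y * AA e (U * W) z w ∂μ :=
  (integral_mul_right_eq_self (μ := μ) (fun U => AA e U x y * AA e U z w) W).symm

/-- phase unitary -/
noncomputable def phaseU (t : ι) : Matrix.unitaryGroup ι ℂ :=
  ⟨Matrix.diagonal fun i => if i = t then Complex.I else 1, by
    rw [Matrix.mem_unitaryGroup_iff, Matrix.star_eq_conjTranspose, Matrix.diagonal_conjTranspose,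
      Matrix.diagonal_mul_diagonal, ← Matrix.diagonal_one]
    congr 1
    ext i
    by_cases h : i = t <;> simp [h]⟩

lemma AA_phase (e : κ → ι) (t : ι) (U : Matrix.unitaryGroup ι ℂ) (x y : ι) :
    AA e (U * phaseU t) x y = conj (if x = t then Complex.I else 1) *
      (if y = t then Complex.I else 1) * AA e U x y := by
  rw [AA_mul, Finset.sum_eq_single x, Finset.sum_eq_single y]
  · simp [phaseU]
  · intro b _ hb; simp [phaseU, Matrix.diagonal_apply_ne _ hb]
  · simp
  · intro b _ hb; simp [phaseU, Matrix.diagonal_apply_ne _ hb]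
  · simp

lemma TT_phase (e : κ → ι) (t x y z w : ι) :
    TT μ e x y z w = (conj (if x = t then Complex.I else 1) *
      (if y = t then Complex.I else 1) * (conj (if z = t then Complex.I else 1) *
      (if w = t then Complex.I else 1))) * TT μ e x y z w := by
  conv_lhs => rw [TT_inv μ e (phaseU t)]
  rw [TT, ← integral_const_mul]
  refine integral_congr_ae (Filter.Eventually.of_forall fun U => ?_)
  simp only [AA_phase]
  ring

lemma I_ne_one : Complex.I ≠ 1 := fun h => by simpa using congrArg Complex.re h
lemma negI_ne_one : -Complex.I ≠ 1 := fun h => by simpa using congrArg Complex.re h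
lemma neg1_ne_one : (-1 : ℂ) ≠ 1 := by norm_num

lemma TT_zero (e : κ → ι) (x y z w : ι) (h : ¬ ((x = y ∧ z = w) ∨ (x = w ∧ z = y))) :
    TT μ e x y z w = 0 := by
  have key : ∀ c : ℂ, c ≠ 1 → TT μ e x y z w = c * TT μ e x y z w → TT μ e x y z w = 0 := by
    intro c hc h
    have : (1 - c) * TT μ e x y z w = 0 := by linear_combination h
    exact (mul_eq_zero.mp this).resolve_left (sub_ne_zero.mpr hc.symm)
  by_cases h1 : y = x
  · subst h1
    have hw : w ≠ z := fun h' => h (Or.inl ⟨rfl, h'.symm⟩)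
    by_cases h2 : y = z
    · subst h2
      refine key _ ?_ (TT_phase μ e y y y y w)
      simp [hw, negI_ne_one]
    · refine key _ ?_ (TT_phase μ e z y y z w)
      simp [hw, h2, negI_ne_one]
  · by_cases h2 : w = x
    · subst h2
      have hy : y ≠ z := fun h' => h (Or.inr ⟨rfl, h'.symm⟩)
      by_cases h3 : w = z
      · subst h3
        refine key _ ?_ (TT_phase μ e w w y w w)
        simp [hy, negI_ne_one]
      · refine key _ ?_ (TT_phase μ e z w y z w)
        simp [hy, h3, negI_ne_one]
    · by_cases h3 : z = x
      · subst h3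
        refine key _ ?_ (TT_phase μ e z z y z w)
        simp [h1, h2, neg1_ne_one]
      · refine key _ ?_ (TT_phase μ e x x y z w)
        simp [h1, h2, h3, negI_ne_one]

/-- permutation unitary -/
noncomputable def permU (σ : Equiv.Perm ι) : Matrix.unitaryGroup ι ℂ :=
  ⟨Matrix.of fun i j => if i = σ j then 1 else 0, by
    rw [Matrix.mem_unitaryGroup_iff']
    ext i j
    simp [Matrix.mul_apply, Matrix.star_apply, Matrix.one_apply, apply_ite, eq_comm]⟩

lemma AA_perm (e : κ → ι) (σ : Equiv.Perm ι) (U : Matrix.unitaryGroup ι ℂ) (x y : ι) :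
    AA e (U * permU σ) x y = AA e U (σ x) (σ y) := by
  rw [AA_mul, Finset.sum_eq_single (σ x), Finset.sum_eq_single (σ y)]
  · simp [permU]
  · intro b _ hb; simp [permU, hb]
  · simp
  · intro b _ hb; simp [permU, hb]
  · simp

lemma TT_perm (e : κ → ι) (σ : Equiv.Perm ι) (x y z w : ι) :
    TT μ e x y z w = TT μ e (σ x) (σ y) (σ z) (σ w) := by
  rw [TT_inv μ e (permU σ)]
  simp only [AA_perm]
  rfl

/-- rotation unitary -/
noncomputable def vv (a b : ι) (i : ι) : ℂ := if i = a then 1 else if i = b then 1 else 0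

lemma vv_sq {a b : ι} (h : a ≠ b) : ∑ i, vv a b i * vv a b i = 2 := by
  have : ∀ i, vv a b i * vv a b i = (if i = a then 1 else 0) + (if i = b then 1 else 0) := by
    intro i
    unfold vv
    by_cases h1 : i = a
    · subst h1; simp [h]
    · simp [h1]
  simp only [this, Finset.sum_add_distrib]
  simp; norm_num

lemma vv_conj (a b i : ι) : conj (vv a b i) = vv a b i := by
  unfold vv; split_ifs <;> simp

noncomputable def rotM (a b : ι) : Matrix ι ι ℂ :=
  fun i j => (if i = j then 1 else 0) - (1 - Complex.I) / 2 * (vv a b i * vv a b j)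

lemma rotM_mem {a b : ι} (h : a ≠ b) : rotM a b ∈ Matrix.unitaryGroup ι ℂ := by
  rw [Matrix.mem_unitaryGroup_iff']
  ext i j
  simp only [Matrix.mul_apply, Matrix.star_apply, rotM, Matrix.one_apply]
  have : ∀ k, star ((if k = i then (1:ℂ) else 0) - (1 - Complex.I) / 2 * (vv a b k * vv a b i)) *
      ((if k = j then 1 else 0) - (1 - Complex.I) / 2 * (vv a b k * vv a b j)) =
      (if k = i then (if k = j then 1 else 0) else 0)
      - (1 - Complex.I) / 2 * vv a b j * (if k = i then vv a b k else 0)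
      - (1 + Complex.I) / 2 * vv a b i * (if k = j then vv a b k else 0)
      + 1 / 2 * vv a b i * vv a b j * (vv a b k * vv a b k) := by
    intro k
    have hs : star ((if k = i then (1:ℂ) else 0) - (1 - Complex.I) / 2 * (vv a b k * vv a b i)) =
        (if k = i then (1:ℂ) else 0) - (1 + Complex.I) / 2 * (vv a b k * vv a b i) := by
      rw [← starRingEnd_apply]
      simp only [map_sub, map_mul, vv_conj, map_div₀, Complex.conj_I, map_one]
      congr 1
      · split_ifs <;> simp
      · rw [Complex.conj_ofNat, sub_neg_eq_add]
    rw [hs]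
    have hI := Complex.I_sq
    split_ifs <;> linear_combination (-1/4 * vv a b k * vv a b k * vv a b i * vv a b j) * hI
  simp only [this, Finset.sum_add_distrib, Finset.sum_sub_distrib, ← Finset.mul_sum, vv_sq h]
  simp
  ring

lemma AA_rot (e : κ → ι) {a b : ι} (h : a ≠ b) (U : Matrix.unitaryGroup ι ℂ) :
    AA e (U * ⟨rotM a b, rotM_mem h⟩) a a =
      (AA e U a a + AA e U b b + Complex.I * AA e U a b - Complex.I * AA e U b a) / 2 := by
  rw [AA_mul]
  have hr : ∀ p, rotM a b p a = (if p = a then (1 + Complex.I) / 2 else 0) +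
      (if p = b then -(1 - Complex.I) / 2 else 0) := by
    intro p
    unfold rotM vv
    by_cases h1 : p = a
    · subst h1; simp [h]; ring
    · by_cases h2 : p = b
      · subst h2; simp [h1]; ring
      · simp [h1, h2]
  have hI := Complex.I_sq
  simp only [hr, map_add, apply_ite conj, map_zero, add_mul, mul_add, Finset.sum_add_distrib, ite_mul, zero_mul,
    mul_ite, mul_zero, Finset.sum_ite_eq', Finset.sum_ite_irrel, Finset.sum_const_zero, Finset.mem_univ, if_true]
  simp only [map_div₀, map_add, map_sub, map_neg, map_one, Complex.conj_I, map_ofNat]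
  linear_combination (-1/4 * (AA e U a a + AA e U b b + AA e U a b + AA e U b a)) * hI

lemma TT_rot (e : κ → ι) {a b : ι} (h : a ≠ b) :
    TT μ e a a a a = TT μ e a a b b + TT μ e a b b a := by
  have h1 := TT_inv μ e ⟨rotM a b, rotM_mem h⟩ a a a a
  simp only [AA_rot e h] at h1
  have hI := Complex.I_sq
  have h2 : ∀ U, ((AA e U a a + AA e U b b + Complex.I * AA e U a b - Complex.I * AA e U b a) / 2) *
      ((AA e U a a + AA e U b b + Complex.I * AA e U a b - Complex.I * AA e U b a) / 2) =
      ∑ k : Fin 10, (![1/4, 1/4, 1/2, 1/2, -1/4, -1/4, Complex.I/2, Complex.I/2, -Complex.I/2, -Complex.I/2] : Fin 10 → ℂ) k *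
       (AA e U ((![a,b,a,a,a,b,a,b,a,b] : Fin 10 → ι) k) ((![a,b,a,b,b,a,a,b,a,b] : Fin 10 → ι) k) *
        AA e U ((![a,b,b,b,a,b,a,a,b,b] : Fin 10 → ι) k) ((![a,b,b,a,b,a,b,b,a,a] : Fin 10 → ι) k)) := by
    intro U
    simp [Fin.sum_univ_succ]
    linear_combination (1/4 * (AA e U a b - AA e U b a)^2) * hI
  simp only [h2] at h1
  rw [integral_finsetSum _ fun k _ => (AA2_int μ e _ _ _ _).const_mul _] at h1
  simp only [integral_const_mul] at h1
  change _ = ∑ k : Fin 10, _ * TT μ e _ _ _ _ at h1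
  have hb : TT μ e b b b b = TT μ e a a a a := by
    have := TT_perm μ e (Equiv.swap a b) b b b b
    simpa using this
  simp [Fin.sum_univ_succ, hb, TT_zero μ e a b a b (by simp [h, h.symm]),
    TT_zero μ e b a b a (by simp [h, h.symm]), TT_zero μ e a a a b (by simp [h, h.symm]),
    TT_zero μ e b b a b (by simp [h, h.symm]), TT_zero μ e a a b a (by simp [h, h.symm]),
    TT_zero μ e b b b a (by simp [h, h.symm])] at h1
  linear_combination 2 * h1

lemma EA (e : κ → ι) (x : ι) :
    (Fintype.card ι : ℂ) * ∫ U, AA e U x x ∂μ = Fintype.card κ := by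
  have h : ∀ y, ∫ U, AA e U y y ∂μ = ∫ U, AA e U x x ∂μ := by
    intro y
    rw [← integral_mul_right_eq_self (μ := μ) (fun U => AA e U y y) (permU (Equiv.swap x y))]
    simp [AA_perm]
  have h2 : ∫ U, ∑ y, AA e U y y ∂μ = Fintype.card κ := by
    simp only [AA_trace]; simp
  rw [integral_finsetSum _ fun k _ => AA_int μ e _ _] at h2
  simpa [h] using h2

lemma exists_perm {a b x y : ι} (h : a ≠ b) (h' : x ≠ y) :
    ∃ σ : Equiv.Perm ι, σ a = x ∧ σ b = y := by
  refine ⟨(Equiv.swap a x).trans (Equiv.swap (Equiv.swap a x b) y), ?_, ?_⟩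
  · simp only [Equiv.trans_apply, Equiv.swap_apply_left]
    refine Equiv.swap_apply_of_ne_of_ne ?_ h'
    intro h2
    have : Equiv.swap a x a = Equiv.swap a x b := by simpa using h2
    exact h ((Equiv.swap a x).injective this)
  · simp

lemma TT_formula (e : κ → ι) (he : Function.Injective e) (hι : 2 ≤ Fintype.card ι) :
    ∃ α β : ℂ, (∀ x y z w, TT μ e x y z w = α * (if x = y ∧ z = w then 1 else 0) +
        β * (if x = w ∧ z = y then 1 else 0)) ∧
      (Fintype.card ι : ℂ) * ((Fintype.card ι : ℂ) * α + β) = (Fintype.card κ : ℂ) ^ 2 ∧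
      (Fintype.card ι : ℂ) * ((Fintype.card ι : ℂ) * β + α) = Fintype.card κ := by
  obtain ⟨a, b, hab⟩ := Fintype.exists_pair_of_one_lt_card (α := ι) (by omega)
  have hα : ∀ x y, x ≠ y → TT μ e x x y y = TT μ e a a b b := by
    intro x y hxy
    obtain ⟨σ, h1, h2⟩ := exists_perm hab hxy
    rw [TT_perm μ e σ a a b b, h1, h2]
  have hβ : ∀ x y, x ≠ y → TT μ e x y y x = TT μ e a b b a := by
    intro x y hxy
    obtain ⟨σ, h1, h2⟩ := exists_perm hab hxy
    rw [TT_perm μ e σ a b b a, h1, h2]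
  have hγ : ∀ x, TT μ e x x x x = TT μ e a a b b + TT μ e a b b a := by
    intro x
    rw [← TT_rot μ e hab, TT_perm μ e (Equiv.swap x a) x x x x]
    simp
  have hf : ∀ x y z w, TT μ e x y z w = TT μ e a a b b * (if x = y ∧ z = w then 1 else 0) +
        TT μ e a b b a * (if x = w ∧ z = y then 1 else 0) := by
    intro x y z w
    by_cases h1 : x = y ∧ z = w
    · obtain ⟨rfl, rfl⟩ := h1
      by_cases h2 : x = z
      · subst h2; simp [hγ]
      · simp [h2, hα x z h2]
    · by_cases h2 : x = w ∧ z = y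
      · obtain ⟨rfl, rfl⟩ := h2
        have : x ≠ z := fun h => h1 ⟨h, h.symm⟩
        simp [this, hβ x z this]
      · rw [TT_zero μ e x y z w (by tauto)]; simp [h1, h2]
  refine ⟨_, _, hf, ?_, ?_⟩
  all_goals
    clear hα hβ hγ
    generalize TT μ e a a b b = α at hf ⊢
    generalize TT μ e a b b a = β at hf ⊢
  · have h1 : ∫ U, ∑ y, AA e U a a * AA e U y y ∂μ = Fintype.card κ * ∫ U, AA e U a a ∂μ := by
      simp only [← Finset.mul_sum, AA_trace]
      rw [integral_mul_const, mul_comm]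
    rw [integral_finsetSum _ fun k _ => AA2_int μ e _ _ _ _] at h1
    change ∑ y, TT μ e a a y y = _ at h1
    have h2 := EA μ e a
    simp only [hf, Finset.sum_add_distrib, ← Finset.mul_sum] at h1
    have hc : ∀ x, (a = x ∧ x = a) ↔ x = a := fun x => ⟨fun h => h.2, fun h => ⟨h.symm, h⟩⟩
    simp [-mul_eq_mul_left_iff, hc] at h1
    linear_combination (Fintype.card ι : ℂ) * h1 + (Fintype.card κ : ℂ) * h2
  · have h1 : ∫ U, ∑ y, AA e U a y * AA e U y a ∂μ = ∫ U, AA e U a a ∂μ := by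
      simp only [AA_idem e he]
    rw [integral_finsetSum _ fun k _ => AA2_int μ e _ _ _ _] at h1
    change ∑ y, TT μ e a y y a = _ at h1
    have h2 := EA μ e a
    simp only [hf, Finset.sum_add_distrib, ← Finset.mul_sum] at h1
    have hc : ∀ x, (a = x ∧ x = a) ↔ x = a := fun x => ⟨fun h => h.2, fun h => ⟨h.symm, h⟩⟩
    simp [-mul_eq_mul_left_iff, hc] at h1
    linear_combination (Fintype.card ι : ℂ) * h1 + h2

end SecMom

lemma inn_expand (P d m : ℕ) (hP : 0 < P) (U : Matrix.unitaryGroup (Fin P × Fin d) ℂ)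
    (ψ : (Fin P × Fin d) × Fin m → ℂ) :
    inn (sliceV2 P d m hP U (tensSelf P d m ψ))
             (sliceV2 P d m hP U (swapOut P d m (tensSelf P d m ψ))) =
    ∑ y : Fin m, ∑ y' : Fin m, ∑ x₁, ∑ x₂, ∑ z₁, ∑ z₂,
      ((P : ℂ) ^ 2 * (conj (ψ (x₁, y)) * conj (ψ (x₂, y')) * ψ (z₁, y') * ψ (z₂, y))) *
        (AA (fun j : Fin d => ((⟨0, hP⟩ : Fin P), j)) U x₁ z₁ *
          AA (fun j : Fin d => ((⟨0, hP⟩ : Fin P), j)) U x₂ z₂) := by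
  have hA : ∀ x₁ z₁ x₂ z₂, (AA (fun j : Fin d => ((⟨0, hP⟩ : Fin P), j)) U x₁ z₁ *
          AA (fun j : Fin d => ((⟨0, hP⟩ : Fin P), j)) U x₂ z₂) = 
      ∑ j : Fin d, ∑ k : Fin d, 
       (conj ((U : Matrix (Fin P × Fin d) (Fin P × Fin d) ℂ) ((⟨0, hP⟩ : Fin P), j) x₁) * (U : Matrix (Fin P × Fin d) (Fin P × Fin d) ℂ) ((⟨0, hP⟩ : Fin P), j) z₁) *
       (conj ((U : Matrix (Fin P × Fin d) (Fin P × Fin d) ℂ) ((⟨0, hP⟩ : Fin P), k) x₂) * (U : Matrix (Fin P × Fin d) (Fin P × Fin d) ℂ) ((⟨0, hP⟩ : Fin P), k) z₂) := by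
    intro x₁ z₁ x₂ z₂
    unfold AA
    rw [Finset.sum_mul_sum]
  simp only [hA, Finset.mul_sum]
  unfold inn sliceV2 tensSelf swapOut
  rw [Fintype.sum_prod_type, Fintype.sum_prod_type_right]
  refine Finset.sum_congr rfl fun y _ => ?_
  simp_rw [Fintype.sum_prod_type_right (f := fun x : Fin d × Fin m => _)]
  rw [Finset.sum_comm]
  refine Finset.sum_congr rfl fun y' _ => ?_
  have hR : ∀ F : (Fin P × Fin d) → (Fin P × Fin d) → (Fin P × Fin d) → (Fin P × Fin d) → Fin d → Fin d → ℂ,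
      ∑ x₁, ∑ x₂, ∑ z₁, ∑ z₂, ∑ j, ∑ k, F x₁ x₂ z₁ z₂ j k =
      ∑ j, ∑ k, ∑ x₁, ∑ x₂, ∑ z₁, ∑ z₂, F x₁ x₂ z₁ z₂ j k := by
    intro F
    simp only [← Fintype.sum_prod_type']
    refine Fintype.sum_equiv
      ⟨fun a => (a.2.2.2.2.1, a.2.2.2.2.2, a.1, a.2.1, a.2.2.1, a.2.2.2.1),
       fun a => (a.2.2.1, a.2.2.2.1, a.2.2.2.2.1, a.2.2.2.2.2, a.1, a.2.1),
       fun _ => rfl, fun _ => rfl⟩ _ _ fun _ => rfl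
  rw [hR]
  refine Finset.sum_congr rfl fun j _ => Finset.sum_congr rfl fun k _ => ?_
  simp only [map_mul, map_sum, Complex.conj_natCast]
  rw [mul_mul_mul_comm, Finset.sum_mul, Finset.mul_sum]
  refine Finset.sum_congr rfl fun x₁ _ => ?_
  rw [Finset.sum_mul, Finset.mul_sum]
  refine Finset.sum_congr rfl fun x₂ _ => ?_
  rw [Finset.mul_sum, Finset.mul_sum]
  refine Finset.sum_congr rfl fun z₁ _ => ?_
  rw [Finset.mul_sum, Finset.mul_sum]
  refine Finset.sum_congr rfl fun z₂ _ => ?_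
  ring

/-- **Swap-twisted second moment.**  Assume `Pd ≥ 2`.  For every unit vector
`ψ ∈ ℂ^{Pd} ⊗ ℂ^m`,
`∫ ⟨ψ ⊗ ψ, (V(U)†V(U))^{⊗2} S_out (ψ ⊗ ψ)⟩ dμ(U)
  = tr((ψ^out)²) + (P − 1)(P·d − tr((ψ^out)²))/(P²d² − 1)`,
where `⟨Φ, (V†V)^{⊗2} Ξ⟩ = ⟨(V ⊗ V)Φ, (V ⊗ V)Ξ⟩` and `μ` is the Haar probability measure
(the left- and right-invariant Borel probability measure) on `U(Pd)`. -/
theorem sliceV_swap_twisted_second_moment (P d m : ℕ) (hP : 0 < P) (hd : 0 < d) (hm : 0 < m)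
    (hPd : 2 ≤ P * d)
    (μ : Measure (Matrix.unitaryGroup (Fin P × Fin d) ℂ))
    [IsProbabilityMeasure μ] [μ.IsMulLeftInvariant] [μ.IsMulRightInvariant]
    (ψ : (Fin P × Fin d) × Fin m → ℂ) (hψ : inn ψ ψ = 1) :
    ∫ U, inn (sliceV2 P d m hP U (tensSelf P d m ψ))
             (sliceV2 P d m hP U (swapOut P d m (tensSelf P d m ψ))) ∂μ
      = (outMat P d m ψ * outMat P d m ψ).trace
        + ((P : ℂ) - 1) *
            ((P : ℂ) * (d : ℂ) - (outMat P d m ψ * outMat P d m ψ).trace) /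
              ((P : ℂ) ^ 2 * (d : ℂ) ^ 2 - 1) := by
  set e : Fin d → Fin P × Fin d := fun j => ((⟨0, hP⟩ : Fin P), j) with he
  have hinj : Function.Injective e := fun a b h => (Prod.ext_iff.mp h).2
  obtain ⟨α, β, hf, h1, h2⟩ := TT_formula μ e hinj (by simpa using hPd)
  simp only [Fintype.card_prod, Fintype.card_fin, Nat.cast_mul] at h1 h2
  have hint : ∫ U, inn (sliceV2 P d m hP U (tensSelf P d m ψ))
             (sliceV2 P d m hP U (swapOut P d m (tensSelf P d m ψ))) ∂μ =
      ∑ y : Fin m, ∑ y' : Fin m, ∑ x₁, ∑ x₂, ∑ z₁, ∑ z₂,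
      ((P : ℂ) ^ 2 * (conj (ψ (x₁, y)) * conj (ψ (x₂, y')) * ψ (z₁, y') * ψ (z₂, y))) *
        TT μ e x₁ z₁ x₂ z₂ := by
    simp only [inn_expand]
    have hi : ∀ (y y' : Fin m) (x₁ x₂ z₁ z₂ : Fin P × Fin d), Integrable (fun U =>
      ((P : ℂ) ^ 2 * (conj (ψ (x₁, y)) * conj (ψ (x₂, y')) * ψ (z₁, y') * ψ (z₂, y))) *
        (AA e U x₁ z₁ * AA e U x₂ z₂)) μ := fun y y' x₁ x₂ z₁ z₂ =>
      (AA2_int μ e _ _ _ _).const_mul _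
    rw [integral_finsetSum _ fun _ _ => integrable_finsetSum _ fun _ _ => integrable_finsetSum _
      fun _ _ => integrable_finsetSum _ fun _ _ => integrable_finsetSum _ fun _ _ =>
      integrable_finsetSum _ fun _ _ => hi _ _ _ _ _ _]
    refine Finset.sum_congr rfl fun y _ => ?_
    rw [integral_finsetSum _ fun _ _ => integrable_finsetSum _
      fun _ _ => integrable_finsetSum _ fun _ _ => integrable_finsetSum _ fun _ _ =>
      integrable_finsetSum _ fun _ _ => hi _ _ _ _ _ _]
    refine Finset.sum_congr rfl fun y' _ => ?_
    rw [integral_finsetSum _ fun _ _ => integrable_finsetSum _ fun _ _ => integrable_finsetSum _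
      fun _ _ => integrable_finsetSum _ fun _ _ => hi _ _ _ _ _ _]
    refine Finset.sum_congr rfl fun x₁ _ => ?_
    rw [integral_finsetSum _ fun _ _ => integrable_finsetSum _
      fun _ _ => integrable_finsetSum _ fun _ _ => hi _ _ _ _ _ _]
    refine Finset.sum_congr rfl fun x₂ _ => ?_
    rw [integral_finsetSum _ fun _ _ => integrable_finsetSum _ fun _ _ => hi _ _ _ _ _ _]
    refine Finset.sum_congr rfl fun z₁ _ => ?_
    rw [integral_finsetSum _ fun _ _ => hi _ _ _ _ _ _]
    refine Finset.sum_congr rfl fun z₂ _ => ?_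
    rw [integral_const_mul]
    rfl
  have hin : ∀ (y y' : Fin m) (x₁ x₂ : Fin P × Fin d), ∑ z₁, ∑ z₂,
      ((P : ℂ) ^ 2 * (conj (ψ (x₁, y)) * conj (ψ (x₂, y')) * ψ (z₁, y') * ψ (z₂, y))) *
        TT μ e x₁ z₁ x₂ z₂ =
      (P : ℂ) ^ 2 * α * ((ψ (x₁, y') * conj (ψ (x₁, y))) * (ψ (x₂, y) * conj (ψ (x₂, y')))) +
      (P : ℂ) ^ 2 * β * ((conj (ψ (x₁, y)) * ψ (x₁, y)) * (conj (ψ (x₂, y')) * ψ (x₂, y'))) := by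
    intro y y' x₁ x₂
    simp only [hf, mul_add, Finset.sum_add_distrib]
    congr 1
    · rw [Finset.sum_eq_single x₁, Finset.sum_eq_single x₂]
      · simp; ring
      · intro b _ hb; simp [hb.symm]
      · simp
      · intro b _ hb; simp [hb.symm]
      · simp
    · rw [Finset.sum_eq_single x₂, Finset.sum_eq_single x₁]
      · simp; ring
      · intro b _ hb; simp [hb.symm]
      · simp
      · intro b _ hb; simp [hb.symm]
      · simp
  have htr : ∑ y : Fin m, ∑ y' : Fin m, ∑ x₁, ∑ x₂,
      ((ψ (x₁, y') * conj (ψ (x₁, y))) * (ψ (x₂, y) * conj (ψ (x₂, y')))) =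
      (outMat P d m ψ * outMat P d m ψ).trace := by
    simp only [Matrix.trace, Matrix.diag_apply, Matrix.mul_apply, outMat]
    refine Finset.sum_congr rfl fun y _ => Finset.sum_congr rfl fun y' _ => ?_
    rw [mul_comm, Finset.sum_mul_sum]
  have hone : ∑ y : Fin m, ∑ y' : Fin m, ∑ x₁, ∑ x₂,
      ((conj (ψ (x₁, y)) * ψ (x₁, y)) * (conj (ψ (x₂, y')) * ψ (x₂, y'))) = 1 := by
    have h : ∑ y : Fin m, ∑ x : Fin P × Fin d, conj (ψ (x, y)) * ψ (x, y) = 1 := by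
      rw [← hψ, inn, Fintype.sum_prod_type_right]
    simp only [← Finset.sum_mul_sum]
    rw [h, one_mul]
  rw [hint]
  simp only [hin, Finset.sum_add_distrib, ← Finset.mul_sum] at htr hone ⊢
  rw [htr, hone]
  generalize (outMat P d m ψ * outMat P d m ψ).trace = t
  have hP0 : (P : ℂ) ≠ 0 := by exact_mod_cast hP.ne'
  have hd0 : (d : ℂ) ≠ 0 := by exact_mod_cast hd.ne'
  have hN : (P : ℂ) ^ 2 * (d : ℂ) ^ 2 - 1 ≠ 0 := by
    rw [sub_ne_zero, ← mul_pow]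
    have : (P * d) ^ 2 ≠ 1 := by nlinarith
    exact_mod_cast this
  have hP' : (P : ℂ) * α * P * d + P * β = d := by
    have : (d : ℂ) * ((P : ℂ) * α * P * d + P * β) = d * d := by linear_combination h1
    exact mul_left_cancel₀ hd0 this
  have hQ' : (P : ℂ) * β * P * d + P * α = 1 := by
    have : (d : ℂ) * ((P : ℂ) * β * P * d + P * α) = d * 1 := by linear_combination h2
    exact mul_left_cancel₀ hd0 this
  have hα : (P : ℂ) ^ 2 * α * ((P : ℂ) ^ 2 * (d : ℂ) ^ 2 - 1) = (P : ℂ) ^ 2 * d ^ 2 - P := by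
    linear_combination (P : ℂ) ^ 2 * d * hP' - P * hQ'
  have hβ : (P : ℂ) ^ 2 * β * ((P : ℂ) ^ 2 * (d : ℂ) ^ 2 - 1) = (P - 1) * (P * d) := by
    linear_combination (P : ℂ) ^ 2 * d * hQ' - P * hP'
  rw [eq_comm, ← sub_eq_zero, ← mul_left_inj' hN, zero_mul]
  field_simp
  linear_combination -t * hα - hβ
end
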